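/- For every integer N ≥ 1, qp_3(N) ≤ 2^(26N), i.e., the number of 3-quasi-plane graphs on any set of N points in the plane in general position is at most 2^(26N). -/

import Mathlib

open scoped Classical

noncomputable section

/-- A point in the plane. -/
abbrev Pt : Type := ℝ × ℝ

/-- `S` is in general position: no three distinct points of `S` are collinear. -/
def GenPos (S : Finset Pt) : Prop :=
  ∀ p ∈ S, ∀ q ∈ S, ∀ r ∈ S, p ≠ q → p ≠ r → q ≠ r →
    ¬ Collinear ℝ ({p, q, r} : Set Pt)

/-- Two straight edges cross if their relative interiors (open segments) meet. -/
def EdgesCross (e f : Sym2 Pt) : Prop :=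
  ∃ a b c d : Pt, e = s(a, b) ∧ f = s(c, d) ∧
    (openSegment ℝ a b ∩ openSegment ℝ c d).Nonempty

/-- `G` is a crossing-free straight-edge (plane) graph on the point set `S`:
its edges are nondegenerate straight segments between points of `S`,
and no two distinct edges cross. -/
def IsPlaneGraph (S : Finset Pt) (G : Finset (Sym2 Pt)) : Prop :=
  (∀ e ∈ G, ¬ e.IsDiag ∧ ∀ p ∈ e, p ∈ S) ∧
    ∀ e ∈ G, ∀ f ∈ G, e ≠ f → ¬ EdgesCross e f

/-- The (finite) collection of all plane graphs on `S`. -/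
def planeGraphs (S : Finset Pt) : Finset (Finset (Sym2 Pt)) :=
  S.sym2.powerset.filter (IsPlaneGraph S)

/-- The degree of the point `p` in the graph `G`. -/
def vingDeg (G : Finset (Sym2 Pt)) (p : Pt) : ℕ :=
  (G.filter fun e => p ∈ e).card

/-- The ving `(p, G)` is an x-ving: no straight edge from `p` to another point
of `S` can be added to `G` while keeping the graph plane. -/
def IsXVing (S : Finset Pt) (G : Finset (Sym2 Pt)) (p : Pt) : Prop :=
  ∀ q ∈ S, q ≠ p → s(p, q) ∉ G → ¬ IsPlaneGraph S (insert s(p, q) G)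

/-- `v_x(G)`: the number of x-vings of `G`. -/
def vx (S : Finset Pt) (G : Finset (Sym2 Pt)) : ℕ :=
  (S.filter (IsXVing S G)).card

/-- `v_i(G)`: the number of vertices of degree exactly `i` in `G`. -/
def vdeg (S : Finset Pt) (G : Finset (Sym2 Pt)) (i : ℕ) : ℕ :=
  (S.filter fun p => vingDeg G p = i).card

/-- `ĥv_x(S)`: the average of `v_x(G)` over a uniformly random plane graph on `S`. -/
def hvx (S : Finset Pt) : ℝ :=
  (∑ G ∈ planeGraphs S, (vx S G : ℝ)) / (planeGraphs S).card

/-- `ĥv_i(S)`: the average of `v_i(G)` over a uniformly random plane graph on `S`. -/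
def hvdeg (S : Finset Pt) (i : ℕ) : ℝ :=
  (∑ G ∈ planeGraphs S, (vdeg S G i : ℝ)) / (planeGraphs S).card

/-- `pg(N)`: the maximum number of plane graphs over all sets of `N` points in
general position. -/
def pgMax (N : ℕ) : ℕ :=
  sSup {n : ℕ | ∃ S : Finset Pt, S.card = N ∧ GenPos S ∧ (planeGraphs S).card = n}

/-- The plane graphs on `S` with at most `m` edges. -/
def planeGraphsLE (S : Finset Pt) (m : ℝ) : Finset (Finset (Sym2 Pt)) :=
  (planeGraphs S).filter fun G => (G.card : ℝ) ≤ m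

/-- `ĥv_{x,m}(S)`: the average of `v_x(G)` over a uniformly random plane graph
on `S` with at most `m` edges. -/
def hvxLE (S : Finset Pt) (m : ℝ) : ℝ :=
  (∑ G ∈ planeGraphsLE S m, (vx S G : ℝ)) / (planeGraphsLE S m).card

/-- `G` has no vertex (point of `S`) of degree smaller than `i`. -/
def MinDegGe (S : Finset Pt) (G : Finset (Sym2 Pt)) (i : ℕ) : Prop :=
  ∀ p ∈ S, i ≤ vingDeg G p

/-- The plane graphs on `S` with no vertex of degree smaller than `i`. -/
def planeGraphsDeg (S : Finset Pt) (i : ℕ) : Finset (Finset (Sym2 Pt)) :=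
  (planeGraphs S).filter fun G => MinDegGe S G i

/-- The plane graphs on `S` with at most `m` edges and no vertex of degree
smaller than `i`. -/
def planeGraphsLEDeg (S : Finset Pt) (m : ℝ) (i : ℕ) : Finset (Finset (Sym2 Pt)) :=
  (planeGraphs S).filter fun G => (G.card : ℝ) ≤ m ∧ MinDegGe S G i

/-- `ĥv_{x,m}(S,i)`: the average of `v_x(G)` over a uniformly random plane graph
on `S` with at most `m` edges and no vertex of degree smaller than `i`. -/
def hvxLEDeg (S : Finset Pt) (m : ℝ) (i : ℕ) : ℝ :=
  (∑ G ∈ planeGraphsLEDeg S m i, (vx S G : ℝ)) / (planeGraphsLEDeg S m i).card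

/-- `pg(N, i)`: the maximum, over sets `S` of `N` points in general position, of
the number of plane graphs on `S` with no vertex of degree smaller than `i`. -/
def pgMaxDeg (N i : ℕ) : ℕ :=
  sSup {n : ℕ | ∃ S : Finset Pt, S.card = N ∧ GenPos S ∧ (planeGraphsDeg S i).card = n}

/-- The underlying abstract graph of `G` on the vertex set `S`. -/
def abstractGraph (S : Finset Pt) (G : Finset (Sym2 Pt)) :
    SimpleGraph (S : Set Pt) :=
  SimpleGraph.induce (S : Set Pt) (SimpleGraph.fromEdgeSet (G : Set (Sym2 Pt)))

/-- The connected plane graphs on `S`. -/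
def connPlaneGraphs (S : Finset Pt) : Finset (Finset (Sym2 Pt)) :=
  (planeGraphs S).filter fun G => (abstractGraph S G).Connected

/-- The underlying abstract graph of `G` is bi-connected (2-vertex-connected):
it is connected and remains connected after deletion of any single vertex. -/
def Biconnected (S : Finset Pt) (G : Finset (Sym2 Pt)) : Prop :=
  (abstractGraph S G).Connected ∧
    ∀ v ∈ S, (SimpleGraph.induce ((S : Set Pt) \ {v})
      (SimpleGraph.fromEdgeSet (G : Set (Sym2 Pt)))).Connected

/-- The bi-connected plane graphs on `S`. -/
def biconnPlaneGraphs (S : Finset Pt) : Finset (Finset (Sym2 Pt)) :=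
  (planeGraphs S).filter (Biconnected S)

/-- `G` is a `k`-quasi-plane graph on `S`: a straight-edge graph on `S`
(crossings allowed) with no `k` pairwise crossing edges. -/
def IsQuasiPlane (k : ℕ) (S : Finset Pt) (G : Finset (Sym2 Pt)) : Prop :=
  (∀ e ∈ G, ¬ e.IsDiag ∧ ∀ p ∈ e, p ∈ S) ∧
    ¬ ∃ T ⊆ G, T.card = k ∧ ∀ e ∈ T, ∀ f ∈ T, e ≠ f → EdgesCross e f

/-- The (finite) collection of all `k`-quasi-plane graphs on `S`. -/
def qpGraphs (k : ℕ) (S : Finset Pt) : Finset (Finset (Sym2 Pt)) :=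
  S.sym2.powerset.filter (IsQuasiPlane k S)

/-- The ving `(p, G)` is an x-ving of the `k`-quasi-plane graph `G`: no straight
edge from `p` to another point of `S` can be added to `G` without violating
`k`-quasi-planarity. -/
def IsXVingQP (k : ℕ) (S : Finset Pt) (G : Finset (Sym2 Pt)) (p : Pt) : Prop :=
  ∀ q ∈ S, q ≠ p → s(p, q) ∉ G → ¬ IsQuasiPlane k S (insert s(p, q) G)

/-- `v_x(G)` for a `k`-quasi-plane graph `G`. -/
def vxQP (k : ℕ) (S : Finset Pt) (G : Finset (Sym2 Pt)) : ℕ :=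
  (S.filter (IsXVingQP k S G)).card

/-- `ĥv_x^k(S)`: the average of `v_x(G)` over a uniformly random `k`-quasi-plane
graph on `S`. -/
def hvxQP (k : ℕ) (S : Finset Pt) : ℝ :=
  (∑ G ∈ qpGraphs k S, (vxQP k S G : ℝ)) / (qpGraphs k S).card

/-- `qp_k(N)`: the maximum number of `k`-quasi-plane graphs over all sets of `N`
points in general position. -/
def qpMax (k N : ℕ) : ℕ :=
  sSup {n : ℕ | ∃ S : Finset Pt, S.card = N ∧ GenPos S ∧ (qpGraphs k S).card = n}

/-! ### Affine geometry of the plane in coordinates -/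

/-- The point `p + t (q - p)`. -/
def lerp (p q : Pt) (t : ℝ) : Pt := (p.1 + t * (q.1 - p.1), p.2 + t * (q.2 - p.2))

/-- Twice the signed area of the triangle `a b c`; positive when `c` is to the left of `a b`. -/
def ori (a b c : Pt) : ℝ := (b.1 - a.1) * (c.2 - a.2) - (b.2 - a.2) * (c.1 - a.1)

/-- `z` is in the open segment from `p` to `q`. -/
def OSeg (p z q : Pt) : Prop := ∃ t, 0 < t ∧ t < 1 ∧ z = lerp p q t

/-- `z` is in the closed segment from `p` to `q`. -/
def Seg (p z q : Pt) : Prop := ∃ t, 0 ≤ t ∧ t ≤ 1 ∧ z = lerp p q t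

/-- `f` is an affine function on the plane. -/
def IsAff (f : Pt → ℝ) : Prop := ∃ u v w, ∀ x, f x = u * x.1 + v * x.2 + w

theorem IsAff.lerp {f : Pt → ℝ} (hf : IsAff f) (p q : Pt) (t : ℝ) :
    f (lerp p q t) = f p + t * (f q - f p) := by
  obtain ⟨u, v, w, h⟩ := hf
  simp only [h, _root_.lerp]; ring

theorem isAff_ori (a b : Pt) : IsAff (ori a b) :=
  ⟨-(b.2 - a.2), b.1 - a.1, -(b.1 - a.1) * a.2 + (b.2 - a.2) * a.1, fun x => by
    simp only [ori]; ring⟩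

theorem isAff_ori_mid (a b : Pt) : IsAff (fun x => ori a x b) :=
  ⟨b.2 - a.2, -(b.1 - a.1), -(b.2 - a.2) * a.1 + (b.1 - a.1) * a.2, fun x => by
    simp only [ori]; ring⟩

theorem IsAff.comb {f g : Pt → ℝ} (hf : IsAff f) (hg : IsAff g) (a b c : ℝ) :
    IsAff (fun x => a * f x + b * g x + c) := by
  obtain ⟨u, v, w, h⟩ := hf
  obtain ⟨u', v', w', h'⟩ := hg
  exact ⟨a * u + b * u', a * v + b * v', a * w + b * w' + c, fun x => by simp only [h, h']; ring⟩

theorem IsAff.neg {f : Pt → ℝ} (hf : IsAff f) : IsAff (fun x => -f x) := by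
  obtain ⟨u, v, w, h⟩ := hf
  exact ⟨-u, -v, -w, fun x => by simp only [h]; ring⟩

theorem IsAff.div_const {f : Pt → ℝ} (hf : IsAff f) (c : ℝ) : IsAff (fun x => f x / c) := by
  obtain ⟨u, v, w, h⟩ := hf
  exact ⟨u / c, v / c, w / c, fun x => by simp only [h]; ring⟩

theorem ori_self_left (a b : Pt) : ori a a b = 0 := by simp [ori]
theorem ori_self_mid (a b : Pt) : ori a b a = 0 := by simp [ori]
theorem ori_self_right (a b : Pt) : ori a b b = 0 := by simp only [ori]; ring
theorem ori_rot (a b c : Pt) : ori b c a = ori a b c := by simp only [ori]; ring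
theorem ori_swap (a b c : Pt) : ori b a c = -ori a b c := by simp only [ori]; ring
theorem ori_swap_right (a b c : Pt) : ori a c b = -ori a b c := by simp only [ori]; ring

theorem ne_of_ori_ne {a b c : Pt} (h : ori a b c ≠ 0) : a ≠ b := by
  rintro rfl; exact h (ori_self_left _ _)

theorem lerp_zero (p q : Pt) : lerp p q 0 = p := by ext <;> simp [lerp]
theorem lerp_one (p q : Pt) : lerp p q 1 = q := by ext <;> simp [lerp]

theorem lerp_comm (p q : Pt) (t : ℝ) : lerp p q t = lerp q p (1 - t) := by
  ext <;> simp only [lerp] <;> ring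

theorem lerp_lerp (p q : Pt) (s t u : ℝ) :
    lerp (lerp p q s) (lerp p q t) u = lerp p q (s + u * (t - s)) := by
  ext <;> simp only [lerp] <;> ring

theorem lerp_lerp_right (p q : Pt) (t u : ℝ) : lerp p (lerp p q t) u = lerp p q (u * t) := by
  ext <;> simp only [lerp] <;> ring

theorem lerp_inj {p q : Pt} (h : p ≠ q) {s t : ℝ} (e : lerp p q s = lerp p q t) : s = t := by
  have h1 := congrArg Prod.fst e
  have h2 := congrArg Prod.snd e
  simp only [lerp] at h1 h2
  by_contra hst
  have e1 : (s - t) * (q.1 - p.1) = 0 := by linarith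
  have e2 : (s - t) * (q.2 - p.2) = 0 := by linarith
  have := sub_ne_zero.2 hst
  apply h
  ext
  · rcases mul_eq_zero.1 e1 with h | h
    · exact absurd h this
    · linarith
  · rcases mul_eq_zero.1 e2 with h | h
    · exact absurd h this
    · linarith

theorem OSeg.symm {p z q : Pt} (h : OSeg p z q) : OSeg q z p := by
  obtain ⟨t, h0, h1, rfl⟩ := h
  exact ⟨1 - t, by linarith, by linarith, lerp_comm _ _ _⟩

theorem Seg.symm {p z q : Pt} (h : Seg p z q) : Seg q z p := by
  obtain ⟨t, h0, h1, rfl⟩ := h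
  exact ⟨1 - t, by linarith, by linarith, lerp_comm _ _ _⟩

theorem OSeg.seg {p z q : Pt} (h : OSeg p z q) : Seg p z q := by
  obtain ⟨t, h0, h1, rfl⟩ := h
  exact ⟨t, h0.le, h1.le, rfl⟩

theorem Seg.left (p q : Pt) : Seg p p q := ⟨0, le_rfl, zero_le_one, (lerp_zero _ _).symm⟩
theorem Seg.right (p q : Pt) : Seg p q q := ⟨1, zero_le_one, le_rfl, (lerp_one _ _).symm⟩

theorem Seg.cases {p z q : Pt} (h : Seg p z q) : z = p ∨ z = q ∨ OSeg p z q := by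
  obtain ⟨t, h0, h1, rfl⟩ := h
  rcases h0.eq_or_lt with rfl | h0
  · exact Or.inl (lerp_zero _ _)
  rcases h1.eq_or_lt with rfl | h1
  · exact Or.inr (Or.inl (lerp_one _ _))
  · exact Or.inr (Or.inr ⟨t, h0, h1, rfl⟩)

theorem Seg.lerp {p x y q : Pt} (hx : Seg p x q) (hy : Seg p y q) {t : ℝ} (h0 : 0 ≤ t)
    (h1 : t ≤ 1) : Seg p (lerp x y t) q := by
  obtain ⟨a, a0, a1, rfl⟩ := hx
  obtain ⟨b, b0, b1, rfl⟩ := hy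
  exact ⟨a + t * (b - a), by nlinarith, by nlinarith, lerp_lerp _ _ _ _ _⟩

theorem Seg.trans {p x y q z : Pt} (hx : Seg p x q) (hy : Seg p y q) (hz : Seg x z y) :
    Seg p z q := by
  obtain ⟨t, h0, h1, rfl⟩ := hz
  exact hx.lerp hy h0 h1

theorem OSeg.lerp {p x y q : Pt} (hx : OSeg p x q) (hy : Seg p y q) {t : ℝ} (h0 : 0 ≤ t)
    (h1 : t < 1) : OSeg p (lerp x y t) q := by
  obtain ⟨a, a0, a1, rfl⟩ := hx
  obtain ⟨b, b0, b1, rfl⟩ := hy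
  exact ⟨a + t * (b - a), by nlinarith, by nlinarith, lerp_lerp _ _ _ _ _⟩

theorem OSeg.mono {p x y q z : Pt} (hx : Seg p x q) (hy : Seg p y q) (hz : OSeg x z y) :
    p ≠ q → x ≠ y → OSeg p z q := by
  intro _ hxy
  obtain ⟨t, h0, h1, rfl⟩ := hz
  obtain ⟨a, a0, a1, rfl⟩ := hx
  obtain ⟨b, b0, b1, rfl⟩ := hy
  have hab : a ≠ b := by rintro rfl; exact hxy rfl
  refine ⟨a + t * (b - a), ?_, ?_, lerp_lerp _ _ _ _ _⟩
  · rcases a0.eq_or_lt with rfl | h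
    · have : 0 < b := lt_of_le_of_ne b0 hab
      nlinarith
    · nlinarith
  · rcases a1.eq_or_lt with rfl | h
    · have : b < 1 := lt_of_le_of_ne b1 hab.symm
      nlinarith
    · nlinarith

/-- A point collinear with two distinct points is on the line they span. -/
theorem exists_lerp_of_ori_eq_zero {p q z : Pt} (h : p ≠ q) (hz : ori p q z = 0) :
    ∃ t, z = lerp p q t := by
  have hn : (q.1 - p.1) ^ 2 + (q.2 - p.2) ^ 2 ≠ 0 := by
    intro h0
    apply h
    ext <;> nlinarith [sq_nonneg (q.1 - p.1), sq_nonneg (q.2 - p.2)]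
  refine ⟨((z.1 - p.1) * (q.1 - p.1) + (z.2 - p.2) * (q.2 - p.2)) /
    ((q.1 - p.1) ^ 2 + (q.2 - p.2) ^ 2), ?_⟩
  simp only [ori] at hz
  ext
  · simp only [lerp]; field_simp
    linear_combination (-(q.2 - p.2)) * hz
  · simp only [lerp]; field_simp
    linear_combination (q.1 - p.1) * hz

theorem ori_lerp_same (p q : Pt) (t : ℝ) : ori p q (lerp p q t) = 0 := by
  simp only [ori, lerp]; ring

theorem ori_eq_zero_of_seg {p z q : Pt} (h : Seg p z q) : ori p q z = 0 := by
  obtain ⟨t, _, _, rfl⟩ := h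
  exact ori_lerp_same _ _ _

/-- First coordinate of `x` in the affine frame `o, m, n`. -/
def crdA (o m n x : Pt) : ℝ := ori o x n / ori o m n

/-- Second coordinate of `x` in the affine frame `o, m, n`. -/
def crdB (o m n x : Pt) : ℝ := ori o m x / ori o m n

theorem isAff_crdA (o m n : Pt) : IsAff (crdA o m n) := (isAff_ori_mid o n).div_const _
theorem isAff_crdB (o m n : Pt) : IsAff (crdB o m n) := (isAff_ori o m).div_const _

/-- An affine function in the coordinates of the frame `o, m, n`. -/
theorem IsAff.crd {f : Pt → ℝ} (hf : IsAff f) {o m n : Pt} (hK : ori o m n ≠ 0) (x : Pt) :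
    f x = f o + crdA o m n x * (f m - f o) + crdB o m n x * (f n - f o) := by
  obtain ⟨u, v, w, h⟩ := hf
  simp only [h, crdA, crdB]
  field_simp
  simp only [ori]
  ring

theorem crd_ext {o m n x y : Pt} (hK : ori o m n ≠ 0) (ha : crdA o m n x = crdA o m n y)
    (hb : crdB o m n x = crdB o m n y) : x = y := by
  have h1 : IsAff (fun z : Pt => z.1) := ⟨1, 0, 0, fun x => by ring⟩
  have h2 : IsAff (fun z : Pt => z.2) := ⟨0, 1, 0, fun x => by ring⟩
  ext
  · have e1 := h1.crd hK x
    have e2 := h1.crd hK y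
    rw [ha, hb] at e1
    exact e1.trans e2.symm
  · have e1 := h2.crd hK x
    have e2 := h2.crd hK y
    rw [ha, hb] at e1
    exact e1.trans e2.symm

@[simp] theorem crdA_o (o m n : Pt) : crdA o m n o = 0 := by simp [crdA, ori_self_left]
@[simp] theorem crdB_o (o m n : Pt) : crdB o m n o = 0 := by simp [crdB, ori_self_mid]
theorem crdA_m {o m n : Pt} (hK : ori o m n ≠ 0) : crdA o m n m = 1 := by simp [crdA, hK]
theorem crdB_n {o m n : Pt} (hK : ori o m n ≠ 0) : crdB o m n n = 1 := by simp [crdB, hK]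
@[simp] theorem crdA_n (o m n : Pt) : crdA o m n n = 0 := by simp [crdA, ori_self_right]
@[simp] theorem crdB_m (o m n : Pt) : crdB o m n m = 0 := by simp [crdB, ori_self_right]

/-- Two decreasing linear functions: the first time at which one of them vanishes. -/
theorem exists_first_zero {a0 a1 b0 b1 : ℝ} (ha : 0 < a0) (hb : 0 < b0)
    (h : a1 ≤ 0 ∨ b1 ≤ 0) : ∃ t, 0 < t ∧ t ≤ 1 ∧ 0 ≤ a0 + t * (a1 - a0) ∧
      0 ≤ b0 + t * (b1 - b0) ∧ (a0 + t * (a1 - a0) = 0 ∨ b0 + t * (b1 - b0) = 0) := by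
  have aux : ∀ a0 a1 : ℝ, 0 < a0 → a1 ≤ 0 → 0 < a0 / (a0 - a1) ∧ a0 / (a0 - a1) ≤ 1 ∧
      a0 + a0 / (a0 - a1) * (a1 - a0) = 0 := by
    intro a0 a1 h0 h1
    have : 0 < a0 - a1 := by linarith
    refine ⟨by positivity, by rw [div_le_one this]; linarith, ?_⟩
    field_simp; ring
  rcases h with h | h
  · obtain ⟨t0, t1, te⟩ := aux a0 a1 ha h
    set t := a0 / (a0 - a1)
    by_cases hbt : 0 ≤ b0 + t * (b1 - b0)
    · exact ⟨t, t0, t1, te.ge, hbt, Or.inl te⟩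
    · obtain ⟨s0, s1, se⟩ := aux b0 (b0 + t * (b1 - b0)) hb (not_le.1 hbt).le
      set s := b0 / (b0 - (b0 + t * (b1 - b0)))
      refine ⟨s * t, by positivity, by nlinarith, ?_, ?_, Or.inr ?_⟩
      · nlinarith
      · linarith
      · linarith
  · obtain ⟨t0, t1, te⟩ := aux b0 b1 hb h
    set t := b0 / (b0 - b1)
    by_cases hat : 0 ≤ a0 + t * (a1 - a0)
    · exact ⟨t, t0, t1, hat, te.ge, Or.inr te⟩
    · obtain ⟨s0, s1, se⟩ := aux a0 (a0 + t * (a1 - a0)) ha (not_le.1 hat).le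
      set s := a0 / (a0 - (a0 + t * (a1 - a0)))
      refine ⟨s * t, by positivity, by nlinarith, ?_, ?_, Or.inl ?_⟩
      · linarith
      · nlinarith
      · linarith

/-! ### Plane nets -/

/-- A finite plane straight-line graph whose vertices are `V` and whose adjacency relation is `A`,
in which every vertex sees the hull of `V` through convex angles only. -/
structure PlaneNet (V : Finset Pt) (A : Pt → Pt → Prop) : Prop where
  symm : ∀ {p q}, A p q → A q p
  ne : ∀ {p q}, A p q → p ≠ q
  mem : ∀ {p q}, A p q → p ∈ V
  empty : ∀ {p q z}, A p q → z ∈ V → ¬ OSeg p z q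
  disj : ∀ {p q r s z}, A p q → A r s → OSeg p z q → OSeg r z s → (p = r ∧ q = s) ∨ (p = s ∧ q = r)
  ext : ∀ {p s} {f : Pt → ℝ}, p ∈ V → s ∈ V → IsAff f → f p < f s → ∃ q, A p q ∧ f p < f q

namespace PlaneNet

variable {V : Finset Pt} {A : Pt → Pt → Prop} (h : PlaneNet V A)
include h

theorem mem' {p q : Pt} (e : A p q) : q ∈ V := h.mem (h.symm e)

/-- Neighbours of `q` in the same direction coincide. -/
theorem eq_of_same_dir {q r r' : Pt} (e : A q r) (e' : A q r') (h0 : ori q r r' = 0)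
    {f : Pt → ℝ} (hf : IsAff f) (hr : f q < f r) (hr' : f q < f r') : r = r' := by
  obtain ⟨k, rfl⟩ := exists_lerp_of_ori_eq_zero (h.ne e) h0
  rw [hf.lerp] at hr'
  have hk : 0 < k := by
    by_contra hk
    nlinarith [mul_nonneg (neg_nonneg.2 (not_lt.1 hk)) (sub_pos.2 hr).le]
  have hlt : min 1 k / 2 < 1 := by have := min_le_left 1 k; linarith
  have hpos : 0 < min 1 k / 2 := by have := lt_min one_pos hk; linarith
  have hb : OSeg q (lerp q r (min 1 k / 2)) (lerp q r k) := by
    refine ⟨min 1 k / 2 / k, by positivity, ?_, ?_⟩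
    · rw [div_lt_one hk]; have := min_le_right 1 k; linarith
    · rw [lerp_lerp_right, div_mul_cancel₀ _ hk.ne']
  rcases h.disj e e' ⟨_, hpos, hlt, rfl⟩ hb with ⟨_, h2⟩ | ⟨h1, _⟩
  · exact h2
  · exact absurd h1 (h.ne e')

end PlaneNet

/-- `(q, r)` is the dart following `(p, q)` along the face to the left of `(p, q)`. -/
def Next (A : Pt → Pt → Prop) (p q r : Pt) : Prop :=
  A p q ∧ A q r ∧ 0 < ori p q r ∧ ∀ s, A q s → 0 < ori p q s → ori s q r ≤ 0

/-- The inner darts: those with a vertex on their left. -/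
def innerDarts (V : Finset Pt) (A : Pt → Pt → Prop) : Finset (Pt × Pt) :=
  (V ×ˢ V).filter fun x => A x.1 x.2 ∧ ∃ s ∈ V, 0 < ori x.1 x.2 s

/-- The type of inner darts. -/
abbrev Dart (V : Finset Pt) (A : Pt → Pt → Prop) : Type := {x : Pt × Pt // x ∈ innerDarts V A}

namespace PlaneNet

variable {V : Finset Pt} {A : Pt → Pt → Prop} (h : PlaneNet V A)
include h

theorem mem_innerDarts {p q s : Pt} (e : A p q) (hs : s ∈ V) (ho : 0 < ori p q s) :
    (p, q) ∈ innerDarts V A := by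
  simp only [innerDarts, Finset.mem_filter, Finset.mem_product]
  exact ⟨⟨h.mem e, h.mem' e⟩, e, s, hs, ho⟩

omit h in
theorem _root_.Dart.adj (d : Dart V A) : A d.1.1 d.1.2 := by
  have := d.2
  simp only [innerDarts, Finset.mem_filter] at this
  exact this.2.1

omit h in
theorem _root_.Dart.left (d : Dart V A) : ∃ s ∈ V, 0 < ori d.1.1 d.1.2 s := by
  have := d.2
  simp only [innerDarts, Finset.mem_filter] at this
  exact this.2.2

theorem exists_next {p q s : Pt} (e : A p q) (hs : s ∈ V) (ho : 0 < ori p q s) :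
    ∃ r, Next A p q r := by
  obtain ⟨r0, hr0, hr0'⟩ := h.ext (h.mem' e) hs (isAff_ori p q)
    (by rwa [ori_self_right])
  rw [ori_self_right] at hr0'
  obtain ⟨r, hr, hmin⟩ := Finset.exists_min_image (V.filter fun r => A q r ∧ 0 < ori p q r)
    (fun r => ((q.1 - p.1) * (r.1 - q.1) + (q.2 - p.2) * (r.2 - q.2)) / ori p q r)
    ⟨r0, by simp [h.mem' hr0, hr0, hr0']⟩
  simp only [Finset.mem_filter] at hr hmin
  refine ⟨r, e, hr.2.1, hr.2.2, fun s hs hos => ?_⟩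
  have := hmin s ⟨h.mem' hs, hs, hos⟩
  rw [div_le_div_iff₀ hr.2.2 hos] at this
  have hn : 0 < (q.1 - p.1) ^ 2 + (q.2 - p.2) ^ 2 := by
    by_contra h0
    apply h.ne e
    ext <;> nlinarith [sq_nonneg (q.1 - p.1), sq_nonneg (q.2 - p.2)]
  have key : ((q.1 - p.1) ^ 2 + (q.2 - p.2) ^ 2) * ori s q r ≤ 0 := by
    simp only [ori] at this ⊢
    nlinarith
  by_contra hc
  nlinarith [mul_pos hn (not_le.1 hc)]

theorem next_inj {p p' q r : Pt} (h1 : Next A p q r) (h2 : Next A p' q r) : p = p' := by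
  have : ori p q p' = 0 := by
    rcases lt_trichotomy (ori p q p') 0 with hlt | h0 | hgt
    · have := h2.2.2.2 p (h.symm h1.1) (by simp only [ori] at *; linarith)
      exact absurd h1.2.2.1 (not_lt.2 this)
    · exact h0
    · have := h1.2.2.2 p' (h.symm h2.1) hgt
      exact absurd h2.2.2.1 (not_lt.2 this)
  refine h.eq_of_same_dir (h.symm h1.1) (h.symm h2.1) ?_ (isAff_ori q r) ?_ ?_
  · simp only [ori] at *; linarith
  · rw [ori_self_mid, ori_rot]; exact h1.2.2.1
  · rw [ori_self_mid, ori_rot]; exact h2.2.2.1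

theorem next_inner {p q r : Pt} (h1 : Next A p q r) : (q, r) ∈ innerDarts V A :=
  h.mem_innerDarts h1.2.1 (h.mem h1.1) (by rw [ori_rot]; exact h1.2.2.1)

theorem exists_next_dart (d : Dart V A) : ∃ d' : Dart V A, Next A d.1.1 d.1.2 d'.1.2 ∧
    d'.1.1 = d.1.2 := by
  obtain ⟨s, hs, ho⟩ := d.left
  obtain ⟨r, hr⟩ := h.exists_next d.adj hs ho
  exact ⟨⟨_, h.next_inner hr⟩, hr, rfl⟩

/-- The face permutation of the inner darts. -/
def φ : Equiv.Perm (Dart V A) :=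
  Equiv.ofBijective (fun d => (h.exists_next_dart d).choose) <| by
    rw [← Finite.injective_iff_bijective]
    intro d d' hd
    obtain ⟨h1, h2⟩ := (h.exists_next_dart d).choose_spec
    obtain ⟨h1', h2'⟩ := (h.exists_next_dart d').choose_spec
    simp only at hd
    rw [hd] at h1 h2
    have e : d.1.2 = d'.1.2 := h2.symm.trans h2'
    rw [e] at h1
    exact Subtype.ext (Prod.ext (h.next_inj h1 h1') e)

theorem φ_next (d : Dart V A) : Next A d.1.1 d.1.2 (h.φ d).1.2 :=
  (h.exists_next_dart d).choose_spec.1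

theorem φ_fst (d : Dart V A) : (h.φ d).1.1 = d.1.2 :=
  (h.exists_next_dart d).choose_spec.2

theorem φ_left (d : Dart V A) : 0 < ori d.1.1 d.1.2 (h.φ d).1.2 := (h.φ_next d).2.2.1

theorem φ_symm_snd (d : Dart V A) : (h.φ.symm d).1.2 = d.1.1 := by
  have := h.φ_fst (h.φ.symm d)
  rw [Equiv.apply_symm_apply] at this
  exact this.symm

theorem φ_symm_next (d : Dart V A) : Next A (h.φ.symm d).1.1 d.1.1 d.1.2 := by
  have := h.φ_next (h.φ.symm d)
  rwa [Equiv.apply_symm_apply, h.φ_symm_snd] at this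

end PlaneNet

/-! ### Empty triangles -/

/-- `x` is in the triangle `o m n` but not on its sides at `o`. -/
def InT (o m n x : Pt) : Prop :=
  0 < crdA o m n x ∧ 0 < crdB o m n x ∧ crdA o m n x + crdB o m n x ≤ 1

theorem eq_lerp_of_crdA_eq_zero {o m n y : Pt} (hK : ori o m n ≠ 0) (ha : crdA o m n y = 0) :
    y = lerp o n (crdB o m n y) := by
  apply crd_ext hK
  · rw [(isAff_crdA o m n).lerp]; simp [ha]
  · rw [(isAff_crdB o m n).lerp]; simp [crdB_n hK]

theorem eq_lerp_of_crdB_eq_zero {o m n y : Pt} (hK : ori o m n ≠ 0) (hb : crdB o m n y = 0) :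
    y = lerp o m (crdA o m n y) := by
  apply crd_ext hK
  · rw [(isAff_crdA o m n).lerp]; simp [crdA_m hK]
  · rw [(isAff_crdB o m n).lerp]; simp [hb]

/-- A segment from `x` in the triangle `o m n` out of the angle at `o` meets one of the
sides at `o`. -/
theorem InT.exit {o m n x e : Pt} (hK : ori o m n ≠ 0) (hx : InT o m n x)
    (he : crdA o m n e ≤ 0 ∨ crdB o m n e ≤ 0) :
    ∃ t u, 0 < t ∧ t ≤ 1 ∧ 0 ≤ u ∧
      u = (crdA o m n x + crdB o m n x) +
        t * ((crdA o m n e + crdB o m n e) - (crdA o m n x + crdB o m n x)) ∧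
      (lerp x e t = lerp o m u ∨ lerp x e t = lerp o n u) := by
  obtain ⟨t, t0, t1, h1, h2, h3⟩ := exists_first_zero hx.1 hx.2.1 he
  rw [← (isAff_crdA o m n).lerp] at h1 h3
  rw [← (isAff_crdB o m n).lerp] at h2 h3
  have ea := (isAff_crdA o m n).lerp x e t
  have eb := (isAff_crdB o m n).lerp x e t
  refine ⟨t, crdA o m n (lerp x e t) + crdB o m n (lerp x e t), t0, t1, by linarith,
    by linarith, ?_⟩
  rcases h3 with h3 | h3
  · right; rw [h3, zero_add]; exact eq_lerp_of_crdA_eq_zero hK h3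
  · left; rw [h3, add_zero]; exact eq_lerp_of_crdB_eq_zero hK h3

namespace PlaneNet

variable {V : Finset Pt} {A : Pt → Pt → Prop} (h : PlaneNet V A)
include h

/-- If the edges meeting the sides at `o` of the triangle `o m n` do not enter the triangle and
no edge spans `m n`, then no edge meets the triangle. -/
theorem triangle_free {o m n : Pt} (hK : ori o m n ≠ 0)
    (H : ∀ p q x y t, A p q → Seg p x q → Seg p y q → InT o m n x → 0 ≤ t → t < 1 →
      (y = lerp o m t ∨ y = lerp o n t) → False)
    (hs : ∃ s ∈ V, crdA o m n s + crdB o m n s ≤ 0)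
    (hmn : ∀ p q, A p q → Seg p m q → Seg p n q → False) :
    ∀ p q x, A p q → Seg p x q → ¬ InT o m n x := by
  have hsum : IsAff (fun x => -(crdA o m n x + crdB o m n x)) := by
    have := ((isAff_crdA o m n).comb (isAff_crdB o m n) 1 1 0).neg
    simpa using this
  have hV : ∀ v ∈ V, ¬ InT o m n v := by
    by_contra! hc
    obtain ⟨v0, hv0, hv0'⟩ := hc
    obtain ⟨v, hv, hmin⟩ := Finset.exists_min_image (V.filter (InT o m n))
      (fun x => crdA o m n x + crdB o m n x) ⟨v0, by simp [hv0, hv0']⟩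
    simp only [Finset.mem_filter] at hv hmin
    obtain ⟨s, hs, hs'⟩ := hs
    obtain ⟨q, hq, hq'⟩ := h.ext hv.1 hs hsum (by have := hv.2.1; have := hv.2.2.1; linarith)
    have hqT : ¬ InT o m n q := fun hT => by have := hmin q ⟨h.mem' hq, hT⟩; linarith
    have he : crdA o m n q ≤ 0 ∨ crdB o m n q ≤ 0 := by
      by_contra! hc
      exact hqT ⟨hc.1, hc.2, by have := hv.2.2.2; linarith⟩
    obtain ⟨t, u, t0, t1, u0, hu, hy⟩ := hv.2.exit hK he
    refine H v q v (lerp v q t) u hq (Seg.left _ _) ((Seg.left _ _).lerp (Seg.right _ _) t0.le t1)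
      hv.2 u0 ?_ hy
    have := hv.2.2.2
    nlinarith
  intro p q x hA hx hT
  have key : ∀ e, e ∈ V → Seg p e q →
      crdA o m n x + crdB o m n x ≤ crdA o m n e + crdB o m n e ∧
      (crdA o m n x + crdB o m n x = crdA o m n e + crdB o m n e → ∃ t, 0 < t ∧ t ≤ 1 ∧
        (lerp x e t = m ∨ lerp x e t = n)) := by
    intro e heV he
    by_cases hab : crdA o m n e ≤ 0 ∨ crdB o m n e ≤ 0
    · obtain ⟨t, u, t0, t1, u0, hu, hy⟩ := hT.exit hK hab
      have hu1 : 1 ≤ u := by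
        by_contra! hu1
        exact H p q x _ u hA hx (hx.lerp he t0.le t1) hT u0 hu1 hy
      have := hT.2.2
      refine ⟨?_, fun heq => ⟨t, t0, t1, ?_⟩⟩
      · by_contra! hc
        nlinarith
      · have : u = 1 := by rw [← heq] at hu; linarith
        rw [this, lerp_one, lerp_one] at hy
        exact hy
    · push Not at hab
      have : ¬ crdA o m n e + crdB o m n e ≤ 1 := fun h1 => hV e heV ⟨hab.1, hab.2, h1⟩
      have h2 := hT.2.2
      exact ⟨by linarith, fun heq => by linarith⟩
  obtain ⟨hp1, hp2⟩ := key p (h.mem hA) (Seg.left _ _)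
  obtain ⟨hq1, hq2⟩ := key q (h.mem' hA) (Seg.right _ _)
  have hxp : x ≠ p := by rintro rfl; exact hV _ (h.mem hA) hT
  have hxq : x ≠ q := by rintro rfl; exact hV _ (h.mem' hA) hT
  obtain ⟨r, r0, r1, rfl⟩ := (hx.cases.resolve_left hxp).resolve_left hxq
  have ea := (isAff_crdA o m n).lerp p q r
  have eb := (isAff_crdB o m n).lerp p q r
  set x := lerp p q r
  have e1 : crdA o m n x + crdB o m n x = crdA o m n p + crdB o m n p := by nlinarith
  have e2 : crdA o m n x + crdB o m n x = crdA o m n q + crdB o m n q := by nlinarith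
  obtain ⟨t, t0, t1, ht⟩ := hp2 e1
  obtain ⟨t', t0', t1', ht'⟩ := hq2 e2
  have sp := hx.lerp (Seg.left p q) t0.le t1
  have sq := hx.lerp (Seg.right p q) t0'.le t1'
  have a1 := (isAff_crdA o m n).lerp x p t
  have a2 := (isAff_crdA o m n).lerp x q t'
  have hxa := hT.1
  have hxb := hT.2.1
  have hx1 := hT.2.2
  rcases ht with ht | ht <;> rcases ht' with ht' | ht' <;> rw [ht] at sp a1 <;>
    rw [ht'] at sq a2
  · rw [crdA_m hK] at a1 a2
    have i1 : crdA o m n x < crdA o m n p := by nlinarith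
    have i2 : crdA o m n x < crdA o m n q := by nlinarith
    nlinarith
  · exact hmn p q hA sp sq
  · exact hmn p q hA sq sp
  · rw [crdA_n] at a1 a2
    have i1 : crdA o m n p < crdA o m n x := by nlinarith
    have i2 : crdA o m n q < crdA o m n x := by nlinarith
    nlinarith

/-! ### Visibility within a face -/

omit h in
/-- The points at parameter `l` on the two darts see each other on their left sides. -/
def _root_.Vis (A : Pt → Pt → Prop) (l : ℝ) (p q p' q' : Pt) : Prop :=
  0 < ori p q (lerp p' q' l) ∧ 0 < ori p' q' (lerp p q l) ∧
    ∀ a b z, A a b → Seg a z b → ¬ OSeg (lerp p q l) z (lerp p' q' l)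

/-- An edge meeting an edge at an interior point is that edge. -/
theorem eq_of_seg {p q r s z : Pt} (e : A p q) (e' : A r s) (hz : OSeg p z q) (hz' : Seg r z s) :
    (p = r ∧ q = s) ∨ (p = s ∧ q = r) := by
  rcases hz'.cases with rfl | rfl | hz'
  · exact absurd hz (h.empty e (h.mem e'))
  · exact absurd hz (h.empty e (h.mem' e'))
  · exact h.disj e e' hz hz'

omit h in
theorem _root_.Seg.of_eq {p q r s z : Pt} (he : (p = r ∧ q = s) ∨ (p = s ∧ q = r)) (hz : Seg r z s) :
    Seg p z q := by
  rcases he with ⟨rfl, rfl⟩ | ⟨rfl, rfl⟩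
  · exact hz
  · exact hz.symm

/-- A vertex lying on an edge is one of its ends. -/
theorem eq_of_mem_seg {p q z : Pt} (e : A p q) (hz : z ∈ V) (hs : Seg p z q) : z = p ∨ z = q := by
  rcases hs.cases with h1 | h1 | h1
  · exact Or.inl h1
  · exact Or.inr h1
  · exact absurd h1 (h.empty e hz)

omit h in
theorem _root_.InT.of_lerp {o m n : Pt} (hK : ori o m n ≠ 0) {t : ℝ} (h0 : 0 < t) (h1 : t < 1) :
    InT o m n (lerp m n t) := by
  have ea := (isAff_crdA o m n).lerp m n t
  have eb := (isAff_crdB o m n).lerp m n t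
  rw [crdA_m hK, crdA_n] at ea
  rw [crdB_n hK, crdB_m] at eb
  exact ⟨by linarith, by linarith, by linarith⟩

omit h in
theorem _root_.InT.pos {o m n x : Pt} (hx : InT o m n x) (hK : ori o m n ≠ 0) {f : Pt → ℝ}
    (hf : IsAff f) (ho : f o = 0) (hm : 0 ≤ f m) (hn : 0 ≤ f n) (hmn : 0 < f m + f n) :
    0 < f x := by
  rw [hf.crd hK x, ho]
  obtain ⟨h1, h2, _⟩ := hx
  rcases hm.eq_or_lt with hm | hm
  · rw [← hm] at hmn ⊢
    have := mul_pos h2 (by linarith : 0 < f n)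
    linarith
  · have := mul_pos h1 hm
    have := mul_nonneg h2.le hn
    linarith

theorem vis_next {l : ℝ} (l0 : 0 < l) (l1 : l < 1) {p q r : Pt} (hn : Next A p q r) :
    Vis A l p q q r := by
  obtain ⟨hpq, hqr, ho, hlast⟩ := hn
  have o1 : ori p q (lerp q r l) = l * ori p q r := by
    rw [(isAff_ori p q).lerp, ori_self_right]; ring
  have o2 : ori q r (lerp p q l) = (1 - l) * ori p q r := by
    rw [(isAff_ori q r).lerp, ori_rot, ori_self_mid]; ring
  refine ⟨by rw [o1]; positivity, by rw [o2]; exact mul_pos (by linarith) ho, ?_⟩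
  set m := lerp p q l with hm
  set n := lerp q r l with hn
  have hmb : OSeg p m q := ⟨l, l0, l1, rfl⟩
  have hnb : OSeg q n r := ⟨l, l0, l1, rfl⟩
  have hK : ori q m n ≠ 0 := by
    have : ori q m n = - (l * (1 - l)) * ori p q r := by
      simp only [hm, hn, ori, lerp]; ring
    rw [this]
    have := mul_pos (mul_pos l0 (sub_pos.2 l1)) ho
    intro h0; linarith
  have pos1 : ∀ x, InT q m n x → 0 < ori p q x := fun x hx =>
    hx.pos hK (isAff_ori p q) (ori_self_right _ _) (by rw [hm, ori_lerp_same])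
      (by rw [o1]; positivity) (by rw [o1, hm, ori_lerp_same, zero_add]; positivity)
  have pos2 : ∀ x, InT q m n x → 0 < ori q r x := fun x hx =>
    hx.pos hK (isAff_ori q r) (ori_self_mid _ _)
      (by rw [o2]; exact mul_nonneg (by linarith) ho.le)
      (by rw [hn, ori_lerp_same]) (by
        rw [o2, hn, ori_lerp_same, add_zero]; exact mul_pos (by linarith) ho)
  have free := h.triangle_free hK (o := q) (m := m) (n := n) ?_ ?_ ?_
  · rintro a b z hab hz ⟨t, t0, t1, rfl⟩
    exact free a b _ hab hz (InT.of_lerp hK t0 t1)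
  · intro a b x y t hab hx hy hT t0 t1 hyt
    rcases t0.eq_or_lt with rfl | t0
    · simp only [lerp_zero, or_self] at hyt
      subst hyt
      have hc : ∀ s, A y s → Seg y x s → False := by
        rintro s hys ⟨u, u0, u1, rfl⟩
        have p1 := pos1 _ hT
        have p2 := pos2 _ hT
        rw [(isAff_ori p y).lerp, ori_self_right] at p1
        rw [(isAff_ori y r).lerp, ori_self_mid] at p2
        have u0' : 0 < u := by
          rcases u0.eq_or_lt with rfl | u0
          · linarith
          · exact u0
        have p1' : 0 < ori p y s := by
          by_contra hc; nlinarith [mul_nonneg u0 (neg_nonneg.2 (not_lt.1 hc))]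
        have p2' : 0 < ori y r s := by
          by_contra hc; nlinarith [mul_nonneg u0 (neg_nonneg.2 (not_lt.1 hc))]
        have := hlast s hys p1'
        rw [← ori_rot] at this
        linarith
      rcases h.eq_of_mem_seg hab (h.mem hqr) hy with rfl | rfl
      · exact hc _ hab hx
      · exact hc _ (h.symm hab) hx.symm
    · rcases hyt with rfl | rfl
      · have hyb : OSeg p (lerp q m t) q := by
          rw [hm, lerp_comm p q, lerp_lerp_right]
          exact OSeg.symm ⟨_, mul_pos t0 (by linarith), by nlinarith, rfl⟩
        have := ori_eq_zero_of_seg (Seg.of_eq (h.eq_of_seg hpq hab hyb hy) hx)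
        have := pos1 _ hT
        linarith
      · have hyb : OSeg q (lerp q n t) r := by
          rw [hn, lerp_lerp_right]
          exact ⟨_, mul_pos t0 l0, by nlinarith, rfl⟩
        have := ori_eq_zero_of_seg (Seg.of_eq (h.eq_of_seg hqr hab hyb hy) hx)
        have := pos2 _ hT
        linarith
  · exact ⟨q, h.mem hqr, by simp⟩
  · intro a b hab h1 h2
    have := ori_eq_zero_of_seg (Seg.of_eq (h.eq_of_seg hpq hab hmb h1) h2)
    rw [o1] at this
    have := mul_pos l0 ho
    linarith

omit h in
theorem _root_.Vis.symm {l : ℝ} {p q p' q' : Pt} (hv : Vis A l p q p' q') : Vis A l p' q' p q :=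
  ⟨hv.2.1, hv.1, fun a b z e hs hz => hv.2.2 a b z e hs hz.symm⟩

theorem vis_trans_aux {l : ℝ} (l0 : 0 < l) (l1 : l < 1) {p q p' q' p'' q'' : Pt}
    (e : A p q) (e' : A p' q') (e'' : A p'' q'') (hne : ¬ (p = p'' ∧ q = q''))
    (hv : Vis A l p q p' q') (hv' : Vis A l p' q' p'' q'') :
    ori (lerp p' q' l) (lerp p q l) (lerp p'' q'' l) ≠ 0 ∧
    ∀ a b x, A a b → Seg a x b → ¬ InT (lerp p' q' l) (lerp p q l) (lerp p'' q'' l) x := by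
  obtain ⟨v1, v2, v3⟩ := hv
  obtain ⟨w1, w2, w3⟩ := hv'
  set m := lerp p q l with hm
  set o := lerp p' q' l with ho
  set n := lerp p'' q'' l with hn
  have hmb : OSeg p m q := ⟨l, l0, l1, rfl⟩
  have hob : OSeg p' o q' := ⟨l, l0, l1, rfl⟩
  have hnb : OSeg p'' n q'' := ⟨l, l0, l1, rfl⟩
  have hoo : ori p' q' o = 0 := ori_lerp_same _ _ _
  have hmn : ∀ a b, A a b → Seg a m b → Seg a n b → False := by
    intro a b hab h1 h2
    have h3 := Seg.of_eq (h.eq_of_seg e hab hmb h1) h2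
    rcases h.eq_of_seg e'' e hnb h3 with ⟨rfl, rfl⟩ | ⟨rfl, rfl⟩
    · exact hne ⟨rfl, rfl⟩
    · rw [ori_swap] at w2
      linarith
  have hmneq : m ≠ n := by
    intro h0
    exact hmn p q e hmb.seg (h0 ▸ hmb.seg)
  have hom : o ≠ m := by rintro h0; rw [← h0] at v2; linarith
  have hon : o ≠ n := by rintro h0; rw [← h0] at w1; linarith
  have hK : ori o m n ≠ 0 := by
    intro h0
    obtain ⟨k, hk⟩ := exists_lerp_of_ori_eq_zero hom h0
    have : ori p' q' n = k * ori p' q' m := by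
      rw [hk, (isAff_ori p' q').lerp, hoo]; ring
    have hk0 : 0 < k := by
      by_contra hc
      nlinarith [mul_nonneg (neg_nonneg.2 (not_lt.1 hc)) v2.le]
    rcases lt_trichotomy k 1 with hk1 | hk1 | hk1
    · exact v3 p'' q'' n e'' hnb.seg (OSeg.symm ⟨k, hk0, hk1, hk⟩)
    · rw [hk1, lerp_one] at hk
      exact hmneq hk.symm
    · refine w3 p q m e hmb.seg ⟨1 / k, by positivity, ?_, ?_⟩
      · rw [div_lt_one hk0]; exact hk1
      · rw [hk, lerp_lerp_right, one_div, inv_mul_cancel₀ hk0.ne', lerp_one]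
  refine ⟨hK, h.triangle_free hK ?_ ?_ hmn⟩
  · intro a b x y t hab hx hy hT t0 t1 hyt
    rcases t0.eq_or_lt with rfl | t0
    · simp only [lerp_zero, or_self] at hyt
      rw [hyt] at hy
      have h1 := ori_eq_zero_of_seg (Seg.of_eq (h.eq_of_seg e' hab hob hy) hx)
      have := hT.pos hK (isAff_ori p' q') hoo v2.le w1.le (by linarith)
      linarith
    · rcases hyt with rfl | rfl
      · exact v3 a b _ hab hy (OSeg.symm ⟨t, t0, t1, rfl⟩)
      · exact w3 a b _ hab hy ⟨t, t0, t1, rfl⟩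
  · by_contra! hc
    have hsum := (isAff_crdA o m n).comb (isAff_crdB o m n) 1 1 0
    have h1 := hc p' (h.mem e')
    have h2 := hc q' (h.mem' e')
    have h3 := hsum.lerp p' q' l
    rw [← ho] at h3
    simp only [one_mul, add_zero, crdA_o, crdB_o] at h3
    nlinarith

theorem vis_trans_left {l : ℝ} (l0 : 0 < l) (l1 : l < 1) {p q p' q' p'' q'' : Pt}
    (e : A p q) (e' : A p' q') (e'' : A p'' q'') (hne : ¬ (p = p'' ∧ q = q''))
    (hv : Vis A l p q p' q') (hv' : Vis A l p' q' p'' q'') : 0 < ori p q (lerp p'' q'' l) := by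
  obtain ⟨hK, free⟩ := h.vis_trans_aux l0 l1 e e' e'' hne hv hv'
  have v1 := hv.1
  set m := lerp p q l with hm
  set o := lerp p' q' l with ho
  set n := lerp p'' q'' l with hn
  by_contra hc
  have hbm := (isAff_crdB o m n).lerp p q l
  have ham := (isAff_crdA o m n).lerp p q l
  rw [← hm, crdB_m] at hbm
  rw [← hm, crdA_m hK] at ham
  have hL : ∀ x, ori p q x = ori p q o * (1 - crdA o m n x - crdB o m n x) +
      ori p q n * crdB o m n x := by
    intro x
    have := (isAff_ori p q).crd hK x
    rw [hm, ori_lerp_same] at this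
    rw [this]; ring
  have main : ∀ c, Seg p c q → ori p q c = 0 → 0 < crdB o m n c → False := by
    intro c hcs hc0 hcb
    have h1 : crdA o m n c + crdB o m n c ≤ 1 := by
      rw [hL] at hc0
      by_contra! h1
      nlinarith [mul_pos v1 (sub_pos.2 h1), mul_nonneg (neg_nonneg.2 (not_lt.1 hc)) hcb.le]
    set ε := 1 / (2 * (1 + |crdA o m n c - 1|)) with hε
    have ε0 : 0 < ε := by positivity
    have ε1 : ε * (1 + |crdA o m n c - 1|) = 1 / 2 := by rw [hε]; field_simp
    have ε2 : ε ≤ 1 := by nlinarith [abs_nonneg (crdA o m n c - 1)]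
    have hmb : Seg p m q := ⟨l, l0.le, l1.le, rfl⟩
    refine free p q (lerp m c ε) e (hmb.lerp hcs ε0.le ε2) ?_
    have ea := (isAff_crdA o m n).lerp m c ε
    have eb := (isAff_crdB o m n).lerp m c ε
    rw [crdA_m hK] at ea
    rw [crdB_m] at eb
    refine ⟨?_, ?_, ?_⟩
    · have := neg_abs_le (crdA o m n c - 1)
      nlinarith
    · rw [eb]; nlinarith
    · rw [ea, eb]; nlinarith
  have hb : crdB o m n p ≠ crdB o m n q := by
    intro h0
    have hp := hL p
    have hq := hL q
    rw [ori_self_mid] at hp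
    rw [ori_self_right] at hq
    have : crdB o m n p = 0 := by rw [h0] at hbm ⊢; linarith
    rw [h0] at this
    rw [h0, this] at hp
    rw [this] at hq
    have e1 : crdA o m n p = 1 := by
      have : ori p q o * (1 - crdA o m n p) = 0 := by linarith
      rcases mul_eq_zero.1 this with h | h <;> linarith
    have e2 : crdA o m n q = 1 := by
      have : ori p q o * (1 - crdA o m n q) = 0 := by linarith
      rcases mul_eq_zero.1 this with h | h <;> linarith
    exact h.ne e (crd_ext hK (by rw [e1, e2]) h0)
  rcases hb.lt_or_gt with h1 | h1
  · exact main q (Seg.right _ _) (ori_self_right _ _) (by nlinarith)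
  · exact main p (Seg.left _ _) (ori_self_mid _ _) (by nlinarith)

theorem vis_trans {l : ℝ} (l0 : 0 < l) (l1 : l < 1) {p q p' q' p'' q'' : Pt}
    (e : A p q) (e' : A p' q') (e'' : A p'' q'') (hne : ¬ (p = p'' ∧ q = q''))
    (hv : Vis A l p q p' q') (hv' : Vis A l p' q' p'' q'') : Vis A l p q p'' q'' := by
  refine ⟨h.vis_trans_left l0 l1 e e' e'' hne hv hv',
    h.vis_trans_left l0 l1 e'' e' e (fun h0 => hne ⟨h0.1.symm, h0.2.symm⟩) hv'.symm hv.symm, ?_⟩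
  obtain ⟨hK, free⟩ := h.vis_trans_aux l0 l1 e e' e'' hne hv hv'
  rintro a b z hab hz ⟨t, t0, t1, rfl⟩
  exact free a b _ hab hz (InT.of_lerp hK t0 t1)

/-- Two distinct darts of a face see each other. -/
theorem sameCycle_vis {d d' : Dart V A} (hd : h.φ.SameCycle d d') (hne : d ≠ d') {l : ℝ}
    (l0 : 0 < l) (l1 : l < 1) : Vis A l d.1.1 d.1.2 d'.1.1 d'.1.2 := by
  obtain ⟨k, rfl⟩ := hd.exists_nat_pow_eq
  suffices ∀ k : ℕ, d = (h.φ ^ k) d ∨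
      Vis A l d.1.1 d.1.2 ((h.φ ^ k) d).1.1 ((h.φ ^ k) d).1.2 from (this k).resolve_left hne
  intro k
  induction k with
  | zero => simp
  | succ k ih =>
    rw [pow_succ', Equiv.Perm.mul_apply]
    have step : ∀ c : Dart V A, Vis A l c.1.1 c.1.2 (h.φ c).1.1 (h.φ c).1.2 := by
      intro c
      rw [h.φ_fst]
      exact h.vis_next l0 l1 (h.φ_next c)
    rcases ih with ih | ih
    · rw [← ih]; exact Or.inr (step d)
    · by_cases h0 : d = h.φ ((h.φ ^ k) d)
      · exact Or.inl h0
      · refine Or.inr (h.vis_trans l0 l1 d.adj (Dart.adj _) (Dart.adj _) ?_ ih (step _))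
        rintro ⟨h1, h2⟩
        exact h0 (Subtype.ext (Prod.ext h1 h2))

/-- A face is to the left of each of its darts. -/
theorem sameCycle_left {d d' : Dart V A} (hd : h.φ.SameCycle d d') :
    0 ≤ ori d.1.1 d.1.2 d'.1.1 := by
  by_cases hne : d = d'
  · rw [hne, ori_self_mid]
  have key : ∀ l, 0 < l → l < 1 → 0 < ori d.1.1 d.1.2 d'.1.1 +
      l * (ori d.1.1 d.1.2 d'.1.2 - ori d.1.1 d.1.2 d'.1.1) := by
    intro l l0 l1
    have := (h.sameCycle_vis hd hne l0 l1).1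
    rwa [(isAff_ori _ _).lerp] at this
  by_contra! hc
  rcases le_or_gt (ori d.1.1 d.1.2 d'.1.2) 0 with h1 | h1
  · have := key (1 / 2) (by norm_num) (by norm_num)
    linarith
  · have hden : 0 < ori d.1.1 d.1.2 d'.1.2 - ori d.1.1 d.1.2 d'.1.1 := by linarith
    have := key (-ori d.1.1 d.1.2 d'.1.1 / (ori d.1.1 d.1.2 d'.1.2 - ori d.1.1 d.1.2 d'.1.1))
      (div_pos (by linarith) hden) (by rw [div_lt_one hden]; linarith)
    rw [div_mul_cancel₀ _ hden.ne'] at this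
    linarith

end PlaneNet

/-! ### An Euler inequality -/

/-- The orbit of a point under a permutation of a finite type. -/
def orb {D : Type} [Fintype D] (σ : Equiv.Perm D) (d : D) : Finset D :=
  Finset.univ.filter (σ.SameCycle d)

theorem mem_orb {D : Type} [Fintype D] {σ : Equiv.Perm D} {d e : D} :
    e ∈ orb σ d ↔ σ.SameCycle d e := by simp [orb]

/-- The faces of a permutation of a finite type. -/
def faces {D : Type} [Fintype D] (σ : Equiv.Perm D) : Finset (Finset D) :=
  Finset.univ.image (orb σ)

theorem orb_mem_faces {D : Type} [Fintype D] (σ : Equiv.Perm D) (d : D) : orb σ d ∈ faces σ :=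
  Finset.mem_image_of_mem _ (Finset.mem_univ _)

/-- A finite set of points has an injective affine height function. -/
theorem exists_height (V : Finset Pt) : ∃ f : Pt → ℝ, IsAff f ∧ Set.InjOn f V := by
  obtain ⟨u, hu⟩ := Infinite.exists_notMem_finset
    ((V ×ˢ V).image fun x : Pt × Pt => -(x.1.1 - x.2.1) / (x.1.2 - x.2.2))
  refine ⟨fun x => x.1 + u * x.2, ⟨1, u, 0, fun x => by ring⟩, fun p hp q hq hpq => ?_⟩
  simp only at hpq
  simp only [Finset.mem_image, not_exists, not_and, Finset.mem_product] at hu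
  have h2 : p.2 = q.2 := by
    by_contra hne
    apply hu (p, q) ⟨hp, hq⟩
    have := sub_ne_zero.2 hne
    simp only
    field_simp
    linarith
  ext
  · rw [h2] at hpq; linarith
  · exact h2

namespace PlaneNet

variable {V : Finset Pt} {A : Pt → Pt → Prop} (h : PlaneNet V A)
include h

/-- The dart is a local minimum of the height `f` on its face. -/
def IsSwitch (f : Pt → ℝ) (d : Dart V A) : Prop :=
  f d.1.1 < f d.1.2 ∧ f d.1.1 < f (h.φ.symm d).1.1

theorem exists_switch {f : Pt → ℝ} (hf : IsAff f) (hinj : Set.InjOn f V) {w q q' : Pt}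
    (e : A w q) (e' : A w q') (hq : f w < f q) (hq' : f w < f q') (ho : 0 < ori w q q') :
    ∃ d : Dart V A, d.1 = (w, q) ∧ h.IsSwitch f d := by
  refine ⟨⟨(w, q), h.mem_innerDarts e (h.mem' e') ho⟩, rfl, hq, ?_⟩
  set d : Dart V A := ⟨(w, q), h.mem_innerDarts e (h.mem' e') ho⟩ with hd
  obtain ⟨h1, -, h2, h3⟩ := h.φ_symm_next d
  set p := (h.φ.symm d).1.1
  simp only [hd] at h1 h2 h3 ⊢
  by_contra! hc
  have hlt : f p < f w := lt_of_le_of_ne hc fun h0 => h.ne h1 (hinj (h.mem h1) (h.mem e) h0)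
  have h4 : ori p w q' ≤ 0 := by
    by_contra! h4
    have := h3 q' e' h4
    rw [← ori_rot] at this
    linarith
  obtain ⟨u, v, k, hf⟩ := hf
  rw [hf] at hq hq' hlt
  rw [hf] at hq hq' hlt
  have key : (u * q.1 + v * q.2 + k - (u * w.1 + v * w.2 + k)) * ori p w q' =
      (u * q'.1 + v * q'.2 + k - (u * w.1 + v * w.2 + k)) * ori p w q +
      (u * w.1 + v * w.2 + k - (u * p.1 + v * p.2 + k)) * ori w q q' := by
    simp only [ori]; ring
  nlinarith [mul_pos (sub_pos.2 hq') h2, mul_pos (sub_pos.2 hlt) ho,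
    mul_nonneg (sub_pos.2 hq).le (neg_nonneg.2 h4)]

theorem switch_unique {f : Pt → ℝ} (hf : IsAff f) (hinj : Set.InjOn f V) {d d' : Dart V A}
    (hd : h.IsSwitch f d) (hd' : h.IsSwitch f d') (hs : h.φ.SameCycle d d') : d = d' := by
  have low : ∀ {d d' : Dart V A}, h.IsSwitch f d → h.φ.SameCycle d d' → f d.1.1 ≤ f d'.1.1 := by
    intro d d' hd hs
    have h1 := h.sameCycle_left hs
    have h2 := h.sameCycle_left (d := h.φ.symm d) (d' := d')
      (by rw [← Equiv.Perm.sameCycle_apply_left, Equiv.apply_symm_apply]; exact hs)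
    rw [h.φ_symm_snd] at h2
    have h3 := (h.φ_symm_next d).2.2.1
    obtain ⟨g1, g2⟩ := hd
    obtain ⟨u, v, k, hf⟩ := hf
    simp only [hf] at g1 g2 ⊢
    set p := (h.φ.symm d).1.1
    set w := d.1.1
    set q := d.1.2
    set x := d'.1.1
    have key : ori p w q * ((u * x.1 + v * x.2 + k) - (u * w.1 + v * w.2 + k)) =
      (u * p.1 + v * p.2 + k - (u * w.1 + v * w.2 + k)) * ori w q x +
      (u * q.1 + v * q.2 + k - (u * w.1 + v * w.2 + k)) * ori p w x := by
      simp only [ori]; ring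
    by_contra! hc
    nlinarith [mul_nonneg (sub_pos.2 g1).le h2, mul_nonneg (sub_pos.2 g2).le h1,
      mul_pos h3 (sub_pos.2 hc)]
  have e : d.1.1 = d'.1.1 := hinj (h.mem d.adj) (h.mem d'.adj)
    (le_antisymm (low hd hs) (low hd' hs.symm))
  by_contra hne
  have hv := h.sameCycle_vis hs hne (l := 1 / 2) (by norm_num) (by norm_num)
  have a1 := hv.1
  have a2 := hv.2.1
  rw [(isAff_ori _ _).lerp] at a1 a2
  rw [e, ori_self_mid] at a1
  rw [← e, ori_self_mid, e, ori_swap_right] at a2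
  linarith

omit h in
/-- The darts going up for the height `f`. -/
def upDarts (V : Finset Pt) (A : Pt → Pt → Prop) (f : Pt → ℝ) : Finset (Pt × Pt) :=
  (V ×ˢ V).filter fun x => A x.1 x.2 ∧ f x.1 < f x.2

theorem card_upDarts_lt {f : Pt → ℝ} (hf : IsAff f) (hinj : Set.InjOn f V) (hV : V.Nonempty) :
    (upDarts V A f).card + 1 ≤ (faces h.φ).card + V.card := by
  set P : Pt × Pt → Prop := fun x => ∃ d : Dart V A, d.1 = x ∧ h.IsSwitch f d with hP
  rw [← Finset.card_filter_add_card_filter_not (s := upDarts V A f) P]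
  have h1 : ((upDarts V A f).filter P).card ≤ (faces h.φ).card := by
    refine Finset.card_le_card_of_injOn
      (fun x => if hx : P x then orb h.φ hx.choose else ∅) ?_ ?_
    · intro x hx
      simp only [Finset.coe_filter, Set.mem_ofPred_eq] at hx
      simp only [dif_pos hx.2, Finset.mem_coe]
      exact orb_mem_faces _ _
    · intro x hx y hy hxy
      simp only [Finset.coe_filter, Set.mem_ofPred_eq] at hx hy
      simp only [dif_pos hx.2, dif_pos hy.2] at hxy
      have sx := hx.2.choose_spec
      have sy := hy.2.choose_spec
      have : hy.2.choose ∈ orb h.φ hx.2.choose := by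
        rw [hxy, mem_orb]
      rw [mem_orb] at this
      rw [← sx.1, ← sy.1, h.switch_unique hf hinj sx.2 sy.2 this]
  have h2 : ((upDarts V A f).filter fun x => ¬ P x).card + 1 ≤ V.card := by
    obtain ⟨t, ht, hmax⟩ := Finset.exists_max_image V f hV
    rw [← Finset.card_erase_add_one ht]
    refine Nat.succ_le_succ (Finset.card_le_card_of_injOn Prod.fst ?_ ?_)
    · rintro ⟨w, q⟩ hx
      simp only [upDarts, Finset.coe_filter, Set.mem_ofPred_eq, Finset.mem_filter] at hx
      simp only [Finset.coe_erase, Set.mem_sdiff, Finset.mem_coe, Set.mem_singleton_iff]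
      refine ⟨h.mem hx.1.2.1, ?_⟩
      rintro rfl
      have := hmax q (h.mem' hx.1.2.1)
      linarith [hx.1.2.2]
    · rintro ⟨w, q⟩ hx ⟨w', q'⟩ hy hxy
      simp only [upDarts, Finset.coe_filter, Set.mem_ofPred_eq, Finset.mem_filter] at hx hy hxy
      subst hxy
      obtain ⟨⟨-, e, hu⟩, hn⟩ := hx
      obtain ⟨⟨-, e', hu'⟩, hn'⟩ := hy
      have h0 : ori w q q' = 0 := by
        rcases lt_trichotomy (ori w q q') 0 with h0 | h0 | h0
        · exact absurd (h.exists_switch hf hinj e' e hu' hu (by rw [ori_swap_right]; linarith)) hn'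
        · exact h0
        · exact absurd (h.exists_switch hf hinj e e' hu hu' h0) hn
      rw [h.eq_of_same_dir e e' h0 hf hu hu']
  omega

/-- All darts of the net. -/
def darts (V : Finset Pt) (A : Pt → Pt → Prop) : Finset (Pt × Pt) :=
  (V ×ˢ V).filter fun x => A x.1 x.2

theorem card_darts_le (hV : V.Nonempty) :
    (darts V A).card + 2 ≤ 2 * (faces h.φ).card + 2 * V.card := by
  obtain ⟨f, hf, hinj⟩ := exists_height V
  have h1 := h.card_upDarts_lt hf hinj hV
  have h2 := Finset.card_filter_add_card_filter_not (s := darts V A) (fun x => f x.1 < f x.2)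
  have h3 : (darts V A).filter (fun x => f x.1 < f x.2) = upDarts V A f := by
    simp only [darts, upDarts, Finset.filter_filter]
  have h4 : ((darts V A).filter (fun x => ¬ f x.1 < f x.2)).card ≤ (upDarts V A f).card := by
    refine Finset.card_le_card_of_injOn Prod.swap ?_ Prod.swap_injective.injOn
    rintro ⟨p, q⟩ hx
    simp only [darts, Finset.coe_filter, Set.mem_ofPred_eq, Finset.mem_filter, not_lt,
      Finset.mem_product] at hx
    obtain ⟨⟨⟨hp, hq⟩, e⟩, hle⟩ := hx
    simp only [upDarts, Finset.coe_filter, Set.mem_ofPred_eq, Finset.mem_product, Prod.swap]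
    exact ⟨⟨hq, hp⟩, h.symm e, lt_of_le_of_ne hle fun h0 => h.ne e (hinj hq hp h0).symm⟩
  rw [h3] at h2
  omega

end PlaneNet

/-! ### Maximal quasi-plane graphs -/

/-- `z` is in the relative interior of the edge `e`. -/
def InO (e : Sym2 Pt) (z : Pt) : Prop := ∃ a b, e = s(a, b) ∧ OSeg a z b

/-- `z` is on the closed edge `e`. -/
def InC (e : Sym2 Pt) (z : Pt) : Prop := ∃ a b, e = s(a, b) ∧ Seg a z b

/-- The relative interiors of the edges meet. -/
def Cr (e f : Sym2 Pt) : Prop := ∃ z, InO e z ∧ InO f z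

theorem inO_mk {a b z : Pt} : InO s(a, b) z ↔ OSeg a z b := by
  constructor
  · rintro ⟨c, d, he, hz⟩
    rcases Sym2.eq_iff.1 he with ⟨rfl, rfl⟩ | ⟨rfl, rfl⟩
    · exact hz
    · exact hz.symm
  · exact fun hz => ⟨a, b, rfl, hz⟩

theorem inC_mk {a b z : Pt} : InC s(a, b) z ↔ Seg a z b := by
  constructor
  · rintro ⟨c, d, he, hz⟩
    rcases Sym2.eq_iff.1 he with ⟨rfl, rfl⟩ | ⟨rfl, rfl⟩
    · exact hz
    · exact hz.symm
  · exact fun hz => ⟨a, b, rfl, hz⟩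

theorem InO.inC {e : Sym2 Pt} {z : Pt} (hz : InO e z) : InC e z := by
  obtain ⟨a, b, rfl, hz⟩ := hz
  exact inC_mk.2 hz.seg

theorem inC_of_mem {e : Sym2 Pt} {z : Pt} (hz : z ∈ e) : InC e z := by
  obtain ⟨b, rfl⟩ := hz
  exact inC_mk.2 (Seg.left _ _)

theorem InC.cases {e : Sym2 Pt} {z : Pt} (hz : InC e z) : z ∈ e ∨ InO e z := by
  obtain ⟨a, b, rfl, hz⟩ := hz
  rcases hz.cases with rfl | rfl | hz
  · exact Or.inl (Sym2.mem_mk_left _ _)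
  · exact Or.inl (Sym2.mem_mk_right _ _)
  · exact Or.inr (inO_mk.2 hz)

theorem Cr.symm {e f : Sym2 Pt} (hc : Cr e f) : Cr f e := hc.imp fun _ hz => hz.symm

theorem oseg_iff_mem {a b z : Pt} : OSeg a z b ↔ z ∈ openSegment ℝ a b := by
  rw [openSegment_eq_image]
  have : ∀ t, lerp a b t = (1 - t) • a + t • b := by
    intro t
    ext <;> simp only [lerp, Prod.fst_add, Prod.snd_add, Prod.smul_fst, Prod.smul_snd,
      smul_eq_mul] <;> ring
  constructor
  · rintro ⟨t, h0, h1, rfl⟩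
    exact ⟨t, ⟨h0, h1⟩, (this t).symm⟩
  · rintro ⟨t, ⟨h0, h1⟩, rfl⟩
    exact ⟨t, h0, h1, (this t).symm⟩

theorem edgesCross_iff {e f : Sym2 Pt} : EdgesCross e f ↔ Cr e f := by
  constructor
  · rintro ⟨a, b, c, d, rfl, rfl, z, h1, h2⟩
    exact ⟨z, inO_mk.2 (oseg_iff_mem.2 h1), inO_mk.2 (oseg_iff_mem.2 h2)⟩
  · rintro ⟨z, ⟨a, b, rfl, h1⟩, ⟨c, d, rfl, h2⟩⟩
    exact ⟨a, b, c, d, rfl, rfl, z, oseg_iff_mem.1 h1, oseg_iff_mem.1 h2⟩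

theorem GenPos.ori_ne_zero {S : Finset Pt} (hS : GenPos S) {p q r : Pt} (hp : p ∈ S) (hq : q ∈ S)
    (hr : r ∈ S) (hpq : p ≠ q) (hpr : p ≠ r) (hqr : q ≠ r) : ori p q r ≠ 0 := by
  intro h0
  refine hS p hp q hq r hr hpq hpr hqr ?_
  obtain ⟨t, rfl⟩ := exists_lerp_of_ori_eq_zero hpq h0
  rw [collinear_iff_of_mem (p₀ := p) (by simp)]
  refine ⟨q - p, ?_⟩
  simp only [Set.mem_insert_iff, Set.mem_singleton_iff, vadd_eq_add]
  rintro x (rfl | rfl | rfl)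
  · exact ⟨0, by simp⟩
  · exact ⟨1, by simp⟩
  · exact ⟨t, by ext <;> simp [lerp] <;> ring⟩

theorem GenPos.eq_or_eq {S : Finset Pt} (hS : GenPos S) {a b c : Pt} (ha : a ∈ S) (hb : b ∈ S)
    (hc : c ∈ S) (hab : a ≠ b) (h0 : ori a b c = 0) : c = a ∨ c = b := by
  by_contra! hne
  exact hS.ori_ne_zero ha hb hc hab hne.1.symm hne.2.symm h0

theorem GenPos.not_oseg {S : Finset Pt} (hS : GenPos S) {a b c : Pt} (ha : a ∈ S) (hb : b ∈ S)
    (hc : c ∈ S) (hab : a ≠ b) : ¬ OSeg a c b := by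
  intro ho
  obtain ⟨t, t0, t1, hct⟩ := ho
  rcases hS.eq_or_eq ha hb hc hab (by rw [hct, ori_lerp_same]) with h1 | h1
  · have := lerp_inj hab ((lerp_zero a b).trans (h1.symm.trans hct))
    linarith
  · have := lerp_inj hab ((lerp_one a b).trans (h1.symm.trans hct))
    linarith

/-- Two segments spanned by points in general position share at most one point. -/
theorem GenPos.meet_unique {S : Finset Pt} (hS : GenPos S) {a b c d z w : Pt} (ha : a ∈ S)
    (hb : b ∈ S) (hc : c ∈ S) (hd : d ∈ S) (hab : a ≠ b) (hcd : c ≠ d) (hne : s(a, b) ≠ s(c, d))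
    (hz : Seg a z b) (hz' : Seg c z d) (hw : Seg a w b) (hw' : Seg c w d) : z = w := by
  by_contra hzw
  have h1 := ori_eq_zero_of_seg hz
  have h2 := ori_eq_zero_of_seg hw
  obtain ⟨u, -, -, rfl⟩ := hz'
  obtain ⟨v, -, -, rfl⟩ := hw'
  have huv : u ≠ v := by rintro rfl; exact hzw rfl
  rw [(isAff_ori a b).lerp] at h1 h2
  have h3 : (u - v) * (ori a b d - ori a b c) = 0 := by linarith
  have h4 := (mul_eq_zero.1 h3).resolve_left (sub_ne_zero.2 huv)
  rw [h4] at h1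
  have hc0 : ori a b c = 0 := by linarith
  have hd0 : ori a b d = 0 := by linarith
  rcases hS.eq_or_eq ha hb hc hab hc0 with rfl | rfl <;>
    rcases hS.eq_or_eq ha hb hd hab hd0 with rfl | rfl
  · exact hcd rfl
  · exact hne rfl
  · exact hne Sym2.eq_swap
  · exact hcd rfl

/-- A maximal graph with no three pairwise crossing edges. -/
structure QNet (S : Finset Pt) (G : Finset (Sym2 Pt)) : Prop where
  gp : GenPos S
  edge : ∀ {a b}, s(a, b) ∈ G → a ≠ b ∧ a ∈ S ∧ b ∈ S
  qp : ∀ {e f g}, e ∈ G → f ∈ G → g ∈ G → e ≠ f → f ≠ g → e ≠ g → Cr e f → Cr f g → Cr e g → False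
  max : ∀ {a b}, a ∈ S → b ∈ S → a ≠ b → s(a, b) ∉ G → ∃ e ∈ G, ∃ f ∈ G, e ≠ f ∧ Cr e f ∧
    Cr e s(a, b) ∧ Cr f s(a, b)

namespace QNet

variable {S : Finset Pt} {G : Finset (Sym2 Pt)} (h : QNet S G)
include h

theorem meet_unique {e f : Sym2 Pt} {z w : Pt} (he : e ∈ G) (hf : f ∈ G) (hne : e ≠ f)
    (hz : InC e z) (hz' : InC f z) (hw : InC e w) (hw' : InC f w) : z = w := by
  induction e with | _ a b
  induction f with | _ c d
  rw [inC_mk] at hz hz' hw hw'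
  obtain ⟨h1, h2, h3⟩ := h.edge he
  obtain ⟨h4, h5, h6⟩ := h.edge hf
  exact h.gp.meet_unique h2 h3 h5 h6 h1 h4 hne hz hz' hw hw'

theorem not_inO {e : Sym2 Pt} {v : Pt} (he : e ∈ G) (hv : v ∈ S) : ¬ InO e v := by
  induction e with | _ a b
  rw [inO_mk]
  obtain ⟨h1, h2, h3⟩ := h.edge he
  exact h.gp.not_oseg h2 h3 hv h1

theorem mem_S {e : Sym2 Pt} {v : Pt} (he : e ∈ G) (hv : v ∈ e) : v ∈ S := by
  obtain ⟨b, rfl⟩ := hv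
  exact (h.edge he).2.1

theorem not_cr_of_mem {e f : Sym2 Pt} {v : Pt} (he : e ∈ G) (hf : f ∈ G) (hne : e ≠ f)
    (hv : v ∈ e) (hv' : v ∈ f) : ¬ Cr e f := by
  rintro ⟨z, hz, hz'⟩
  have := h.meet_unique he hf hne hz.inC hz'.inC (inC_of_mem hv) (inC_of_mem hv')
  rw [this] at hz
  exact h.not_inO he (h.mem_S he hv) hz

omit h in
theorem _root_.GenPos.not_share {a b c d z : Pt} (hS : GenPos S) (ha : a ∈ S) (hb : b ∈ S)
    (hc : c ∈ S) (hd : d ∈ S) (hab : a ≠ b) (hcd : c ≠ d) (hne : s(a, b) ≠ s(c, d))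
    (hz : OSeg a z b) (hz' : Seg c z d) : a ≠ c ∧ a ≠ d := by
  constructor
  · rintro rfl
    have := hS.meet_unique ha hb hc hd hab hcd hne hz.seg hz' (Seg.left _ _) (Seg.left _ _)
    rw [this] at hz
    exact hS.not_oseg ha hb ha hab hz
  · rintro rfl
    have := hS.meet_unique ha hb hc hd hab hcd hne hz.seg hz' (Seg.left _ _) (Seg.right _ _)
    rw [this] at hz
    exact hS.not_oseg ha hb ha hab hz

/-- If `z` is the first point of `q s` on an edge `a b`, some edge leaves `q` on the side of `a`. -/
theorem exists_edge_side {q s a b z : Pt} {t0 : ℝ} (hq : q ∈ S) (hs : s ∈ S) (hqs : q ≠ s)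
    (he : s(a, b) ∈ G) (hz : OSeg a z b) (h0 : 0 < t0) (h1 : t0 < 1) (hzt : z = lerp q s t0)
    (hK : ori q z a ≠ 0)
    (hfirst : ∀ e ∈ G, ∀ t, 0 < t → t < 1 → InO e (lerp q s t) → t0 ≤ t) :
    ∃ w, s(q, w) ∈ G ∧ 0 ≤ crdA q z a w ∧ 0 < crdB q z a w := by
  obtain ⟨hab, ha, hb⟩ := h.edge he
  obtain ⟨w, hw, hmax⟩ := Finset.exists_max_image
    (S.filter fun w => 0 ≤ crdA q z a w ∧ 0 < crdB q z a w ∧ crdA q z a w + crdB q z a w ≤ 1)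
    (fun w => crdA q z a w / crdB q z a w) ⟨a, by simp [ha, crdB_n hK]⟩
  simp only [Finset.mem_filter] at hw hmax
  obtain ⟨hwS, hα0, hβ0, hsum0⟩ := hw
  refine ⟨w, ?_, hα0, hβ0⟩
  have hqw : q ≠ w := by rintro rfl; simp at hβ0
  by_contra hnot
  obtain ⟨g1, hg1, g2, hg2, hne, hc12, hc1, hc2⟩ := h.max hq hwS hqw hnot
  have hsab : ∀ x, Seg a x b → crdA q z a x + crdB q z a x = 1 := by
    have haff := (isAff_crdA q z a).comb (isAff_crdB q z a) 1 1 0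
    obtain ⟨t, t0, t1, hzt⟩ := hz
    have ea : 1 * crdA q z a a + 1 * crdB q z a a + 0 = 1 := by simp [crdB_n hK]
    have ez : 1 * crdA q z a z + 1 * crdB q z a z + 0 = 1 := by simp [crdA_m hK]
    have h2 := haff.lerp a b t
    rw [← hzt] at h2
    rw [ea, ez] at h2
    have h3 : t * ((1 * crdA q z a b + 1 * crdB q z a b + 0) - 1) = 0 := by linarith
    have h4 := (mul_eq_zero.1 h3).resolve_left t0.ne'
    rintro x ⟨u, -, -, rfl⟩
    have h5 := haff.lerp a b u
    rw [ea, h4] at h5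
    linarith
  have hsumw : ∀ x, OSeg q x w → crdA q z a x + crdB q z a x < 1 := by
    rintro x ⟨u, u0, u1, rfl⟩
    rw [(isAff_crdA q z a).lerp, (isAff_crdB q z a).lerp, crdA_o, crdB_o]
    nlinarith
  have hcross : ∀ g ∈ G, Cr g s(q, w) → Cr g s(a, b) ∧ g ≠ s(a, b) := by
    intro g hg hc
    obtain ⟨c, hcg, hcw⟩ := hc
    rw [inO_mk] at hcw
    have hge : g ≠ s(a, b) := by
      rintro rfl
      have := hsab c (inO_mk.1 hcg).seg
      have := hsumw c hcw
      linarith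
    refine ⟨?_, hge⟩
    have hgw : g ≠ s(q, w) := by rintro rfl; exact hnot hg
    set H : Pt → ℝ := fun x => crdB q z a w * crdA q z a x + (-crdA q z a w) * crdB q z a x + 0
      with hH
    have hHaff : IsAff H := (isAff_crdA q z a).comb (isAff_crdB q z a) _ _ 0
    have hHc : H c = 0 := by
      obtain ⟨u, u0, u1, rfl⟩ := hcw
      rw [hHaff.lerp]
      simp only [hH, crdA_o, crdB_o]; ring
    have hH0 : ∀ y, H y = 0 → ori q w y = 0 := by
      intro y hy
      have e1 := (isAff_ori q w).crd hK y
      have e2 := (isAff_ori q w).crd hK w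
      rw [ori_self_mid] at e1 e2
      rw [ori_self_right] at e2
      have e3 : crdB q z a w * ori q w y = ori q w z * H y := by
        rw [e1]; simp only [hH]; linear_combination (-crdB q z a y) * e2
      rw [hy, mul_zero] at e3
      exact (mul_eq_zero.1 e3).resolve_left hβ0.ne'
    obtain ⟨y1, y2, rfl, hcg⟩ := hcg
    obtain ⟨hy12, hy1, hy2⟩ := h.edge hg
    have main : ∀ y, y ∈ S → Seg y1 y y2 → y ≠ c → 0 < H y → Cr s(y1, y2) s(a, b) := by
      intro y hyS hyg hyc hHy
      have hout : crdB q z a y ≤ 0 ∨ 1 - (crdA q z a y + crdB q z a y) ≤ 0 := by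
        by_contra! hc
        have hα : 0 ≤ crdA q z a y := by
          by_contra! hα
          simp only [hH] at hHy
          nlinarith [mul_nonneg hα0 hc.1.le]
        have := hmax y ⟨hyS, hα, hc.1, by linarith⟩
        rw [div_le_div_iff₀ hc.1 hβ0] at this
        simp only [hH] at hHy
        linarith
      have hcs := hsumw c hcw
      have hcb : 0 < crdB q z a c := by
        obtain ⟨u, u0, u1, rfl⟩ := hcw
        rw [(isAff_crdB q z a).lerp, crdB_o]
        have := mul_pos u0 hβ0
        linarith
      obtain ⟨t, tp, tl, hb1, hb2, hz'⟩ := exists_first_zero hcb (sub_pos.2 hcs) hout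
      have eb := (isAff_crdB q z a).lerp c y t
      have ea := (isAff_crdA q z a).lerp c y t
      have eH := hHaff.lerp c y t
      rw [hHc] at eH
      have hHx : 0 < H (lerp c y t) := by rw [eH]; nlinarith
      have hxg : t < 1 → OSeg y1 (lerp c y t) y2 := fun ht => hcg.lerp hyg tp.le ht
      have hx1 : t = 1 → lerp c y t = y := fun ht => by rw [ht, lerp_one]
      set x := lerp c y t with hx
      rcases hz' with hz' | hz'
      · have hβx : crdB q z a x = 0 := by linarith
        have hxe := eq_lerp_of_crdB_eq_zero hK hβx
        have hαx : 0 < crdA q z a x := by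
          simp only [hH] at hHx
          rw [hβx] at hHx
          by_contra! hc
          nlinarith
        have hαx1 : crdA q z a x ≤ 1 := by linarith
        rw [hzt, lerp_lerp_right, ← hzt] at hxe
        have hlt : crdA q z a x * t0 < 1 := by nlinarith
        rcases tl.lt_or_eq with ht | ht
        · have := hfirst _ hg _ (mul_pos hαx h0) hlt (by rw [← hxe]; exact inO_mk.2 (hxg ht))
          have hα1 : crdA q z a x = 1 := by
            by_contra hne
            have := lt_of_le_of_ne hαx1 hne
            nlinarith
          rw [hα1, one_mul, ← hzt] at hxe
          exact ⟨x, inO_mk.2 (hxg ht), inO_mk.2 (hxe ▸ hz)⟩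
        · exfalso
          rw [hx1 ht] at hxe hlt hαx
          exact h.gp.not_oseg hq hs hyS hqs ⟨_, mul_pos hαx h0, hlt, hxe⟩
      · have hsx : crdA q z a x + crdB q z a x = 1 := by linarith
        have hβx : 0 ≤ crdB q z a x := by linarith
        have hαx : 0 < crdA q z a x := by
          simp only [hH] at hHx
          by_contra! hc
          nlinarith [mul_nonneg hα0 hβx]
        have hxab : OSeg a x b := by
          have : x = lerp z a (crdB q z a x) := by
            apply crd_ext hK
            · rw [(isAff_crdA q z a).lerp z a, crdA_m hK, crdA_n]; linarith
            · rw [(isAff_crdB q z a).lerp z a, crdB_n hK, crdB_m]; ring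
          rw [this]
          exact hz.lerp (Seg.left _ _) hβx (by linarith)
        rcases tl.lt_or_eq with ht | ht
        · exact ⟨x, inO_mk.2 (hxg ht), inO_mk.2 hxab⟩
        · rw [hx1 ht] at hxab
          exact absurd hxab (h.gp.not_oseg ha hb hyS hab)
    have hy1w := h.gp.not_share hy1 hy2 hq hwS hy12 hqw hgw hcg hcw.seg
    have hy1H : H y1 ≠ 0 := fun h0 => by
      rcases h.gp.eq_or_eq hq hwS hy1 hqw (hH0 _ h0) with h1 | h1
      · exact hy1w.1 h1
      · exact hy1w.2 h1
    have hc1 : y1 ≠ c := by rintro rfl; exact hy1H hHc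
    have hc2 : y2 ≠ c := by rintro rfl; exact h.gp.not_oseg hy1 hy2 hy2 hy12 hcg
    rcases hy1H.lt_or_gt with h1 | h1
    · refine main y2 hy2 (Seg.right _ _) hc2 ?_
      obtain ⟨u, u0, u1, hcu⟩ := hcg
      have := hHaff.lerp y1 y2 u
      rw [← hcu, hHc] at this
      by_contra! hc
      nlinarith
    · exact main y1 hy1 (Seg.left _ _) hc1 h1
  obtain ⟨k1, n1⟩ := hcross g1 hg1 hc1
  obtain ⟨k2, n2⟩ := hcross g2 hg2 hc2
  exact h.qp hg1 hg2 he hne n2 n1 hc12 k2 k1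

omit h in
theorem _root_.exists_aff_sep {p q : Pt} (hpq : p ≠ q) : ∃ f, IsAff f ∧ f p = 0 ∧ f q = 1 := by
  have hn : (q.1 - p.1) ^ 2 + (q.2 - p.2) ^ 2 ≠ 0 := by
    intro h0
    apply hpq
    ext <;> nlinarith [sq_nonneg (q.1 - p.1), sq_nonneg (q.2 - p.2)]
  refine ⟨fun x => ((q.1 - p.1) * x.1 + (q.2 - p.2) * x.2 +
    (-(q.1 - p.1) * p.1 - (q.2 - p.2) * p.2)) / ((q.1 - p.1) ^ 2 + (q.2 - p.2) ^ 2),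
    IsAff.div_const ⟨_, _, _, fun x => rfl⟩ _, ?_, ?_⟩
  · simp only; rw [div_eq_zero_iff]; left; ring
  · simp only; rw [div_eq_one_iff_eq hn]; ring

/-- The edges of a maximal graph at `q` positively span the directions to the other points. -/
theorem exists_edge_of_lt {q s : Pt} (hq : q ∈ S) (hs : s ∈ S) {f : Pt → ℝ} (hf : IsAff f)
    (hlt : f q < f s) : ∃ w, s(q, w) ∈ G ∧ f q < f w := by
  have hqs : q ≠ s := by rintro rfl; exact lt_irrefl _ hlt
  by_cases hin : s(q, s) ∈ G
  · exact ⟨s, hin, hlt⟩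
  obtain ⟨g1, hg1, -, -, -, -, hc1, -⟩ := h.max hq hs hqs hin
  obtain ⟨F, hF, hF0, hF1⟩ := exists_aff_sep hqs
  obtain ⟨e, he, hmin⟩ := Finset.exists_min_image (G.filter fun e => Cr e s(q, s))
    (fun e => if hc : Cr e s(q, s) then F hc.choose else 0) ⟨g1, by simp [hg1, hc1]⟩
  simp only [Finset.mem_filter] at he hmin
  obtain ⟨heG, hec⟩ := he
  rw [dif_pos hec] at hmin
  obtain ⟨hz1, hz2⟩ := hec.choose_spec
  set z := hec.choose with hz
  rw [inO_mk] at hz2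
  obtain ⟨t0, h0, h1, hzt⟩ := hz2
  have hFl : ∀ t, F (lerp q s t) = t := fun t => by rw [hF.lerp, hF0, hF1]; ring
  have hfirst : ∀ e ∈ G, ∀ t, 0 < t → t < 1 → InO e (lerp q s t) → t0 ≤ t := by
    intro e' he' t p0 p1 hin'
    have hc : Cr e' s(q, s) := ⟨_, hin', inO_mk.2 ⟨t, p0, p1, rfl⟩⟩
    have := hmin e' ⟨he', hc⟩
    rw [dif_pos hc] at this
    obtain ⟨k1, k2⟩ := hc.choose_spec
    have heq : hc.choose = lerp q s t := by
      induction e' with | _ c d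
      obtain ⟨hcd, hcS, hdS⟩ := h.edge he'
      exact h.gp.meet_unique hcS hdS hq hs hcd hqs (by rintro h0; exact hin (h0 ▸ he'))
        (inO_mk.1 k1).seg (inO_mk.1 k2).seg (inO_mk.1 hin').seg ⟨t, p0.le, p1.le, rfl⟩
    rw [heq, hzt, hFl, hFl] at this
    exact this
  obtain ⟨a, b, rfl, hzab⟩ := hz1
  obtain ⟨hab, ha, hb⟩ := h.edge heG
  have hne : s(a, b) ≠ s(q, s) := fun h0 => hin (h0 ▸ heG)
  have hK : ∀ c, c ∈ S → c ≠ q → c ≠ s → ori q z c ≠ 0 := by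
    intro c hc hcq hcs h2
    have : ori q z c = t0 * ori q s c := by rw [hzt]; simp only [ori, lerp]; ring
    rw [this] at h2
    rcases h.gp.eq_or_eq hq hs hc hqs ((mul_eq_zero.1 h2).resolve_left h0.ne') with h3 | h3
    · exact hcq h3
    · exact hcs h3
  have hza := h.gp.not_share ha hb hq hs hab hqs hne hzab ⟨t0, h0.le, h1.le, hzt⟩
  have hzb := h.gp.not_share hb ha hq hs hab.symm hqs (by rwa [Sym2.eq_swap]) hzab.symm
    ⟨t0, h0.le, h1.le, hzt⟩
  have hKa := hK a ha hza.1 hza.2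
  have hKb := hK b hb hzb.1 hzb.2
  obtain ⟨w1, hw1, a1, b1⟩ := h.exists_edge_side hq hs hqs heG hzab h0 h1 hzt hKa hfirst
  obtain ⟨w2, hw2, a2, b2⟩ := h.exists_edge_side hq hs hqs (Sym2.eq_swap ▸ heG) hzab.symm h0 h1 hzt
    hKb hfirst
  by_contra! hc
  have e1 := hf.crd hKa w1
  have e2 := hf.crd hKb w2
  have i1 := hc w1 hw1
  have i2 := hc w2 hw2
  have hfz : 0 < f z - f q := by rw [hzt, hf.lerp]; nlinarith
  have fa : f a - f q ≤ 0 := by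
    by_contra! fa
    nlinarith [mul_pos b1 fa, mul_nonneg a1 hfz.le]
  have fb : f b - f q ≤ 0 := by
    by_contra! fb
    nlinarith [mul_pos b2 fb, mul_nonneg a2 hfz.le]
  obtain ⟨u, u0, u1, hzu⟩ := hzab
  have := hf.lerp a b u
  rw [← hzu] at this
  nlinarith

end QNet

/-! ### The planar arrangement of a maximal quasi-plane graph -/

/-- The crossing points of the edges. -/
def xpts (G : Finset (Sym2 Pt)) : Finset Pt :=
  ((G ×ˢ G).filter fun x => x.1 ≠ x.2 ∧ Cr x.1 x.2).image fun x =>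
    if hc : Cr x.1 x.2 then hc.choose else (0, 0)

/-- The vertices of the arrangement: the points and the crossings. -/
def vpts (S : Finset Pt) (G : Finset (Sym2 Pt)) : Finset Pt := S ∪ xpts G

/-- Adjacency in the arrangement. -/
def NAdj (S : Finset Pt) (G : Finset (Sym2 Pt)) (p q : Pt) : Prop :=
  p ∈ vpts S G ∧ q ∈ vpts S G ∧ p ≠ q ∧ (∃ e ∈ G, InC e p ∧ InC e q) ∧
    ∀ z ∈ vpts S G, ¬ OSeg p z q

theorem InC.ori_eq_zero {e : Sym2 Pt} {p q r : Pt} (hp : InC e p) (hq : InC e q) (hr : InC e r) :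
    ori p q r = 0 := by
  induction e with | _ a b
  obtain ⟨s, -, -, rfl⟩ := inC_mk.1 hp
  obtain ⟨t, -, -, rfl⟩ := inC_mk.1 hq
  obtain ⟨u, -, -, rfl⟩ := inC_mk.1 hr
  simp only [ori, lerp]; ring

theorem InC.inO_of_oseg {a b p q z : Pt} (hab : a ≠ b) (hp : InC s(a, b) p) (hq : InC s(a, b) q)
    (hpq : p ≠ q) (hz : OSeg p z q) : InO s(a, b) z :=
  inO_mk.2 (OSeg.mono (inC_mk.1 hp) (inC_mk.1 hq) hz hab hpq)

/-- Two intervals with a common interior point and no endpoint inside one another coincide. -/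
theorem interval_eq {a b c d z : ℝ} (h1 : a < z) (h2 : z < b) (h3 : c < z) (h4 : z < d)
    (hc : ¬ (a < c ∧ c < b)) (hd : ¬ (a < d ∧ d < b)) (ha : ¬ (c < a ∧ a < d))
    (hb : ¬ (c < b ∧ b < d)) : a = c ∧ b = d := by
  constructor
  · rcases lt_trichotomy a c with h | h | h
    · exact absurd ⟨h, by linarith⟩ hc
    · exact h
    · exact absurd ⟨h, by linarith⟩ ha
  · rcases lt_trichotomy b d with h | h | h
    · exact absurd ⟨by linarith, h⟩ hb
    · exact h
    · exact absurd ⟨by linarith, h⟩ hd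

theorem oseg_lerp {a b : Pt} {s t u : ℝ} (h1 : s < t) (h2 : t < u) :
    OSeg (lerp a b s) (lerp a b t) (lerp a b u) := by
  have : 0 < u - s := by linarith
  refine ⟨(t - s) / (u - s), div_pos (by linarith) this, ?_, ?_⟩
  · rw [div_lt_one this]; linarith
  · rw [lerp_lerp, div_mul_cancel₀ _ this.ne']; congr 1; ring

theorem oseg_lerp_iff {a b : Pt} (hab : a ≠ b) {s t u : ℝ} (hsu : s < u) :
    OSeg (lerp a b s) (lerp a b t) (lerp a b u) ↔ s < t ∧ t < u := by
  constructor
  · rintro ⟨k, k0, k1, hk⟩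
    rw [lerp_lerp] at hk
    have := lerp_inj hab hk
    constructor <;> nlinarith
  · exact fun h => oseg_lerp h.1 h.2

namespace QNet

variable {S : Finset Pt} {G : Finset (Sym2 Pt)} (h : QNet S G)
include h

theorem mem_xpts {z : Pt} :
    z ∈ xpts G ↔ ∃ e ∈ G, ∃ f ∈ G, e ≠ f ∧ InO e z ∧ InO f z := by
  simp only [xpts, Finset.mem_image, Finset.mem_filter, Finset.mem_product, Prod.exists]
  constructor
  · rintro ⟨e, f, ⟨⟨he, hf⟩, hne, hc⟩, rfl⟩
    rw [dif_pos hc]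
    exact ⟨e, he, f, hf, hne, hc.choose_spec⟩
  · rintro ⟨e, he, f, hf, hne, h1, h2⟩
    have hc : Cr e f := ⟨z, h1, h2⟩
    refine ⟨e, f, ⟨⟨he, hf⟩, hne, hc⟩, ?_⟩
    rw [dif_pos hc]
    exact h.meet_unique he hf hne hc.choose_spec.1.inC hc.choose_spec.2.inC h1.inC h2.inC

theorem not_mem_S {z : Pt} (hz : z ∈ xpts G) : z ∉ S := by
  obtain ⟨e, he, -, -, -, h1, -⟩ := h.mem_xpts.1 hz
  exact fun hzS => h.not_inO he hzS h1

omit h in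
theorem _root_.mem_vpts_of_mem {v : Pt} (hv : v ∈ S) : v ∈ vpts S G := Finset.mem_union_left _ hv

omit h in
theorem _root_.mem_vpts_cases {v : Pt} (hv : v ∈ vpts S G) (hS : v ∉ S) : v ∈ xpts G :=
  (Finset.mem_union.1 hv).resolve_left hS

omit h in
theorem _root_.mem_vpts_of_xpts {v : Pt} (hv : v ∈ xpts G) : v ∈ vpts S G :=
  Finset.mem_union_right _ hv

theorem mem_of_inC {e : Sym2 Pt} {v : Pt} (he : e ∈ G) (hv : v ∈ S) (hc : InC e v) : v ∈ e :=
  hc.cases.resolve_right (h.not_inO he hv)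

theorem inO_of_inC {e : Sym2 Pt} {x : Pt} (he : e ∈ G) (hx : x ∈ xpts G) (hc : InC e x) :
    InO e x :=
  hc.cases.resolve_left fun hm => h.not_mem_S hx (h.mem_S he hm)

/-- The following vertex of the arrangement on an edge. -/
theorem exists_adj_toward {a b p : Pt} (he : s(a, b) ∈ G) (hp : p ∈ vpts S G) (hps : Seg a p b)
    (hpb : p ≠ b) : ∃ q, NAdj S G p q ∧ ∃ t, 0 < t ∧ t ≤ 1 ∧ q = lerp p b t := by
  obtain ⟨hab, ha, hb⟩ := h.edge he
  obtain ⟨F, hF, hF0, hF1⟩ := exists_aff_sep hpb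
  have hFl : ∀ t, F (lerp p b t) = t := fun t => by rw [hF.lerp, hF0, hF1]; ring
  obtain ⟨q, hq, hmin⟩ := Finset.exists_min_image
    ((vpts S G).filter fun q => ∃ t, 0 < t ∧ t ≤ 1 ∧ q = lerp p b t) F
    ⟨b, by simp only [Finset.mem_filter]; exact
      ⟨mem_vpts_of_mem hb, 1, one_pos, le_rfl, (lerp_one _ _).symm⟩⟩
  simp only [Finset.mem_filter] at hq hmin
  obtain ⟨hqV, t, t0, t1, rfl⟩ := hq
  refine ⟨_, ⟨hp, hqV, ?_, ⟨_, he, inC_mk.2 hps, inC_mk.2 ?_⟩, ?_⟩, t, t0, t1, rfl⟩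
  · intro h0
    have := congrArg F h0
    rw [hFl, hF0] at this
    linarith
  · exact hps.lerp (Seg.right _ _) t0.le t1
  · rintro z hz ⟨u, u0, u1, rfl⟩
    rw [lerp_lerp_right] at hz
    have := hmin _ ⟨hz, u * t, by positivity, by nlinarith, rfl⟩
    rw [hFl, hFl] at this
    nlinarith

theorem exists_transversal {p : Pt} (hp : p ∈ xpts G) : ∃ a b c d, s(a, b) ∈ G ∧ s(c, d) ∈ G ∧
    s(a, b) ≠ s(c, d) ∧ OSeg a p b ∧ OSeg c p d ∧ ori p a c ≠ 0 := by
  obtain ⟨e, he, f, hf, hne, h1, h2⟩ := h.mem_xpts.1 hp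
  obtain ⟨a, b, rfl, h1⟩ := h1
  obtain ⟨c, d, rfl, h2⟩ := h2
  refine ⟨a, b, c, d, he, hf, hne, h1, h2, fun h0 => ?_⟩
  obtain ⟨hab, ha, hb⟩ := h.edge he
  obtain ⟨hcd, hc, hd⟩ := h.edge hf
  have hs := h.gp.not_share hc hd ha hb hcd hab hne.symm h2 h1.seg
  obtain ⟨t, t0, t1, rfl⟩ := h1
  have : ori (lerp a b t) a c = - t * ori a b c := by simp only [ori, lerp]; ring
  rw [this] at h0
  have h3 := (mul_eq_zero.1 h0).resolve_left (by linarith)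
  rcases h.gp.eq_or_eq ha hb hc hab h3 with h4 | h4
  · exact hs.1 h4
  · exact hs.2 h4

theorem net_ext {p s : Pt} {f : Pt → ℝ} (hp : p ∈ vpts S G) (hs : s ∈ vpts S G) (hf : IsAff f)
    (hlt : f p < f s) : ∃ q, NAdj S G p q ∧ f p < f q := by
  have fin : ∀ a b, s(a, b) ∈ G → Seg a p b → f p < f b → ∃ q, NAdj S G p q ∧ f p < f q := by
    intro a b he hps hl
    obtain ⟨q, hq, t, t0, t1, rfl⟩ := h.exists_adj_toward he hp hps (by rintro rfl; linarith)
    refine ⟨_, hq, ?_⟩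
    rw [hf.lerp]
    nlinarith
  by_cases hpS : p ∈ S
  · have : ∃ s ∈ S, f p < f s := by
      by_cases hsS : s ∈ S
      · exact ⟨s, hsS, hlt⟩
      · obtain ⟨e, he, -, -, -, h1, -⟩ := h.mem_xpts.1 (mem_vpts_cases hs hsS)
        obtain ⟨a, b, rfl, t, t0, t1, rfl⟩ := h1
        obtain ⟨-, ha, hb⟩ := h.edge he
        by_contra! hc
        have := hc a ha
        have := hc b hb
        rw [hf.lerp] at hlt
        nlinarith
    obtain ⟨s', hs', hl⟩ := this
    obtain ⟨w, hw, hl⟩ := h.exists_edge_of_lt hpS hs' hf hl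
    exact fin p w hw (Seg.left _ _) hl
  · obtain ⟨a, b, c, d, he, he', -, h1, h2, hK⟩ := h.exists_transversal (mem_vpts_cases hp hpS)
    by_contra hno
    have hno' : ∀ a b, s(a, b) ∈ G → OSeg a p b → f b ≤ f p := fun a b he hps => by
      by_contra! hc
      exact hno (fin a b he hps.seg hc)
    have hno2 : ∀ a b, s(a, b) ∈ G → OSeg a p b → f a = f p := fun a b he hps => by
      have i1 := hno' a b he hps
      have i2 := hno' b a (Sym2.eq_swap ▸ he) hps.symm
      obtain ⟨t, t0, t1, hpt⟩ := hps
      have := hf.lerp a b t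
      rw [← hpt] at this
      nlinarith
    have e1 := hno2 a b he h1
    have e2 := hno2 c d he' h2
    have := hf.crd hK s
    rw [e1, e2] at this
    linarith

/-- The arrangement is a plane net. -/
theorem net : PlaneNet (vpts S G) (NAdj S G) where
  symm := by
    rintro p q ⟨hp, hq, hne, ⟨e, he, h1, h2⟩, hz⟩
    exact ⟨hq, hp, hne.symm, ⟨e, he, h2, h1⟩, fun z hzV hb => hz z hzV hb.symm⟩
  ne := fun e => e.2.2.1
  mem := fun e => e.1
  empty := fun e hz => e.2.2.2.2 _ hz
  ext := fun hp hs hf hlt => h.net_ext hp hs hf hlt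
  disj := by
    rintro p q r s z ⟨hp, hq, hpq, ⟨e, he, h1, h2⟩, hz1⟩ ⟨hr, hs, hrs, ⟨f, hf, h3, h4⟩, hz2⟩ z1 z2
    by_cases hef : e = f
    · subst hef
      induction e with | _ a b
      obtain ⟨hab, ha, hb⟩ := h.edge he
      obtain ⟨tp, -, -, rfl⟩ := inC_mk.1 h1
      obtain ⟨tq, -, -, rfl⟩ := inC_mk.1 h2
      obtain ⟨tr, -, -, rfl⟩ := inC_mk.1 h3
      obtain ⟨ts, -, -, rfl⟩ := inC_mk.1 h4
      obtain ⟨tz, rfl⟩ : ∃ t, z = lerp a b t := by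
        obtain ⟨u, -, -, rfl⟩ := z1
        exact ⟨_, lerp_lerp _ _ _ _ _⟩
      have npq : tp ≠ tq := by rintro rfl; exact hpq rfl
      have nrs : tr ≠ ts := by rintro rfl; exact hrs rfl
      have a1 := hz1 _ hr
      have a2 := hz1 _ hs
      have a3 := hz2 _ hp
      have a4 := hz2 _ hq
      have flip : ∀ {x y w : ℝ}, OSeg (lerp a b x) (lerp a b w) (lerp a b y) ↔
          OSeg (lerp a b y) (lerp a b w) (lerp a b x) := ⟨OSeg.symm, OSeg.symm⟩
      rcases npq.lt_or_gt with l1 | l1 <;> rcases nrs.lt_or_gt with l2 | l2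
      · rw [oseg_lerp_iff hab l1] at a1 a2 z1
        rw [oseg_lerp_iff hab l2] at a3 a4 z2
        obtain ⟨rfl, rfl⟩ := interval_eq z1.1 z1.2 z2.1 z2.2 a1 a2 a3 a4
        exact Or.inl ⟨rfl, rfl⟩
      · rw [oseg_lerp_iff hab l1] at a1 a2 z1
        rw [flip, oseg_lerp_iff hab l2] at a3 a4 z2
        obtain ⟨rfl, rfl⟩ := interval_eq z1.1 z1.2 z2.1 z2.2 a2 a1 a3 a4
        exact Or.inr ⟨rfl, rfl⟩
      · rw [flip, oseg_lerp_iff hab l1] at a1 a2 z1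
        rw [oseg_lerp_iff hab l2] at a3 a4 z2
        obtain ⟨rfl, rfl⟩ := interval_eq z1.1 z1.2 z2.1 z2.2 a1 a2 a4 a3
        exact Or.inr ⟨rfl, rfl⟩
      · rw [flip, oseg_lerp_iff hab l1] at a1 a2 z1
        rw [flip, oseg_lerp_iff hab l2] at a3 a4 z2
        obtain ⟨rfl, rfl⟩ := interval_eq z1.1 z1.2 z2.1 z2.2 a2 a1 a4 a3
        exact Or.inl ⟨rfl, rfl⟩
    · exfalso
      have o1 : InO e z := by
        induction e with | _ a b
        exact h1.inO_of_oseg (h.edge he).1 h2 hpq z1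
      have o2 : InO f z := by
        induction f with | _ a b
        exact h3.inO_of_oseg (h.edge hf).1 h4 hrs z2
      exact hz1 z (mem_vpts_of_xpts (h.mem_xpts.2 ⟨e, he, f, hf, hef, o1, o2⟩)) z1

/-! #### Labels of arrangement edges -/

omit h in
/-- The graph edge carrying an arrangement edge. -/
def _root_.lab (G : Finset (Sym2 Pt)) (p q : Pt) : Sym2 Pt :=
  if hc : ∃ e ∈ G, InC e p ∧ InC e q then hc.choose else s(p, q)

omit h in
theorem _root_.lab_spec {p q : Pt} (e : NAdj S G p q) :
    lab G p q ∈ G ∧ InC (lab G p q) p ∧ InC (lab G p q) q := by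
  have hc := e.2.2.2.1
  rw [lab, dif_pos hc]
  exact hc.choose_spec

theorem lab_eq {p q : Pt} {e : Sym2 Pt} (hA : NAdj S G p q) (he : e ∈ G) (hp : InC e p)
    (hq : InC e q) : lab G p q = e := by
  obtain ⟨h1, h2, h3⟩ := lab_spec hA
  by_contra hne
  exact hA.2.2.1 (h.meet_unique h1 he hne h2 hp h3 hq)

theorem lab_comm {p q : Pt} (hA : NAdj S G p q) : lab G p q = lab G q p := by
  obtain ⟨h1, h2, h3⟩ := lab_spec (h.net.symm hA)
  exact h.lab_eq hA h1 h3 h2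

/-- Only two edges pass through a crossing. -/
theorem eq_of_three {x : Pt} {e f g : Sym2 Pt} (he : e ∈ G) (hf : f ∈ G) (hg : g ∈ G)
    (h1 : InO e x) (h2 : InO f x) (h3 : InO g x) (hef : e ≠ f) (heg : e ≠ g) : f = g := by
  by_contra hfg
  exact h.qp he hf hg hef hfg heg ⟨x, h1, h2⟩ ⟨x, h2, h3⟩ ⟨x, h1, h3⟩

omit h in
/-- The labels of two consecutive darts turning at a point differ. -/
theorem _root_.lab_ne {p q r : Pt} (h1 : NAdj S G p q) (h2 : NAdj S G q r) (ho : ori p q r ≠ 0) :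
    lab G p q ≠ lab G q r := by
  intro heq
  obtain ⟨-, a1, a2⟩ := lab_spec h1
  obtain ⟨-, b1, b2⟩ := lab_spec h2
  rw [← heq] at b2
  exact ho (a1.ori_eq_zero a2 b2)

/-- An arrangement edge at a crossing has vertices on both sides. -/
theorem exists_left {p q : Pt} (hA : NAdj S G p q) (hx : p ∈ xpts G ∨ q ∈ xpts G) :
    ∃ s ∈ vpts S G, 0 < ori p q s := by
  have key : ∀ x, x ∈ xpts G → InC (lab G p q) x → ∃ s ∈ vpts S G, 0 < ori p q s := by
    intro x hx hxl
    obtain ⟨hl, l1, l2⟩ := lab_spec hA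
    have hO := h.inO_of_inC hl hx hxl
    have hf : ∃ f ∈ G, f ≠ lab G p q ∧ InO f x := by
      obtain ⟨e, he, f, hf, hne, h1, h2⟩ := h.mem_xpts.1 hx
      by_cases hel : e = lab G p q
      · exact ⟨f, hf, fun h0 => hne (hel.trans h0.symm), h2⟩
      · exact ⟨e, he, hel, h1⟩
    obtain ⟨f, hf, hne, hfx⟩ := hf
    have hx0 : ori p q x = 0 := l1.ori_eq_zero l2 hxl
    obtain ⟨c, d, rfl, t, t0, t1, hxt⟩ := hfx
    obtain ⟨hcd, hcS, hdS⟩ := h.edge hf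
    have e1 := (isAff_ori p q).lerp c d t
    rw [← hxt, hx0] at e1
    have hc0 : ori p q c ≠ 0 := by
      intro hc0
      have : ori p q d = 0 := by
        rw [hc0] at e1
        have : t * ori p q d = 0 := by linarith
        exact (mul_eq_zero.1 this).resolve_left t0.ne'
      have key2 : ∀ e, lab G p q = e → ori p q c = 0 → ori p q d = 0 → False := by
        intro e he hc hd
        induction e with | _ a b
        rw [he] at hl l1 l2 hne
        obtain ⟨hab, ha, hb⟩ := h.edge hl
        obtain ⟨u, -, -, rfl⟩ := inC_mk.1 l1
        obtain ⟨v, -, -, rfl⟩ := inC_mk.1 l2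
        have huv : v - u ≠ 0 := by
          intro h0
          have : v = u := by linarith
          subst this
          exact hA.2.2.1 rfl
        have e3 : ∀ y, ori (lerp a b u) (lerp a b v) y = (v - u) * ori a b y := by
          intro y; simp only [ori, lerp]; ring
        rw [e3] at hc hd
        have hc := (mul_eq_zero.1 hc).resolve_left huv
        have hd := (mul_eq_zero.1 hd).resolve_left huv
        rcases h.gp.eq_or_eq ha hb hcS hab hc with rfl | rfl <;>
          rcases h.gp.eq_or_eq ha hb hdS hab hd with rfl | rfl
        · exact hcd rfl
        · exact hne rfl
        · exact hne Sym2.eq_swap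
        · exact hcd rfl
      exact key2 _ rfl hc0 this
    rcases hc0.lt_or_gt with h1 | h1
    · refine ⟨d, mem_vpts_of_mem hdS, ?_⟩
      by_contra! h2
      nlinarith
    · exact ⟨c, mem_vpts_of_mem hcS, h1⟩
  obtain ⟨-, l1, l2⟩ := lab_spec hA
  rcases hx with hx | hx
  · exact key p hx l1
  · exact key q hx l2

theorem inner_of_xpts {p q : Pt} (hA : NAdj S G p q) (hx : p ∈ xpts G ∨ q ∈ xpts G) :
    (p, q) ∈ innerDarts (vpts S G) (NAdj S G) := by
  obtain ⟨s, hs, ho⟩ := h.exists_left hA hx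
  exact h.net.mem_innerDarts hA hs ho

end QNet

/-! ### Orbits and discharging -/

section Orbits
variable {D : Type} [Fintype D] {σ : Equiv.Perm D}

theorem self_mem_orb (d : D) : d ∈ orb σ d := mem_orb.2 (Equiv.Perm.SameCycle.refl _ _)

theorem apply_mem_orb {d e : D} (he : e ∈ orb σ d) : σ e ∈ orb σ d :=
  mem_orb.2 (Equiv.Perm.sameCycle_apply_right.2 (mem_orb.1 he))

theorem orb_eq_of_mem {d e : D} (he : e ∈ orb σ d) : orb σ e = orb σ d := by
  ext x
  rw [mem_orb, mem_orb]
  exact ⟨(mem_orb.1 he).trans, (mem_orb.1 he).symm.trans⟩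

theorem isCycleOn_orb (d : D) : σ.IsCycleOn (orb σ d) := by
  refine ⟨?_, fun x hx y hy => (mem_orb.1 hx).symm.trans (mem_orb.1 hy)⟩
  refine ⟨fun x hx => apply_mem_orb hx, σ.injective.injOn, fun x hx => ⟨σ.symm x, ?_, by simp⟩⟩
  exact mem_orb.2 ((mem_orb.1 hx).trans ⟨-1, by simp⟩)

theorem pow_card_orb (d : D) : (σ ^ (orb σ d).card) d = d :=
  (isCycleOn_orb d).pow_card_apply (self_mem_orb d)

theorem exists_pow_of_mem_orb {d e : D} (he : e ∈ orb σ d) :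
    ∃ n < (orb σ d).card, (σ ^ n) d = e :=
  (isCycleOn_orb d).exists_pow_eq (self_mem_orb d) he

theorem orb_apply (d : D) : orb σ (σ d) = orb σ d := orb_eq_of_mem (apply_mem_orb (self_mem_orb d))

theorem sum_faces (g : D → ℤ) : ∑ f ∈ faces σ, ∑ d ∈ f, g d = ∑ d, g d := by
  rw [← Finset.sum_fiberwise_of_maps_to (s := Finset.univ) (t := faces σ) (g := orb σ)
    fun d _ => orb_mem_faces σ d]
  refine Finset.sum_congr rfl fun f hf => ?_
  obtain ⟨d, -, rfl⟩ := Finset.mem_image.1 hf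
  refine Finset.sum_congr ?_ fun _ _ => rfl
  ext e
  simp only [Finset.mem_filter, Finset.mem_univ, true_and]
  exact ⟨orb_eq_of_mem, fun he => he ▸ self_mem_orb e⟩

/-- An orbit not wholly inside `P` has more elements meeting `P` at either end than in `P`. -/
theorem card_orb_filter_lt {d : D} (P : D → Prop) (h1 : ∃ e ∈ orb σ d, P e)
    (h2 : ∃ e ∈ orb σ d, ¬ P e) :
    ((orb σ d).filter P).card < ((orb σ d).filter fun e => P e ∨ P (σ e)).card := by
  apply Finset.card_lt_card
  refine ⟨fun e he => ?_, fun hsub => ?_⟩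
  · rw [Finset.mem_filter] at he ⊢
    exact ⟨he.1, Or.inl he.2⟩
  · obtain ⟨e, he, hP⟩ := h1
    obtain ⟨e', he', hP'⟩ := h2
    have back : ∀ x ∈ orb σ d, P (σ x) → P x := fun x hx hp =>
      (Finset.mem_filter.1 (hsub (Finset.mem_filter.2 ⟨hx, Or.inr hp⟩))).2
    rw [← orb_eq_of_mem he'] at he
    obtain ⟨n, -, rfl⟩ := exists_pow_of_mem_orb he
    have : ∀ n, P ((σ ^ n) e') → P e' := by
      intro n
      induction n with
      | zero => exact id
      | succ n ih =>
        intro hp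
        refine ih (back _ ?_ ?_)
        · exact mem_orb.2 ((mem_orb.1 he').trans ⟨n, by simp⟩)
        · rwa [← Equiv.Perm.mul_apply, ← pow_succ']
    exact hP' (this n hP)

theorem orb_of_card_three {d : D} (h : (orb σ d).card = 3) :
    σ (σ (σ d)) = d ∧ ∀ e ∈ orb σ d, e = d ∨ e = σ d ∨ e = σ (σ d) := by
  constructor
  · have := pow_card_orb (σ := σ) d
    rwa [h] at this
  · intro e he
    obtain ⟨n, hn, rfl⟩ := exists_pow_of_mem_orb he
    rw [h] at hn
    interval_cases n
    · exact Or.inl rfl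
    · exact Or.inr (Or.inl rfl)
    · exact Or.inr (Or.inr rfl)

theorem orb_of_card_four {d : D} (h : (orb σ d).card = 4) :
    σ (σ (σ (σ d))) = d ∧ ∀ e ∈ orb σ d, e = d ∨ e = σ d ∨ e = σ (σ d) ∨ e = σ (σ (σ d)) := by
  constructor
  · have := pow_card_orb (σ := σ) d
    rwa [h] at this
  · intro e he
    obtain ⟨n, hn, rfl⟩ := exists_pow_of_mem_orb he
    rw [h] at hn
    interval_cases n
    · exact Or.inl rfl
    · exact Or.inr (Or.inl rfl)
    · exact Or.inr (Or.inr (Or.inl rfl))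
    · exact Or.inr (Or.inr (Or.inr rfl))

/-- The weighted inequality summed over all faces. -/
theorem sum_le_of_faces (W : D → ℤ) (o b t : D → Prop)
    (hf : ∀ d, ∑ e ∈ orb σ d, W e ≤ 6 * (5 * ((orb σ d).card : ℤ) +
      4 * (((orb σ d).filter o).card : ℤ) - (((orb σ d).filter b).card : ℤ) +
      (((orb σ d).filter t).card : ℤ) - 20))
    (hbt : (Finset.univ.filter t).card ≤ (Finset.univ.filter b).card) :
    ∑ d, W d ≤ 6 * (5 * (Fintype.card D : ℤ) + 4 * ((Finset.univ.filter o).card : ℤ)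
      - 20 * ((faces σ).card : ℤ)) := by
  let i : (D → Prop) → D → ℤ := fun p d => if p d then 1 else 0
  have hi : ∀ (p : D → Prop) (s : Finset D), ((s.filter p).card : ℤ) = ∑ d ∈ s, i p d := by
    intro p s; rw [Finset.card_filter]; push_cast; rfl
  have hc : ∀ s : Finset D, (s.card : ℤ) = ∑ d ∈ s, (1 : ℤ) := by intro s; simp
  have key : ∑ f ∈ faces σ, ∑ d ∈ f, (W d - 6 * (5 * 1 + 4 * i o d - i b d + i t d)) ≤
      ∑ f ∈ faces σ, (-120 : ℤ) := by
    refine Finset.sum_le_sum fun f hff => ?_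
    obtain ⟨d, -, rfl⟩ := Finset.mem_image.1 hff
    have := hf d
    rw [hi, hi, hi, hc] at this
    simp only [Finset.sum_sub_distrib, Finset.sum_add_distrib, ← Finset.mul_sum] at this ⊢
    linarith
  rw [sum_faces] at key
  simp only [Finset.sum_sub_distrib, Finset.sum_add_distrib, ← Finset.mul_sum, ← hi, ← hc,
    Finset.sum_const, Finset.card_univ, nsmul_eq_mul] at key
  have : ((Finset.univ.filter t).card : ℤ) ≤ ((Finset.univ.filter b).card : ℤ) := by
    exact_mod_cast hbt
  linarith

/-- The number of elements of `P` in the orbit of `d`. -/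
def orbP (σ : Equiv.Perm D) (P : D → Prop) (d : D) : ℕ := ((orb σ d).filter P).card

/-- The weight of an element of `P`, by the size of its orbit and the number of elements of `P`
in it. -/
def wt (σ : Equiv.Perm D) (P : D → Prop) (d : D) : ℤ :=
  if (orb σ d).card = 3 then (if orbP σ P d = 1 then 0 else if orbP σ P d = 2 then 9 else 14)
  else if (orb σ d).card = 4 then
    (if orbP σ P d = 1 then 12 else if orbP σ P d = 2 ∧ ¬ P (σ (σ d)) then 21 else 24)
  else 30

theorem sum_wt_orb_le {P b t : D → Prop} {d : D} (hk : 3 ≤ (orb σ d).card)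
    (h30 : (orb σ d).card = 3 → orbP σ P d ≠ 0)
    (hb3 : (orb σ d).card = 3 → ∀ e ∈ orb σ d, ¬ b e)
    (hb4 : (orb σ d).card = 4 → orbP σ P d = 0 → ∀ e ∈ orb σ d, ¬ b e)
    (hb : ∀ e, b e → ¬ P e ∧ ¬ P (σ e))
    (ht : ∀ e, t e ↔ P e ∧ (orb σ e).card = 3 ∧ orbP σ P e = 1) :
    ∑ e ∈ orb σ d, (if P e then wt σ P e else 0) ≤ 6 * (5 * ((orb σ d).card : ℤ) +
      4 * (((orb σ d).filter P).card : ℤ) - (((orb σ d).filter b).card : ℤ) +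
      (((orb σ d).filter t).card : ℤ) - 20) := by
  have hkc : ∀ e ∈ orb σ d, (orb σ e).card = (orb σ d).card := fun e he => by
    rw [orb_eq_of_mem he]
  have hvc : ∀ e ∈ orb σ d, orbP σ P e = orbP σ P d := fun e he => by
    rw [orbP, orb_eq_of_mem he, orbP]
  rw [← Finset.sum_filter]
  have hvk : orbP σ P d ≤ (orb σ d).card := Finset.card_filter_le _ _
  have ub : ∀ c : ℤ, (∀ e ∈ orb σ d, P e → wt σ P e ≤ c) →
      ∑ e ∈ (orb σ d).filter P, wt σ P e ≤ (orbP σ P d : ℤ) * c := by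
    intro c hc
    refine (Finset.sum_le_card_nsmul _ _ c fun e he => ?_).trans_eq ?_
    · rw [Finset.mem_filter] at he
      exact hc e he.1 he.2
    · rw [nsmul_eq_mul]; rfl
  have bzero : (∀ e ∈ orb σ d, ¬ b e) → (((orb σ d).filter b).card : ℤ) = 0 := by
    intro h0
    rw [Finset.filter_eq_empty_iff.2 (fun {e} he => h0 e he)]; rfl
  have bdisj : (((orb σ d).filter b).card : ℤ) +
      (((orb σ d).filter fun e => P e ∨ P (σ e)).card : ℤ) ≤ ((orb σ d).card : ℤ) := by
    have : Disjoint ((orb σ d).filter b) ((orb σ d).filter fun e => P e ∨ P (σ e)) := by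
      rw [Finset.disjoint_filter]
      exact fun e _ he => by have := hb e he; tauto
    have h2 := Finset.card_le_card (Finset.union_subset (Finset.filter_subset b (orb σ d))
      (Finset.filter_subset (fun e => P e ∨ P (σ e)) (orb σ d)))
    rw [Finset.card_union_of_disjoint this] at h2
    exact_mod_cast h2
  have bpos : (0 : ℤ) ≤ (((orb σ d).filter b).card : ℤ) := Int.natCast_nonneg _
  have tpos : (0 : ℤ) ≤ (((orb σ d).filter t).card : ℤ) := Int.natCast_nonneg _
  have opos : ((orbP σ P d : ℕ) : ℤ) ≤ (((orb σ d).filter fun e => P e ∨ P (σ e)).card : ℤ) := by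
    have := Finset.card_le_card (s := (orb σ d).filter P)
      (t := (orb σ d).filter fun e => P e ∨ P (σ e)) (fun e he => by
        rw [Finset.mem_filter] at he ⊢
        exact ⟨he.1, Or.inl he.2⟩)
    exact_mod_cast this
  have olt : orbP σ P d ≠ 0 → orbP σ P d < (orb σ d).card →
      ((orbP σ P d : ℕ) : ℤ) + 1 ≤ (((orb σ d).filter fun e => P e ∨ P (σ e)).card : ℤ) := by
    intro h0 h1
    have := card_orb_filter_lt (σ := σ) (d := d) P (by
      obtain ⟨e, he⟩ := Finset.card_ne_zero.1 h0
      exact ⟨e, Finset.mem_filter.1 he⟩) (by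
      by_contra! hall
      exact h1.ne (congrArg Finset.card (Finset.filter_true_of_mem hall)))
    exact_mod_cast this
  change _ ≤ 6 * (5 * ((orb σ d).card : ℤ) + 4 * ((orbP σ P d : ℕ) : ℤ) - _ + _ - 20)
  by_cases k3 : (orb σ d).card = 3
  · have hb0 := bzero (hb3 k3)
    have hv0 := h30 k3
    rw [hb0, k3]
    rw [k3] at hvk
    have hv : orbP σ P d = 1 ∨ orbP σ P d = 2 ∨ orbP σ P d = 3 := by omega
    rcases hv with hv | hv | hv
    · have h1 := ub 0 fun e he _ => by
        simp [wt, hkc e he, hvc e he, k3, hv]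
      have htc : (((orb σ d).filter t).card : ℤ) = 1 := by
        rw [← Nat.cast_one, ← hv, orbP]
        congr 2
        ext e
        simp only [Finset.mem_filter, ht]
        exact ⟨fun h => ⟨h.1, h.2.1⟩, fun h => ⟨h.1, h.2, by rw [hkc e h.1, k3], by
          rw [hvc e h.1, hv]⟩⟩
      rw [htc, hv]
      rw [hv] at h1
      push_cast at *
      linarith
    · have h1 := ub 9 fun e he _ => by
        simp [wt, hkc e he, hvc e he, k3, hv]
      rw [hv] at h1 ⊢
      push_cast at *
      linarith
    · have h1 := ub 14 fun e he _ => by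
        simp [wt, hkc e he, hvc e he, k3, hv]
      rw [hv] at h1 ⊢
      push_cast at *
      linarith
  by_cases k4 : (orb σ d).card = 4
  · have hv : orbP σ P d = 0 ∨ orbP σ P d = 1 ∨ orbP σ P d = 2 ∨ orbP σ P d = 3 ∨
      orbP σ P d = 4 := by omega
    rcases hv with hv | hv | hv | hv | hv
    · have h1 := ub 0 fun e he hP => absurd hv
        (Finset.card_ne_zero_of_mem (Finset.mem_filter.2 ⟨he, hP⟩))
      rw [bzero (hb4 k4 hv), k4, hv]
      rw [hv] at h1
      push_cast at *
      linarith
    · have h1 := ub 12 fun e he _ => by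
        simp [wt, hkc e he, hvc e he, k4, hv]
      have h2 := olt (by omega) (by omega)
      have k4' : ((orb σ d).card : ℤ) = 4 := by exact_mod_cast k4
      rw [k4'] at bdisj ⊢
      rw [hv] at h1 opos ⊢
      push_cast at *
      linarith
    · by_cases hop : ∃ e ∈ orb σ d, P e ∧ P (σ (σ e))
      · have h1 := ub 24 fun e he _ => by
          simp only [wt, hkc e he, hvc e he, k4, hv]
          norm_num
          split_ifs <;> norm_num
        obtain ⟨e, he, p1, p2⟩ := hop
        have hb0 := bzero fun x hx hbx => by
          have h3 := hb x hbx
          rw [← orb_eq_of_mem he] at hx k4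
          obtain ⟨h4, h5⟩ := orb_of_card_four k4
          rcases h5 x hx with rfl | rfl | rfl | rfl
          · exact h3.1 p1
          · exact h3.2 p2
          · exact h3.1 p2
          · exact h3.2 (by rwa [h4])
        have k4' : ((orb σ d).card : ℤ) = 4 := by exact_mod_cast k4
        rw [k4'] at bdisj ⊢
        rw [hv] at h1 opos ⊢
        push_cast at *
        linarith
      · push Not at hop
        have h1 := ub 21 fun e he hP => by
          simp [wt, hkc e he, hvc e he, k4, hv, hop e he hP]
        have h2 := olt (by omega) (by omega)
        have k4' : ((orb σ d).card : ℤ) = 4 := by exact_mod_cast k4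
        rw [k4'] at bdisj ⊢
        rw [hv] at h1 opos ⊢
        push_cast at *
        linarith
    · have h1 := ub 24 fun e he _ => by
        simp [wt, hkc e he, hvc e he, k4, hv]
      have h2 := olt (by omega) (by omega)
      have k4' : ((orb σ d).card : ℤ) = 4 := by exact_mod_cast k4
      rw [k4'] at bdisj ⊢
      rw [hv] at h1 opos ⊢
      push_cast at *
      linarith
    · have h1 := ub 24 fun e he _ => by
        simp [wt, hkc e he, hvc e he, k4, hv]
      have k4' : ((orb σ d).card : ℤ) = 4 := by exact_mod_cast k4
      rw [k4'] at bdisj ⊢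
      rw [hv] at h1 opos ⊢
      push_cast at *
      linarith
  · have h1 := ub 30 fun e he _ => by
      simp [wt, hkc e he, k3, k4]
    have hk5 : (5 : ℤ) ≤ ((orb σ d).card : ℤ) := by
      have : 5 ≤ (orb σ d).card := by omega
      exact_mod_cast this
    have hv0 : (0 : ℤ) ≤ (orbP σ P d : ℤ) := Int.natCast_nonneg _
    have hvk' : (orbP σ P d : ℤ) ≤ ((orb σ d).card : ℤ) := by exact_mod_cast hvk
    by_cases hv : orbP σ P d = 0
    · rw [hv] at h1 ⊢
      push_cast at *
      linarith
    · by_cases hlt : orbP σ P d < (orb σ d).card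
      · have h2 := olt hv hlt
        have : (1 : ℤ) ≤ (orbP σ P d : ℤ) := by
          have : 1 ≤ orbP σ P d := by omega
          exact_mod_cast this
        linarith
      · have : (orbP σ P d : ℤ) = ((orb σ d).card : ℤ) := by
          have : orbP σ P d = (orb σ d).card := by omega
          exact_mod_cast this
        linarith

end Orbits

/-! ### Discharging in the arrangement -/

/-- The inner darts of the arrangement. -/
abbrev QDart (S : Finset Pt) (G : Finset (Sym2 Pt)) : Type := Dart (vpts S G) (NAdj S G)

/-- The dart starts at one of the given points. -/
def Orig {S : Finset Pt} {G : Finset (Sym2 Pt)} (d : QDart S G) : Prop := d.1.1 ∈ S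

/-- Both ends of the dart are crossings of edges through a common point on its right. -/
def Fan {S : Finset Pt} {G : Finset (Sym2 Pt)} (s : QDart S G) : Prop :=
  s.1.1 ∈ xpts G ∧ s.1.2 ∈ xpts G ∧ ∃ v ∈ S, ∃ e ∈ G, ∃ f ∈ G, v ∈ e ∧ v ∈ f ∧ InO e s.1.1 ∧
    InO f s.1.2 ∧ ori s.1.1 s.1.2 v < 0

/-- The reversed dart, if it is an inner dart. -/
def revD {S : Finset Pt} {G : Finset (Sym2 Pt)} (d : QDart S G) : QDart S G :=
  if hs : (d.1.2, d.1.1) ∈ innerDarts (vpts S G) (NAdj S G) then ⟨_, hs⟩ else d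

theorem revD_revD {S : Finset Pt} {G : Finset (Sym2 Pt)} (d : QDart S G) : revD (revD d) = d := by
  by_cases hs : (d.1.2, d.1.1) ∈ innerDarts (vpts S G) (NAdj S G)
  · have h1 : revD d = ⟨_, hs⟩ := dif_pos hs
    rw [h1]
    exact dif_pos d.2
  · have h1 : revD d = d := dif_neg hs
    rw [h1, h1]

theorem revD_injective {S : Finset Pt} {G : Finset (Sym2 Pt)} :
    Function.Injective (revD (S := S) (G := G)) :=
  Function.LeftInverse.injective revD_revD

/-- Two points in the relative interior of a segment are in the same direction from an end. -/
theorem InO.exists_lerp {e : Sym2 Pt} {v x y : Pt} (hv : v ∈ e) (hx : InO e x) (hy : InO e y) :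
    ∃ t, 0 < t ∧ y = lerp v x t := by
  obtain ⟨w, rfl⟩ := hv
  obtain ⟨a, a0, a1, rfl⟩ := inO_mk.1 hx
  obtain ⟨b, b0, b1, rfl⟩ := inO_mk.1 hy
  refine ⟨b / a, div_pos b0 a0, ?_⟩
  rw [lerp_lerp_right, div_mul_cancel₀ _ a0.ne']

/-- Points of `T` inject by `f` into `F`, away from the image by `g` of `F` and `Q`. -/
theorem card_filter_le_of_injective {α : Type*} [Fintype α] {T F Q B : α → Prop} {f g : α → α}
    (hf : Function.Injective f) (hg : Function.Injective g) (hfg : ∀ a b, T a → Q b → f a ≠ g b)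
    (hTF : ∀ a, T a → F (f a)) (hQF : ∀ a, F a → Q a → F (g a))
    (hB : ∀ a, F a → ¬ Q a → B a) :
    (Finset.univ.filter T).card ≤ (Finset.univ.filter B).card := by
  have i1 := Finset.card_image_of_injective (Finset.univ.filter T) hf
  have i2 := Finset.card_image_of_injective ((Finset.univ.filter F).filter Q) hg
  have hd : Disjoint ((Finset.univ.filter T).image f)
      (((Finset.univ.filter F).filter Q).image g) := by
    rw [Finset.disjoint_left]
    intro x h1 h2
    obtain ⟨a, ha, rfl⟩ := Finset.mem_image.1 h1
    obtain ⟨b, hb, he⟩ := Finset.mem_image.1 h2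
    exact hfg a b (Finset.mem_filter.1 ha).2 (Finset.mem_filter.1 hb).2 he.symm
  have hsub : ((Finset.univ.filter T).image f) ∪ (((Finset.univ.filter F).filter Q).image g) ⊆
      Finset.univ.filter F := by
    intro x hx
    rw [Finset.mem_filter]
    refine ⟨Finset.mem_univ _, ?_⟩
    rcases Finset.mem_union.1 hx with hx | hx
    · obtain ⟨a, ha, rfl⟩ := Finset.mem_image.1 hx
      exact hTF a (Finset.mem_filter.1 ha).2
    · obtain ⟨a, ha, rfl⟩ := Finset.mem_image.1 hx
      rw [Finset.mem_filter, Finset.mem_filter] at ha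
      exact hQF a ha.1.2 ha.2
  have hc := Finset.card_le_card hsub
  rw [Finset.card_union_of_disjoint hd, i1, i2] at hc
  have hsplit : ((Finset.univ.filter F).filter Q).card +
      ((Finset.univ.filter F).filter fun a => ¬ Q a).card = (Finset.univ.filter F).card :=
    Finset.card_filter_add_card_filter_not Q
  have hFB : (Finset.univ.filter F).filter (fun a => ¬ Q a) ⊆ Finset.univ.filter B := by
    intro a ha
    rw [Finset.mem_filter, Finset.mem_filter] at ha
    exact Finset.mem_filter.2 ⟨Finset.mem_univ _, hB a ha.1.2 ha.2⟩
  have := Finset.card_le_card hFB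
  omega

namespace QNet
variable {S : Finset Pt} {G : Finset (Sym2 Pt)} (h : QNet S G)
include h

theorem φ_adj (d : QDart S G) : NAdj S G d.1.2 (h.net.φ d).1.2 := by
  have := (h.net.φ d).adj
  rwa [h.net.φ_fst] at this

theorem φφ_fst (d : QDart S G) : (h.net.φ (h.net.φ d)).1.1 = (h.net.φ d).1.2 := h.net.φ_fst _

theorem φ_ne (d : QDart S G) : h.net.φ d ≠ d := fun he => by
  have h1 := h.net.φ_fst d
  rw [he] at h1
  exact h.net.ne d.adj h1

theorem φφ_ne (d : QDart S G) : h.net.φ (h.net.φ d) ≠ d := fun he => by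
  have h1 := h.φφ_fst d
  have h2 := h.net.φ_left d
  rw [← h1, he, ori_self_mid] at h2
  exact lt_irrefl _ h2

theorem three_le_card (d : QDart S G) : 3 ≤ (orb h.net.φ d).card := by
  have : ({d, h.net.φ d, h.net.φ (h.net.φ d)} : Finset (QDart S G)) ⊆ orb h.net.φ d := by
    intro e he
    simp only [Finset.mem_insert, Finset.mem_singleton] at he
    rcases he with rfl | rfl | rfl
    · exact self_mem_orb _
    · exact apply_mem_orb (self_mem_orb _)
    · exact apply_mem_orb (apply_mem_orb (self_mem_orb _))
  refine le_trans (le_of_eq ?_) (Finset.card_le_card this)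
  rw [Finset.card_eq_three.2]
  exact ⟨_, _, _, (h.φ_ne d).symm, (h.φφ_ne d).symm, (h.φ_ne _).symm, rfl⟩

theorem tri_snd {d : QDart S G} (hd : h.net.φ (h.net.φ (h.net.φ d)) = d) :
    (h.net.φ (h.net.φ d)).1.2 = d.1.1 := by
  rw [← h.net.φ_fst, hd]

theorem tri_adj {d : QDart S G} (hd : h.net.φ (h.net.φ (h.net.φ d)) = d) :
    NAdj S G (h.net.φ d).1.2 d.1.1 := by
  have := h.φ_adj (h.net.φ d)
  rwa [h.tri_snd hd] at this

theorem cr_lab {p q r : Pt} (h1 : NAdj S G p q) (h2 : NAdj S G q r) (hq : q ∈ xpts G) :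
    Cr (lab G p q) (lab G q r) :=
  ⟨q, h.inO_of_inC (lab_spec h1).1 hq (lab_spec h1).2.2,
    h.inO_of_inC (lab_spec h2).1 hq (lab_spec h2).2.1⟩

theorem mem_xpts_of_not_orig {d : QDart S G} (hd : ¬ Orig d) : d.1.1 ∈ xpts G :=
  mem_vpts_cases (h.net.mem d.adj) hd

theorem tri_ne {d : QDart S G} (hd : (orb h.net.φ d).card = 3) :
    orbP h.net.φ Orig d ≠ 0 := by
  intro h0
  obtain ⟨h3, -⟩ := orb_of_card_three hd
  have hx : ∀ e ∈ orb h.net.φ d, e.1.1 ∈ xpts G := fun e he => h.mem_xpts_of_not_orig fun ho => by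
    rw [orbP, Finset.card_eq_zero, Finset.filter_eq_empty_iff] at h0
    exact h0 he ho
  have m0 := self_mem_orb (σ := h.net.φ) d
  have x0 := hx _ m0
  have x1 := hx _ (apply_mem_orb m0)
  have x2 := hx _ (apply_mem_orb (apply_mem_orb m0))
  rw [h.net.φ_fst] at x1 x2
  have a0 := d.adj
  have a1 := h.φ_adj d
  have a2 := h.tri_adj h3
  have o := h.net.φ_left d
  have o1 : ori d.1.2 (h.net.φ d).1.2 d.1.1 ≠ 0 := by rw [ori_rot]; exact o.ne'
  have o2 : ori (h.net.φ d).1.2 d.1.1 d.1.2 ≠ 0 := by rw [ori_rot, ori_rot]; exact o.ne'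
  exact h.qp (lab_spec a0).1 (lab_spec a1).1 (lab_spec a2).1 (lab_ne a0 a1 o.ne')
    (lab_ne a1 a2 o1) (lab_ne a2 a0 o2).symm (h.cr_lab a0 a1 x1) (h.cr_lab a1 a2 x2)
    (h.cr_lab a2 a0 x0).symm

/-- Around a fan dart, the next edge is the one through the common point. -/
theorem fan_next {y x t v : Pt} {f : Sym2 Pt} (a : NAdj S G y x) (a' : NAdj S G x t)
    (hx : x ∈ xpts G) (ho : ori y x t ≠ 0) (hf : f ∈ G) (hv : v ∈ f)
    (hfx : InO f x) (hov : ori y x v ≠ 0) : lab G x t = f := by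
  obtain ⟨l1, l2, l3⟩ := lab_spec a
  obtain ⟨m1, m2, m3⟩ := lab_spec a'
  refine h.eq_of_three l1 m1 hf (h.inO_of_inC l1 hx l3) (h.inO_of_inC m1 hx m2) hfx
    (lab_ne a a' ho) fun heq => hov ?_
  rw [heq] at l2 l3
  exact InC.ori_eq_zero l2 l3 (inC_of_mem hv)

theorem fan_prev {y x t v : Pt} {f : Sym2 Pt} (a : NAdj S G y x) (a' : NAdj S G t y)
    (hy : y ∈ xpts G) (ho : ori t y x ≠ 0) (hf : f ∈ G) (hv : v ∈ f)
    (hfy : InO f y) (hov : ori y x v ≠ 0) : lab G t y = f := by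
  rw [h.lab_comm a']
  refine h.fan_next (h.net.symm a) (h.net.symm a') hy ?_ hf hv hfy (v := v) ?_
  · rw [← ori_rot, ori_rot, ori_swap_right, ← ori_rot]
    exact neg_ne_zero.2 ho
  · rw [ori_swap]; exact neg_ne_zero.2 hov

theorem fan_card_ne {s : QDart S G} (hs : Fan s) : (orb h.net.φ s).card ≠ 3 := by
  intro h3
  obtain ⟨h3, -⟩ := orb_of_card_three h3
  obtain ⟨hy, hx, v, hv, e, he, f, hf, hve, hvf, hey, hfx, ho⟩ := hs
  have o := h.net.φ_left s
  have a1 := h.φ_adj s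
  have a2 := h.tri_adj h3
  have l1 := h.fan_next s.adj a1 hx o.ne' hf hvf hfx ho.ne
  have l2 := h.fan_prev s.adj a2 hy (by rw [ori_rot, ori_rot]; exact o.ne') he hve hey ho.ne
  have t1 := (lab_spec a1).2.2
  have t2 := (lab_spec a2).2.1
  rw [l1] at t1
  rw [l2] at t2
  have hef : e ≠ f := by
    rintro rfl
    exact ho.ne (InC.ori_eq_zero hey.inC hfx.inC (inC_of_mem hve))
  have := h.meet_unique he hf hef t2 t1 (inC_of_mem hve) (inC_of_mem hvf)
  rw [this] at o
  linarith

theorem revD_val {d : QDart S G} (hx : d.1.1 ∈ xpts G ∨ d.1.2 ∈ xpts G) :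
    (revD d).1 = (d.1.2, d.1.1) := by
  have := h.inner_of_xpts (h.net.symm d.adj) hx.symm
  rw [revD, dif_pos this]

theorem fan_base {d : QDart S G} (hd : Orig d) (h3 : (orb h.net.φ d).card = 3)
    (h1 : orbP h.net.φ Orig d = 1) : Fan (revD (h.net.φ d)) := by
  have hx : ∀ e ∈ orb h.net.φ d, e ≠ d → e.1.1 ∈ xpts G := fun e he hne =>
    h.mem_xpts_of_not_orig fun ho => hne <| Finset.card_le_one.1 h1.le _
      (Finset.mem_filter.2 ⟨he, ho⟩) _ (Finset.mem_filter.2 ⟨self_mem_orb _, hd⟩)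
  obtain ⟨h3, -⟩ := orb_of_card_three h3
  have m0 := self_mem_orb (σ := h.net.φ) d
  have x1 := hx _ (apply_mem_orb m0) (h.φ_ne _)
  have x2 := hx _ (apply_mem_orb (apply_mem_orb m0)) (h.φφ_ne _)
  have hr := h.revD_val (Or.inl x1)
  rw [h.net.φ_fst] at x1 x2 hr
  have a0 := d.adj
  have a2 := h.tri_adj h3
  obtain ⟨l1, l2, l3⟩ := lab_spec a0
  obtain ⟨m1, m2, m3⟩ := lab_spec a2
  rw [Fan, hr]
  refine ⟨x2, x1, d.1.1, hd, _, m1, _, l1, h.mem_of_inC m1 hd m3, h.mem_of_inC l1 hd l2,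
    h.inO_of_inC m1 x2 m2, h.inO_of_inC l1 x1 l3, ?_⟩
  have := h.net.φ_left d
  simp only [ori] at this ⊢
  linarith

theorem fan_step {s : QDart S G} (hs : Fan s) (h4 : (orb h.net.φ s).card = 4)
    (h0 : orbP h.net.φ Orig s = 0) : Fan (revD (h.net.φ (h.net.φ s))) := by
  have hX : ∀ e ∈ orb h.net.φ s, e.1.1 ∈ xpts G := fun e he => h.mem_xpts_of_not_orig fun ho => by
    rw [orbP, Finset.card_eq_zero, Finset.filter_eq_empty_iff] at h0
    exact h0 he ho
  obtain ⟨h4, -⟩ := orb_of_card_four h4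
  have m0 := self_mem_orb (σ := h.net.φ) s
  have m1 := apply_mem_orb m0
  have m2 := apply_mem_orb m1
  have x2 := hX _ m2
  have x3 := hX _ (apply_mem_orb m2)
  have hr := h.revD_val (Or.inl x2)
  obtain ⟨hy, hx, v, hv, e, he, f, hf, hve, hvf, hey, hfx, ho⟩ := hs
  have a1 := h.φ_adj s
  have a3 := (h.net.φ (h.net.φ (h.net.φ s))).adj
  have o1 := h.net.φ_left s
  have o3 := h.net.φ_left (h.net.φ (h.net.φ (h.net.φ s)))
  have e3 := h.net.φ_fst (h.net.φ (h.net.φ (h.net.φ s)))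
  rw [h4] at o3 e3
  rw [← e3] at a3 o3
  have l1 := h.fan_next s.adj a1 hx o1.ne' hf hvf hfx ho.ne
  have l3 := h.fan_prev s.adj a3 hy o3.ne' he hve hey ho.ne
  rw [h.net.φ_fst] at x2 x3 hr
  rw [h.net.φ_fst] at a3 l3
  have t1 := (lab_spec a1).2.2
  have t2 := (lab_spec a3).2.1
  rw [l1] at t1
  rw [l3] at t2
  have t1' := h.inO_of_inC hf x2 t1
  have t2' := h.inO_of_inC he x3 t2
  rw [Fan, hr]
  refine ⟨x3, x2, v, hv, e, he, f, hf, hve, hvf, t2', t1', ?_⟩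
  obtain ⟨α, α0, hα⟩ := InO.exists_lerp hve hey t2'
  obtain ⟨β, β0, hβ⟩ := InO.exists_lerp hvf hfx t1'
  simp only
  rw [hα, hβ]
  have : ori (lerp v s.1.1 α) (lerp v s.1.2 β) v = α * β * ori s.1.1 s.1.2 v := by
    simp only [ori, lerp]; ring
  rw [this]
  exact mul_neg_of_pos_of_neg (mul_pos α0 β0) ho

/-- The total weight of the darts at the given points. -/
theorem sum_wt_le : ∑ d : QDart S G, (if Orig d then wt h.net.φ Orig d else 0) ≤
    6 * (5 * (Fintype.card (QDart S G) : ℤ) +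
      4 * ((Finset.univ.filter (Orig : QDart S G → Prop)).card : ℤ)
      - 20 * ((faces h.net.φ).card : ℤ)) := by
  set Q : QDart S G → Prop := fun d => (orb h.net.φ d).card = 4 ∧ orbP h.net.φ Orig d = 0 with hQ
  set T : QDart S G → Prop := fun d => Orig d ∧ (orb h.net.φ d).card = 3 ∧
    orbP h.net.φ Orig d = 1 with hT
  refine sum_le_of_faces _ Orig (fun d => Fan d ∧ ¬ Q d) T (fun d => ?_) ?_
  · refine sum_wt_orb_le (h.three_le_card d) h.tri_ne ?_ ?_ ?_ fun e => Iff.rfl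
    · intro h3 e he hf
      rw [← orb_eq_of_mem he] at h3
      exact h.fan_card_ne hf.1 h3
    · intro h4 h0 e he hf
      refine hf.2 ⟨?_, ?_⟩
      · rwa [orb_eq_of_mem he]
      · rwa [orbP, orb_eq_of_mem he]
    · rintro e ⟨hf, -⟩
      refine ⟨h.not_mem_S hf.1, ?_⟩
      rw [Orig, h.net.φ_fst]
      exact h.not_mem_S hf.2.1
  · refine card_filter_le_of_injective (T := T) (F := Fan) (Q := Q) 
      (f := fun d => revD (h.net.φ d)) (g := fun d => revD (h.net.φ (h.net.φ d))) (revD_injective.comp h.net.φ.injective)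
      (revD_injective.comp (h.net.φ.injective.comp h.net.φ.injective)) ?_
      (fun a ha => h.fan_base ha.1 ha.2.1 ha.2.2) (fun a ha hq => h.fan_step ha hq.1 hq.2)
      fun a h1 h2 => ⟨h1, h2⟩
    intro d s hd hs he
    have h3 := hd.2.1
    rw [h.net.φ.injective (revD_injective he), orb_apply, hs.1] at h3
    omega

end QNet

/-! ### The corners around a vertex -/

/-- The combinatorial structure of the corners around a vertex: `ρ` is the rotation, `U` says that
the dart is an uncrossed edge, ending at `n`, and otherwise it is crossed by the edge `l`. -/
structure Rosette {D E N : Type} (s : Finset D) (ρ : D → D) (w : D → ℤ) (U : D → Prop) (l : D → E)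
    (n : D → N) (M : N → E → Prop) (P : N → N → Prop) (Q : E → E → Prop) : Prop where
  maps : ∀ d ∈ s, ρ d ∈ s
  inj : ∀ d ∈ s, ∀ d' ∈ s, ρ d = ρ d' → d = d'
  surj : ∀ d ∈ s, ∃ d' ∈ s, ρ d' = d
  ne : ∀ d ∈ s, ρ d ≠ d
  nonneg : ∀ d ∈ s, 0 ≤ w d
  xx : ∀ d ∈ s, ¬ U d → ¬ U (ρ d) → l d = l (ρ d) ∨ (12 ≤ w d ∧ Q (l d) (l (ρ d))) ∨
    (24 ≤ w d ∧ ¬ Q (l d) (l (ρ d)) ∧ ¬ Q (l (ρ d)) (l d)) ∨ 30 ≤ w d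
  ux : ∀ d ∈ s, U d → ¬ U (ρ d) → (9 ≤ w d ∧ M (n d) (l (ρ d))) ∨ 21 ≤ w d
  xu : ∀ d ∈ s, ¬ U d → U (ρ d) → (9 ≤ w d ∧ M (n (ρ d)) (l d)) ∨ 21 ≤ w d
  uu : ∀ d ∈ s, U d → U (ρ d) → 14 ≤ w d ∧ P (n d) (n (ρ d))
  out : ∀ d ∈ s, ¬ U d → ∃ d' ∈ s, ¬ U d' ∧ l d' = l d ∧ (U (ρ d') ∨ l (ρ d') ≠ l d)
  asymm : ∀ u u', P u u' → ¬ P u' u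
  sign : ∀ a ∈ s, ∀ b ∈ s, U a → ¬ U (ρ a) → ¬ U b → U (ρ b) → l (ρ a) = l b →
    M (n a) (l b) → M (n (ρ b)) (l b) → P (n a) (n (ρ b))
  q_asymm : ∀ e e', Q e e' → ¬ Q e' e
  q_three : ∀ e e' e'', Q e e' → Q e' e'' → ¬ Q e'' e
  q_mem : ∀ u e e', M u e → M u e' → ¬ Q e e'

namespace Rosette
variable {D E N : Type} {s : Finset D} {ρ : D → D} {w : D → ℤ} {U : D → Prop} {l : D → E}
  {n : D → N} {M : N → E → Prop} {P : N → N → Prop} {Q : E → E → Prop}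
  (h : Rosette s ρ w U l n M P Q)
include h

theorem le_sum {t : Finset D} (ht : t ⊆ s) : ∑ d ∈ t, w d ≤ ∑ d ∈ s, w d :=
  Finset.sum_le_sum_of_subset_of_nonneg ht fun d hd _ => h.nonneg d hd

theorem sum_two {a b : D} (ha : a ∈ s) (hb : b ∈ s) (hab : a ≠ b) :
    w a + w b ≤ ∑ d ∈ s, w d := by
  have := h.le_sum (t := {a, b}) (by
    intro x hx; simp only [Finset.mem_insert, Finset.mem_singleton] at hx
    rcases hx with rfl | rfl <;> assumption)
  rwa [Finset.sum_pair hab] at this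

theorem sum_three {a b c : D} (ha : a ∈ s) (hb : b ∈ s) (hc : c ∈ s) (hab : a ≠ b) (hac : a ≠ c)
    (hbc : b ≠ c) : w a + w b + w c ≤ ∑ d ∈ s, w d := by
  have := h.le_sum (t := {a, b, c}) (by
    intro x hx; simp only [Finset.mem_insert, Finset.mem_singleton] at hx
    rcases hx with rfl | rfl | rfl <;> assumption)
  rw [Finset.sum_insert (by simp [hab, hac]), Finset.sum_pair hbc] at this
  linarith

theorem sum_four {a b c e : D} (ha : a ∈ s) (hb : b ∈ s) (hc : c ∈ s) (he : e ∈ s) (hab : a ≠ b)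
    (hac : a ≠ c) (hae : a ≠ e) (hbc : b ≠ c) (hbe : b ≠ e) (hce : c ≠ e) :
    w a + w b + w c + w e ≤ ∑ d ∈ s, w d := by
  have := h.le_sum (t := {a, b, c, e}) (by
    intro x hx; simp only [Finset.mem_insert, Finset.mem_singleton] at hx
    rcases hx with rfl | rfl | rfl | rfl <;> assumption)
  rw [Finset.sum_insert (by simp [hab, hac, hae]), Finset.sum_insert (by simp [hbc, hbe]),
    Finset.sum_pair hce] at this
  linarith

theorem sum_five {a b c e f : D} (ha : a ∈ s) (hb : b ∈ s) (hc : c ∈ s) (he : e ∈ s) (hf : f ∈ s)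
    (hab : a ≠ b) (hac : a ≠ c) (hae : a ≠ e) (haf : a ≠ f) (hbc : b ≠ c) (hbe : b ≠ e)
    (hbf : b ≠ f) (hce : c ≠ e) (hcf : c ≠ f) (hef : e ≠ f) :
    w a + w b + w c + w e + w f ≤ ∑ d ∈ s, w d := by
  have := h.le_sum (t := {a, b, c, e, f}) (by
    intro x hx; simp only [Finset.mem_insert, Finset.mem_singleton] at hx
    rcases hx with rfl | rfl | rfl | rfl | rfl <;> assumption)
  rw [Finset.sum_insert (by simp [hab, hac, hae, haf]), Finset.sum_insert (by simp [hbc, hbe, hbf]),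
    Finset.sum_insert (by simp [hce, hcf]), Finset.sum_pair hef] at this
  linarith

/-- With at least three uncrossed edges the weight is large. -/
theorem sum_ge_of_three (h3 : 3 ≤ (s.filter U).card) : 42 ≤ ∑ d ∈ s, w d := by
  have h1 : ∀ d ∈ s, (7 * ((if U d then 1 else 0) + (if U (ρ d) then 1 else 0)) : ℤ) ≤ w d := by
    intro d hd
    by_cases u1 : U d <;> by_cases u2 : U (ρ d)
    · have := (h.uu d hd u1 u2).1; simp [u1, u2]; linarith
    · simp only [u1, u2, if_true, if_false]; rcases h.ux d hd u1 u2 with h | h <;> linarith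
    · simp only [u1, u2, if_true, if_false]; rcases h.xu d hd u1 u2 with h | h <;> linarith
    · have := h.nonneg d hd; simpa [u1, u2]
  have h2 := Finset.sum_le_sum h1
  have h4 : ∑ d ∈ s, (if U (ρ d) then 1 else 0 : ℤ) = ∑ d ∈ s, (if U d then 1 else 0 : ℤ) :=
    Finset.sum_bij (fun d _ => ρ d) h.maps h.inj
      (fun d hd => by obtain ⟨d', h1, h2⟩ := h.surj d hd; exact ⟨d', h1, h2⟩) fun _ _ => rfl
  have h5 : ((s.filter U).card : ℤ) = ∑ d ∈ s, (if U d then 1 else 0 : ℤ) := by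
    rw [Finset.card_filter]; push_cast; rfl
  rw [← Finset.mul_sum, Finset.sum_add_distrib, h4, ← h5] at h2
  have : (3 : ℤ) ≤ ((s.filter U).card : ℤ) := by exact_mod_cast h3
  linarith

theorem xx' {d : D} (hd : d ∈ s) (hU : ¬ U d) (hU' : ¬ U (ρ d)) (hl : l (ρ d) ≠ l d) :
    12 ≤ w d ∧ (w d < 24 → Q (l d) (l (ρ d))) := by
  rcases h.xx d hd hU hU' with h1 | ⟨h1, h2⟩ | ⟨h1, -⟩ | h1
  · exact absurd h1.symm hl
  · exact ⟨h1, fun _ => h2⟩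
  · exact ⟨by linarith, fun h => by linarith⟩
  · exact ⟨by linarith, fun h => by linarith⟩

/-- With no uncrossed edges the weight is large. -/
theorem sum_ge_of_zero (hs : s.Nonempty) (h0 : ∀ d ∈ s, ¬ U d) : 42 ≤ ∑ d ∈ s, w d := by
  have out : ∀ d ∈ s, ∃ d' ∈ s, l d' = l d ∧ l (ρ d') ≠ l d' := by
    intro d hd
    obtain ⟨d', h1, -, h3, h4⟩ := h.out d hd (h0 d hd)
    exact ⟨d', h1, h3, h3.symm ▸ h4.resolve_left (h0 _ (h.maps _ h1))⟩
  have wt : ∀ d ∈ s, l (ρ d) ≠ l d → 12 ≤ w d ∧ (w d < 24 → Q (l d) (l (ρ d))) :=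
    fun d hd hl => h.xx' hd (h0 d hd) (h0 _ (h.maps d hd)) hl
  obtain ⟨d0, hd0⟩ := hs
  obtain ⟨d1, m1, -, n1⟩ := out d0 hd0
  obtain ⟨d2, m2, e2, n2⟩ := out _ (h.maps d1 m1)
  obtain ⟨w1, q1⟩ := wt d1 m1 n1
  obtain ⟨w2, q2⟩ := wt d2 m2 n2
  have d12 : d1 ≠ d2 := by rintro rfl; exact n1 e2.symm
  by_contra! hlt
  by_cases he : l (ρ d2) = l d1
  · have hs2 := h.sum_two m1 m2 d12
    rcases h.xx d1 m1 (h0 _ m1) (h0 _ (h.maps _ m1)) with h1 | ⟨h1, h2⟩ | ⟨h1, h2, h2'⟩ | h1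
    · exact n1 h1.symm
    · rcases h.xx d2 m2 (h0 _ m2) (h0 _ (h.maps _ m2)) with g1 | ⟨g1, g2⟩ | ⟨g1, g2, g2'⟩ | g1
      · exact n2 g1.symm
      · rw [he, e2] at g2
        exact h.q_asymm _ _ h2 g2
      · rw [he, e2] at g2'
        exact g2' h2
      · linarith
    · have := q2 (by linarith)
      rw [he, e2] at this
      exact h2' this
    · linarith
  · obtain ⟨d3, m3, e3, n3⟩ := out _ (h.maps d2 m2)
    obtain ⟨w3, q3⟩ := wt d3 m3 n3
    have d13 : d1 ≠ d3 := by rintro rfl; exact he e3.symm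
    have d23 : d2 ≠ d3 := by rintro rfl; exact n2 e3.symm
    have hs3 := h.sum_three m1 m2 m3 d12 d13 d23
    have q1 := q1 (by linarith)
    have q2 := q2 (by linarith)
    have q3 := q3 (by linarith)
    rw [← e2] at q1
    rw [← e3] at q2
    by_cases h31 : l (ρ d3) = l d1
    · rw [h31] at q3
      exact h.q_three _ _ _ q1 q2 q3
    by_cases h32 : l (ρ d3) = l d2
    · rw [h32] at q3
      exact h.q_asymm _ _ q2 q3
    obtain ⟨d4, m4, e4, n4⟩ := out _ (h.maps d3 m3)
    obtain ⟨w4, -⟩ := wt d4 m4 n4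
    have := h.sum_four m1 m2 m3 m4 d12 d13 (by rintro rfl; exact h31 e4.symm) d23
      (by rintro rfl; exact h32 e4.symm) (by rintro rfl; exact n3 e4.symm)
    linarith

theorem irrefl (u : N) : ¬ P u u := fun hp => h.asymm _ _ hp hp

/-- With one uncrossed edge the weight is large. -/
theorem sum_ge_of_one {a : D} (ha : a ∈ s) (hU : U a) (h1 : ∀ d ∈ s, U d → d = a) :
    42 ≤ ∑ d ∈ s, w d := by
  by_contra! hlt
  obtain ⟨b, hb, rfl⟩ := h.surj a ha
  have ha' := h.maps _ ha
  have Ub : ¬ U b := fun hu => h.ne b hb (h1 b hb hu).symm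
  have Ua : ¬ U (ρ (ρ b)) := fun hu => h.ne _ ha (h1 _ ha' hu)
  have hab : ρ b ≠ b := h.ne b hb
  have key : ∀ d ∈ s, ¬ U d → ∃ d' ∈ s, ¬ U d' ∧ l d' = l d ∧
      (d' = b ∨ ¬ U (ρ d') ∧ l (ρ d') ≠ l d') := by
    intro d hd hu
    obtain ⟨d', m', u', e', ho⟩ := h.out d hd hu
    refine ⟨d', m', u', e', ?_⟩
    by_cases hu' : U (ρ d')
    · exact Or.inl (h.inj _ m' _ hb (h1 _ (h.maps _ m') hu'))
    · exact Or.inr ⟨hu', e'.symm ▸ ho.resolve_left hu'⟩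
  have hA := h.ux _ ha hU Ua
  have hB := h.xu _ hb Ub hU
  have hs2 := h.sum_two ha hb hab
  have wA : 9 ≤ w (ρ b) := by rcases hA with h | h <;> linarith
  have wB : 9 ≤ w b := by rcases hB with h | h <;> linarith
  obtain ⟨d1, m1, u1, e1, hd1⟩ := key _ ha' Ua
  by_cases hdb : d1 = b
  · subst hdb
    have contra : M (n (ρ d1)) (l d1) → False := fun hM =>
      h.irrefl _ (h.sign _ ha _ hb hU Ua Ub hU e1.symm hM hM)
    rcases hA with ⟨-, hA⟩ | hA
    · exact contra (e1 ▸ hA)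
    rcases hB with ⟨-, hB⟩ | hB
    · exact contra hB
    linarith
  · obtain ⟨u1', n1⟩ := hd1.resolve_left hdb
    obtain ⟨w1, q1⟩ := h.xx' m1 u1 u1' n1
    have d1a : ρ b ≠ d1 := by rintro rfl; exact u1 hU
    have hs3 := h.sum_three ha hb m1 hab d1a (Ne.symm hdb)
    rcases hA with ⟨-, hA⟩ | hA
    swap
    · linarith
    rcases hB with ⟨-, hB⟩ | hB
    swap
    · linarith
    have q1 := q1 (by linarith)
    obtain ⟨d3, m3, u3, e3, hd3⟩ := key _ (h.maps _ m1) u1'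
    rw [← e1] at hA
    by_cases h3b : d3 = b
    · subst h3b
      rw [← e3] at q1
      exact h.q_mem _ _ _ hA hB q1
    · obtain ⟨u3', n3⟩ := hd3.resolve_left h3b
      obtain ⟨w3, -⟩ := h.xx' m3 u3 u3' n3
      have := h.sum_four ha hb m1 m3 hab d1a (by rintro rfl; exact u3 hU) (Ne.symm hdb)
        (Ne.symm h3b) (by rintro rfl; exact n1 e3.symm)
      linarith

/-- With two consecutive uncrossed edges and no other ones the weight is large. -/
theorem sum_ge_of_two_adj {a : D} (ha : a ∈ s) (hU : U a) (hU' : U (ρ a))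
    (h2 : ∀ d ∈ s, U d → d = a ∨ d = ρ a) : 42 ≤ ∑ d ∈ s, w d := by
  by_contra! hlt
  obtain ⟨b, hb, hba⟩ := h.surj a ha
  have hc := h.maps _ ha
  have hc' := h.maps _ hc
  obtain ⟨w1, P1⟩ := h.uu a ha hU hU'
  have hbn : b ≠ ρ a := by
    rintro rfl
    have := (h.uu _ hb hU' (hba.symm ▸ hU)).2
    rw [hba] at this
    exact h.asymm _ _ P1 this
  have hbn' : b ≠ a := by rintro rfl; exact h.ne _ hb hba
  have Ub : ¬ U b := fun hu => (h2 b hb hu).elim hbn' hbn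
  have Uc : ¬ U (ρ (ρ a)) := fun hu => by
    rcases h2 _ hc' hu with h3 | h3
    · exact hbn (h.inj _ hb _ hc (hba.trans h3.symm))
    · exact h.ne _ hc h3
  have hA := h.ux _ hc hU' Uc
  have hB := h.xu _ hb Ub (hba.symm ▸ hU)
  have wA : 9 ≤ w (ρ a) := by rcases hA with h | h <;> linarith
  have wB : 9 ≤ w b := by rcases hB with h | h <;> linarith
  have hac : a ≠ ρ a := (h.ne _ ha).symm
  have hs3 := h.sum_three ha hc hb hac hbn'.symm hbn.symm
  rcases hA with ⟨-, hA⟩ | hA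
  swap
  · linarith
  rcases hB with ⟨-, hB⟩ | hB
  swap
  · linarith
  obtain ⟨d, m, u, e, ho⟩ := h.out _ hc' Uc
  by_cases hu : U (ρ d)
  · rcases h2 _ (h.maps _ m) hu with h3 | h3
    · have := h.inj _ m _ hb (h3.trans hba.symm)
      subst this
      rw [← e] at hA
      have := h.sign _ hc _ hb hU' Uc Ub hu e.symm hA hB
      rw [hba] at this
      exact h.asymm _ _ P1 this
    · exact u (h.inj _ m _ ha h3 ▸ hU)
  · have := (h.xx' m u hu (e.symm ▸ ho.resolve_left hu)).1
    have := h.sum_four ha hc hb m hac hbn'.symm (by rintro rfl; exact u hU) hbn.symm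
      (by rintro rfl; exact u hU') (by rintro rfl; exact hu (hba.symm ▸ hU))
    linarith

/-- With two uncrossed edges the weight is large. -/
theorem sum_ge_of_two {a a' : D} (ha : a ∈ s) (ha' : a' ∈ s) (hne : a ≠ a') (hU : U a)
    (hU' : U a') (h2 : ∀ d ∈ s, U d → d = a ∨ d = a') : 42 ≤ ∑ d ∈ s, w d := by
  by_cases h3 : ρ a = a'
  · subst h3
    exact h.sum_ge_of_two_adj ha hU hU' h2
  by_cases h4 : ρ a' = a
  · subst h4
    exact h.sum_ge_of_two_adj ha' hU' hU fun d hd hu => (h2 d hd hu).symm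
  by_contra! hlt
  obtain ⟨b, hb, hba⟩ := h.surj a ha
  obtain ⟨b', hb', hba'⟩ := h.surj a' ha'
  have b1 : b ≠ a := by rintro rfl; exact h.ne _ hb hba
  have b2 : b ≠ a' := by rintro rfl; exact h4 hba
  have b3 : b' ≠ a := by rintro rfl; exact h3 hba'
  have b4 : b' ≠ a' := by rintro rfl; exact h.ne _ hb' hba'
  have b5 : b ≠ b' := by rintro rfl; exact hne (hba.symm.trans hba')
  have Ub : ¬ U b := fun hu => (h2 b hb hu).elim b1 b2
  have Ub' : ¬ U b' := fun hu => (h2 b' hb' hu).elim b3 b4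
  have Ua : ¬ U (ρ a) := fun hu => (h2 _ (h.maps _ ha) hu).elim (h.ne _ ha) h3
  have Ua' : ¬ U (ρ a') := fun hu => (h2 _ (h.maps _ ha') hu).elim h4 (h.ne _ ha')
  have A := h.ux _ ha hU Ua
  have A' := h.ux _ ha' hU' Ua'
  have B := h.xu _ hb Ub (hba.symm ▸ hU)
  have B' := h.xu _ hb' Ub' (hba'.symm ▸ hU')
  have wA : 9 ≤ w a := by rcases A with h | h <;> linarith
  have wA' : 9 ≤ w a' := by rcases A' with h | h <;> linarith
  have wB : 9 ≤ w b := by rcases B with h | h <;> linarith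
  have wB' : 9 ≤ w b' := by rcases B' with h | h <;> linarith
  have hs4 := h.sum_four ha ha' hb hb' hne b1.symm b3.symm b2.symm b4.symm b5
  have A := (A.resolve_right fun h => by linarith).2
  have A' := (A'.resolve_right fun h => by linarith).2
  have B := (B.resolve_right fun h => by linarith).2
  have B' := (B'.resolve_right fun h => by linarith).2
  have key : ∀ x ∈ s, U x → ¬ U (ρ x) → M (n x) (l (ρ x)) →
      P (n x) (n a) ∨ P (n x) (n a') := by
    intro x hx hux hux' hM
    obtain ⟨d, m, u, e, ho⟩ := h.out _ (h.maps _ hx) hux'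
    by_cases hu : U (ρ d)
    · rcases h2 _ (h.maps _ m) hu with h5 | h5
      · have := h.inj _ m _ hb (h5.trans hba.symm)
        subst this
        have := h.sign _ hx _ m hux hux' u hu e.symm (e.symm ▸ hM) B
        rw [h5] at this
        exact Or.inl this
      · have := h.inj _ m _ hb' (h5.trans hba'.symm)
        subst this
        have := h.sign _ hx _ m hux hux' u hu e.symm (e.symm ▸ hM) B'
        rw [h5] at this
        exact Or.inr this
    · exfalso
      have := (h.xx' m u hu (e.symm ▸ ho.resolve_left hu)).1
      have := h.sum_five ha ha' hb hb' m hne b1.symm b3.symm (by rintro rfl; exact u hU) b2.symm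
        b4.symm (by rintro rfl; exact u hU') b5 (by rintro rfl; exact hu (hba.symm ▸ hU))
        (by rintro rfl; exact hu (hba'.symm ▸ hU'))
      linarith
  have p1 := (key a ha hU Ua A).resolve_left (h.irrefl _)
  have p2 := (key a' ha' hU' Ua' A').resolve_right (h.irrefl _)
  exact h.asymm _ _ p1 p2

/-- The weight around a vertex is large. -/
theorem sum_ge (hs : s.Nonempty) : 42 ≤ ∑ d ∈ s, w d := by
  by_cases h3 : 3 ≤ (s.filter U).card
  · exact h.sum_ge_of_three h3
  have hc : (s.filter U).card = 0 ∨ (s.filter U).card = 1 ∨ (s.filter U).card = 2 := by omega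
  rcases hc with hc | hc | hc
  · rw [Finset.card_eq_zero, Finset.filter_eq_empty_iff] at hc
    exact h.sum_ge_of_zero hs fun d hd => hc hd
  · obtain ⟨a, ha⟩ := Finset.card_eq_one.1 hc
    have hm : ∀ d, d ∈ s ∧ U d ↔ d = a := fun d => by
      rw [← Finset.mem_filter, ha, Finset.mem_singleton]
    have := (hm a).2 rfl
    exact h.sum_ge_of_one this.1 this.2 fun d hd hu => (hm d).1 ⟨hd, hu⟩
  · obtain ⟨a, a', hne, ha⟩ := Finset.card_eq_two.1 hc
    have hm : ∀ d, d ∈ s ∧ U d ↔ d = a ∨ d = a' := fun d => by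
      rw [← Finset.mem_filter, ha, Finset.mem_insert, Finset.mem_singleton]
    have h1 := (hm a).2 (Or.inl rfl)
    have h2 := (hm a').2 (Or.inr rfl)
    exact h.sum_ge_of_two h1.1 h2.1 hne h1.2 h2.2 fun d hd hu => (hm d).1 ⟨hd, hu⟩

end Rosette

/-! ### The weight of the corners around a point -/

section Weights
variable {D : Type} [Fintype D] {σ : Equiv.Perm D} {P : D → Prop} {d : D}

theorem wt_nonneg : 0 ≤ wt σ P d := by
  rw [wt]; split_ifs <;> norm_num

theorem le_wt_of_card (h3 : (orb σ d).card ≠ 3) : 12 ≤ wt σ P d := by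
  rw [wt, if_neg h3]; split_ifs <;> norm_num

theorem wt_of_card_ne (h3 : (orb σ d).card ≠ 3) (h4 : (orb σ d).card ≠ 4) : wt σ P d = 30 := by
  rw [wt, if_neg h3, if_neg h4]

theorem le_wt_of_two (h2 : 2 ≤ orbP σ P d) : 9 ≤ wt σ P d := by
  rw [wt]; split_ifs <;> omega

theorem le_wt_of_two_of_card (h2 : 2 ≤ orbP σ P d) (h3 : (orb σ d).card ≠ 3) : 21 ≤ wt σ P d := by
  rw [wt, if_neg h3]; split_ifs <;> omega

theorem le_wt_of_three (h2 : 3 ≤ orbP σ P d) : 14 ≤ wt σ P d := by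
  rw [wt]; split_ifs <;> omega

theorem le_wt_of_opposite (h2 : 2 ≤ orbP σ P d) (h3 : (orb σ d).card ≠ 3) (ho : P (σ (σ d))) :
    24 ≤ wt σ P d := by
  rw [wt, if_neg h3]; split_ifs with c1 c2 c3 <;> first | omega | exact (c3.2 ho).elim

theorem two_le_orbP {a b : D} (ha : a ∈ orb σ d) (hb : b ∈ orb σ d) (hab : a ≠ b) (pa : P a)
    (pb : P b) : 2 ≤ orbP σ P d := by
  rw [orbP, ← Finset.card_pair hab]
  refine Finset.card_le_card fun x hx => ?_
  simp only [Finset.mem_insert, Finset.mem_singleton] at hx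
  rcases hx with rfl | rfl
  · exact Finset.mem_filter.2 ⟨ha, pa⟩
  · exact Finset.mem_filter.2 ⟨hb, pb⟩

theorem three_le_orbP {a b c : D} (ha : a ∈ orb σ d) (hb : b ∈ orb σ d) (hc : c ∈ orb σ d)
    (hab : a ≠ b) (hac : a ≠ c) (hbc : b ≠ c) (pa : P a) (pb : P b) (pc : P c) :
    3 ≤ orbP σ P d := by
  have h3 : ({a, b, c} : Finset D).card = 3 := Finset.card_eq_three.2 ⟨_, _, _, hab, hac, hbc, rfl⟩
  rw [orbP, ← h3]
  refine Finset.card_le_card fun x hx => ?_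
  simp only [Finset.mem_insert, Finset.mem_singleton] at hx
  rcases hx with rfl | rfl | rfl
  · exact Finset.mem_filter.2 ⟨ha, pa⟩
  · exact Finset.mem_filter.2 ⟨hb, pb⟩
  · exact Finset.mem_filter.2 ⟨hc, pc⟩

end Weights

/-- The edge crossing a dart at its end. -/
def tv {S : Finset Pt} {G : Finset (Sym2 Pt)} (d : QDart S G) : Sym2 Pt :=
  if hc : ∃ e ∈ G, InO e d.1.2 ∧ e ≠ lab G d.1.1 d.1.2 then hc.choose else lab G d.1.1 d.1.2

/-- Two edges cross, and the second one turns left after the first one, when they are directed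
with `v` on the left. -/
def Turn (G : Finset (Sym2 Pt)) (v : Pt) (e f : Sym2 Pt) : Prop :=
  e ∈ G ∧ f ∈ G ∧ Cr e f ∧ ∃ a b c d : Pt, e = s(a, b) ∧ f = s(c, d) ∧ 0 < ori v a b ∧
    0 < ori v c d ∧ 0 < (b.1 - a.1) * (d.2 - c.2) - (b.2 - a.2) * (d.1 - c.1)

theorem Turn.asymm {G : Finset (Sym2 Pt)} {v : Pt} {e f : Sym2 Pt} (h1 : Turn G v e f) :
    ¬ Turn G v f e := by
  rintro ⟨-, -, -, a, b, c, d, hf, he, ho, ho', hc⟩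
  obtain ⟨-, -, -, a', b', c', d', rfl, rfl, go, go', gc⟩ := h1
  rw [ori_swap_right] at ho ho'
  rw [Sym2.eq_iff] at hf he
  rcases hf with ⟨rfl, rfl⟩ | ⟨rfl, rfl⟩
  · rcases he with ⟨rfl, rfl⟩ | ⟨rfl, rfl⟩
    · linarith
    · linarith
  · linarith

theorem Turn.ne {G : Finset (Sym2 Pt)} {v : Pt} {e f : Sym2 Pt} (h1 : Turn G v e f) : e ≠ f := by
  rintro rfl
  exact h1.asymm h1

namespace QNet
variable {S : Finset Pt} {G : Finset (Sym2 Pt)} (h : QNet S G)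
include h

theorem tv_spec {d : QDart S G} (hx : d.1.2 ∈ xpts G) :
    tv d ∈ G ∧ InO (tv d) d.1.2 ∧ tv d ≠ lab G d.1.1 d.1.2 := by
  have hc : ∃ e ∈ G, InO e d.1.2 ∧ e ≠ lab G d.1.1 d.1.2 := by
    obtain ⟨e, he, f, hf, hne, h1, h2⟩ := h.mem_xpts.1 hx
    by_cases h0 : e = lab G d.1.1 d.1.2
    · exact ⟨f, hf, h2, fun h3 => hne (h0.trans h3.symm)⟩
    · exact ⟨e, he, h1, h0⟩
  rw [tv, dif_pos hc]
  exact hc.choose_spec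

theorem tv_eq {d : QDart S G} (hx : d.1.2 ∈ xpts G) {e : Sym2 Pt} (he : e ∈ G)
    (hi : InO e d.1.2) (hne : e ≠ lab G d.1.1 d.1.2) : tv d = e := by
  obtain ⟨h1, h2, h3⟩ := h.tv_spec hx
  obtain ⟨l1, l2, l3⟩ := lab_spec d.adj
  exact h.eq_of_three l1 h1 he (h.inO_of_inC l1 hx l3) h2 hi h3.symm hne.symm

theorem not_mem_tv {d : QDart S G} (hx : d.1.2 ∈ xpts G) : d.1.1 ∉ tv d := by
  intro hm
  obtain ⟨h1, h2, h3⟩ := h.tv_spec hx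
  obtain ⟨l1, l2, l3⟩ := lab_spec d.adj
  exact h.net.ne d.adj (h.meet_unique h1 l1 h3 (inC_of_mem hm) l2 h2.inC l3)

/-- An edge missing a point can be directed to have it on the left. -/
theorem exists_direct {v : Pt} {e : Sym2 Pt} (hv : v ∈ S) (he : e ∈ G) (hve : v ∉ e) :
    ∃ a b, e = s(a, b) ∧ 0 < ori v a b := by
  induction e with | _ a b
  obtain ⟨hab, ha, hb⟩ := h.edge he
  have h1 : v ≠ a := by rintro rfl; exact hve (Sym2.mem_mk_left _ _)
  have h2 : v ≠ b := by rintro rfl; exact hve (Sym2.mem_mk_right _ _)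
  rcases (h.gp.ori_ne_zero hv ha hb h1 h2 hab).lt_or_gt with h3 | h3
  · exact ⟨b, a, Sym2.eq_swap, by rw [ori_swap_right]; linarith⟩
  · exact ⟨a, b, rfl, h3⟩

/-- The direction of an edge along a dart with a point on its left. -/
theorem exists_direct_dart {v q x : Pt} {e : Sym2 Pt} (hv : v ∈ S) (he : e ∈ G) (hve : v ∉ e)
    (hq : InC e q) (hx : InC e x) (hqx : q ≠ x) (ho : 0 ≤ ori q x v) :
    ∃ a b, e = s(a, b) ∧ 0 < ori v a b ∧ ∃ k, 0 < k ∧ x.1 - q.1 = k * (b.1 - a.1) ∧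
      x.2 - q.2 = k * (b.2 - a.2) := by
  obtain ⟨a, b, rfl, hab⟩ := h.exists_direct hv he hve
  obtain ⟨α, -, -, rfl⟩ := inC_mk.1 hq
  obtain ⟨β, -, -, rfl⟩ := inC_mk.1 hx
  refine ⟨a, b, rfl, hab, β - α, ?_, by simp only [lerp]; ring, by simp only [lerp]; ring⟩
  have : ori (lerp a b α) (lerp a b β) v = (β - α) * ori v a b := by
    simp only [ori, lerp]; ring
  rw [this] at ho
  have h1 : 0 ≤ β - α := nonneg_of_mul_nonneg_left ho hab
  refine lt_of_le_of_ne h1 fun h0 => hqx ?_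
  rw [show α = β by linarith]

/-- Consecutive sides of a face seen from one of its points turn left. -/
theorem turn_of_darts {v q x r : Pt} {e f : Sym2 Pt} (hv : v ∈ S) (he : e ∈ G) (hf : f ∈ G)
    (hve : v ∉ e) (hvf : v ∉ f) (hq : InC e q) (hx : InO e x) (hx' : InO f x) (hr : InC f r)
    (ho : 0 < ori q x r) (h1 : 0 ≤ ori q x v) (h2 : 0 ≤ ori x r v) : Turn G v e f := by
  have hqx : q ≠ x := ne_of_ori_ne ho.ne'
  have hxr : x ≠ r := by rintro rfl; rw [ori_self_right] at ho; exact lt_irrefl _ ho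
  obtain ⟨a, b, rfl, hab, k, k0, e1, e2⟩ := h.exists_direct_dart hv he hve hq hx.inC hqx h1
  obtain ⟨c, d, rfl, hcd, m, m0, e3, e4⟩ := h.exists_direct_dart hv hf hvf hx'.inC hr hxr h2
  refine ⟨he, hf, ⟨x, hx, hx'⟩, a, b, c, d, rfl, rfl, hab, hcd, ?_⟩
  have : ori q x r = (k * m) * ((b.1 - a.1) * (d.2 - c.2) - (b.2 - a.2) * (d.1 - c.1)) := by
    have : ori q x r = (x.1 - q.1) * (r.2 - x.2) - (x.2 - q.2) * (r.1 - x.1) := by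
      simp only [ori]; ring
    rw [this, e1, e2, e3, e4]; ring
  rw [this] at ho
  exact (mul_pos_iff_of_pos_left (mul_pos k0 m0)).1 ho

/-- The rotation around the starting point of a dart. -/
def rot (d : QDart S G) : QDart S G := revD (h.net.φ.symm d)

theorem rot_left (d : QDart S G) : 0 < ori d.1.1 d.1.2 (h.net.φ.symm d).1.1 := by
  have := (h.net.φ_symm_next d).2.2.1
  rwa [ori_rot]

theorem symm_adj (d : QDart S G) : NAdj S G (h.net.φ.symm d).1.1 d.1.1 := by
  have := (h.net.φ.symm d).adj
  rwa [h.net.φ_symm_snd] at this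

theorem symm_mem_orb (d : QDart S G) : h.net.φ.symm d ∈ orb h.net.φ d := by
  rw [mem_orb, Equiv.Perm.sameCycle_symm_apply_right]

theorem symm_ne (d : QDart S G) : h.net.φ.symm d ≠ d := fun he =>
  h.φ_ne d (by conv_lhs => rw [← he]; simp)

theorem symm_ne_φ (d : QDart S G) : h.net.φ.symm d ≠ h.net.φ d := fun he =>
  h.φφ_ne d (by rw [← he]; simp)

section Corner
variable {d : QDart S G} (hi : ∀ q, NAdj S G d.1.1 q → (d.1.1, q) ∈ innerDarts (vpts S G) (NAdj S G))
include hi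

theorem rot_val : (h.rot d).1 = (d.1.1, (h.net.φ.symm d).1.1) := by
  have h1 := h.net.φ_symm_snd d
  have h2 := hi _ (h.net.symm (h.symm_adj d))
  rw [rot, revD]
  rw [dif_pos (by rw [h1]; exact h2)]
  exact Prod.ext h1 rfl

theorem rot_fst : (h.rot d).1.1 = d.1.1 := by rw [h.rot_val hi]

theorem rot_snd : (h.rot d).1.2 = (h.net.φ.symm d).1.1 := by rw [h.rot_val hi]

theorem rot_pos : 0 < ori d.1.1 d.1.2 (h.rot d).1.2 := by
  rw [h.rot_snd hi]; exact h.rot_left d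

theorem rot_ne : h.rot d ≠ d := fun he => by
  have := h.rot_pos hi
  rw [he, ori_self_right] at this
  exact lt_irrefl _ this

theorem corner_two (ho : Orig d) (hq : d.1.2 ∈ S ∨ (h.rot d).1.2 ∈ S) :
    2 ≤ orbP h.net.φ Orig d := by
  rw [h.rot_snd hi] at hq
  rcases hq with hq | hq
  · exact two_le_orbP (self_mem_orb _) (apply_mem_orb (self_mem_orb _)) (h.φ_ne d).symm ho
      (by rw [Orig, h.net.φ_fst]; exact hq)
  · exact two_le_orbP (self_mem_orb _) (h.symm_mem_orb d) (h.symm_ne d).symm ho hq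

theorem corner_full (ho : Orig d) (hq : d.1.2 ∈ S) (hr : (h.rot d).1.2 ∈ S) :
    3 ≤ orbP h.net.φ Orig d := by
  rw [h.rot_snd hi] at hr
  exact three_le_orbP (self_mem_orb _) (apply_mem_orb (self_mem_orb _)) (h.symm_mem_orb d)
    (h.φ_ne d).symm (h.symm_ne d).symm (h.symm_ne_φ d).symm ho
    (by rw [Orig, h.net.φ_fst]; exact hq) hr

theorem corner_tri (hk : (orb h.net.φ d).card = 3) :
    ∃ g, (d.1.2 ∈ S → d.1.2 ∈ g) ∧ (d.1.2 ∈ xpts G → tv d = g) ∧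
      ((h.rot d).1.2 ∈ S → (h.rot d).1.2 ∈ g) ∧ ((h.rot d).1.2 ∈ xpts G → tv (h.rot d) = g) := by
  have h3 : h.net.φ (h.net.φ d) = h.net.φ.symm d := by
    rw [Equiv.eq_symm_apply]; exact (orb_of_card_three hk).1
  have a := h.φ_adj d
  have er : (h.net.φ d).1.2 = (h.rot d).1.2 := by
    rw [h.rot_snd hi, ← h3, h.φφ_fst]
  rw [er] at a
  have op := h.rot_pos hi
  have ar : NAdj S G d.1.1 (h.rot d).1.2 := by
    have := (h.rot d).adj
    rwa [h.rot_fst hi] at this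
  obtain ⟨g1, g2, g3⟩ := lab_spec a
  refine ⟨_, fun hq => h.mem_of_inC g1 hq g2, fun hq => ?_, fun hr => h.mem_of_inC g1 hr g3,
    fun hr => ?_⟩
  · exact h.tv_eq hq g1 (h.inO_of_inC g1 hq g2) (lab_ne d.adj a op.ne').symm
  · refine h.tv_eq hr g1 (h.inO_of_inC g1 hr g3) ?_
    rw [h.rot_fst hi, h.lab_comm ar]
    refine lab_ne a (h.net.symm ar) ?_
    rw [ori_rot]
    exact op.ne'

theorem corner_quad (ho : Orig d) (hk : (orb h.net.φ d).card = 4) (hq : d.1.2 ∈ xpts G)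
    (hr : (h.rot d).1.2 ∈ xpts G) : Turn G d.1.1 (tv d) (tv (h.rot d)) ∨
    (24 ≤ wt h.net.φ Orig d ∧ ¬ Turn G d.1.1 (tv d) (tv (h.rot d)) ∧
      ¬ Turn G d.1.1 (tv (h.rot d)) (tv d)) := by
  have h4 : h.net.φ (h.net.φ (h.net.φ d)) = h.net.φ.symm d := by
    rw [Equiv.eq_symm_apply]; exact (orb_of_card_four hk).1
  have a := h.φ_adj d
  have a' := h.φ_adj (h.net.φ d)
  have er : (h.net.φ (h.net.φ d)).1.2 = (h.rot d).1.2 := by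
    rw [h.rot_snd hi, ← h4, h.φφ_fst]
  have o1 := h.net.φ_left d
  have o2 := h.net.φ_left (h.net.φ d)
  have o3 := h.net.φ_left (h.net.φ (h.net.φ d))
  have o4 : 0 ≤ ori (h.net.φ d).1.1 (h.net.φ d).1.2 d.1.1 := h.net.sameCycle_left
    (mem_orb.1 (apply_mem_orb (self_mem_orb _))).symm
  rw [h4, h.net.φ_symm_snd, h.φφ_fst] at o3
  rw [h.net.φ_fst] at o2 o4
  rw [er] at o2 o3 a'
  have ar : NAdj S G d.1.1 (h.rot d).1.2 := by
    have := (h.rot d).adj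
    rwa [h.rot_fst hi] at this
  set x := (h.net.φ d).1.2 with hx
  obtain ⟨e1, e2, e3⟩ := lab_spec a
  obtain ⟨f1, f2, f3⟩ := lab_spec a'
  have t1 : tv d = lab G d.1.2 x :=
    h.tv_eq hq e1 (h.inO_of_inC e1 hq e2) (lab_ne d.adj a o1.ne').symm
  have t2 : tv (h.rot d) = lab G x (h.rot d).1.2 := by
    refine h.tv_eq hr f1 (h.inO_of_inC f1 hr f3) ?_
    rw [h.rot_fst hi, h.lab_comm ar]
    exact lab_ne a' (h.net.symm ar) o3.ne'
  have n1 := h.not_mem_tv hq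
  have n2 := h.not_mem_tv hr
  rw [h.rot_fst hi] at n2
  by_cases hxS : x ∈ S
  · right
    refine ⟨le_wt_of_opposite ?_ (by omega) (by rw [Orig, h.φφ_fst]; exact hxS), ?_⟩
    · exact two_le_orbP (self_mem_orb _) (apply_mem_orb (apply_mem_orb (self_mem_orb _)))
        (h.φφ_ne d).symm ho (by rw [Orig, h.φφ_fst]; exact hxS)
    · have hne := lab_ne a a' o2.ne'
      have := h.not_cr_of_mem e1 f1 hne (h.mem_of_inC e1 hxS e3) (h.mem_of_inC f1 hxS f2)
      rw [t1, t2]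
      exact ⟨fun ht => this ht.2.2.1, fun ht => this ht.2.2.1.symm⟩
  · left
    have hxx := mem_vpts_cases (h.net.mem' a) hxS
    rw [t1] at n1
    rw [t2] at n2
    rw [t1, t2]
    exact h.turn_of_darts ho e1 f1 n1 n2 e2 (h.inO_of_inC e1 hxx e3) (h.inO_of_inC f1 hxx f2) f3
      o2 o4 o3.le

end Corner

end QNet

namespace QNet
variable {S : Finset Pt} {G : Finset (Sym2 Pt)} (h : QNet S G)
include h

theorem mem_xpts_of_not_mem {d : QDart S G} (hd : d.1.2 ∉ S) : d.1.2 ∈ xpts G :=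
  mem_vpts_cases (h.net.mem' d.adj) hd

theorem exists_last_dart {v : Pt} {s : Finset (QDart S G)} {ρ : QDart S G → QDart S G} (hv : v ∈ S)
    (hs : ∀ d ∈ s, d.1.1 = v) (hρ : ∀ d ∈ s, ρ d ∈ s) (hp : ∀ d ∈ s, 0 < ori v d.1.2 (ρ d).1.2)
    {d : QDart S G} (hd : d ∈ s) (hx : d.1.2 ∉ S) :
    ∃ d' ∈ s, d'.1.2 ∉ S ∧ tv d' = tv d ∧ ((ρ d').1.2 ∈ S ∨ tv (ρ d') ≠ tv d) := by
  obtain ⟨he, -, -⟩ := h.tv_spec (h.mem_xpts_of_not_mem hx)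
  have hve := h.not_mem_tv (h.mem_xpts_of_not_mem hx)
  rw [hs d hd] at hve
  obtain ⟨a, b, hab, ho⟩ := h.exists_direct hv he hve
  have hne : a ≠ b := by rintro rfl; rw [ori_self_right] at ho; exact lt_irrefl _ ho
  obtain ⟨F, hF, F0, F1⟩ := exists_aff_sep hne
  obtain ⟨m, hm, hmax⟩ := Finset.exists_max_image (s.filter fun d' => d'.1.2 ∉ S ∧ tv d' = tv d)
    (fun d' => F d'.1.2) ⟨d, Finset.mem_filter.2 ⟨hd, hx, rfl⟩⟩
  obtain ⟨m1, m2, m3⟩ := Finset.mem_filter.1 hm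
  refine ⟨m, m1, m2, m3, ?_⟩
  by_contra hcon
  push Not at hcon
  have hle := hmax _ (Finset.mem_filter.2 ⟨hρ m m1, hcon⟩)
  have i1 := (h.tv_spec (h.mem_xpts_of_not_mem m2)).2.1
  have i2 := (h.tv_spec (h.mem_xpts_of_not_mem hcon.1)).2.1
  rw [m3, hab] at i1
  rw [hcon.2, hab] at i2
  have hpos := hp m m1
  obtain ⟨α, -, -, e1⟩ := inO_mk.1 i1
  obtain ⟨β, -, -, e2⟩ := inO_mk.1 i2
  rw [e1, e2] at hpos
  simp only [e1, e2, hF.lerp, F0, F1] at hle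
  have : ori v (lerp a b α) (lerp a b β) = (β - α) * ori v a b := by
    simp only [ori, lerp]; ring
  rw [this] at hpos
  have := (mul_pos_iff_of_pos_right ho).1 hpos
  linarith

omit h in
theorem _root_.ori_pos_of_mem {v u u' q r : Pt} {e : Sym2 Pt} (hu : u ∈ e) (hu' : u' ∈ e) (hr : InO e r)
    (hq : InO e q) (h1 : 0 < ori v u r) (h2 : 0 < ori v q u') : 0 < ori v u u' := by
  by_cases huu : u = u'
  · subst huu
    obtain ⟨t, t0, rfl⟩ := hr.exists_lerp hu hq
    have : ori v (lerp u r t) u = -(t * ori v u r) := by simp only [ori, lerp]; ring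
    rw [this] at h2
    have := mul_pos t0 h1
    linarith
  · rw [(Sym2.mem_and_mem_iff huu).1 ⟨hu, hu'⟩] at hr
    obtain ⟨t, t0, -, rfl⟩ := inO_mk.1 hr
    have : ori v u (lerp u u' t) = t * ori v u u' := by simp only [ori, lerp]; ring
    rw [this] at h1
    exact (mul_pos_iff_of_pos_left t0).1 h1

theorem rosette {v : Pt} (hv : v ∈ S)
    (hin : ∀ q, NAdj S G v q → (v, q) ∈ innerDarts (vpts S G) (NAdj S G)) :
    Rosette (Finset.univ.filter fun d : QDart S G => d.1.1 = v) h.rot (wt h.net.φ Orig)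
      (fun d => d.1.2 ∈ S) tv (fun d => d.1.2) (fun u e => u ∈ e) (fun u u' => 0 < ori v u u')
      (Turn G v) := by
  have hs : ∀ d : QDart S G, d ∈ Finset.univ.filter (fun d : QDart S G => d.1.1 = v) ↔
      d.1.1 = v := fun d => by simp
  have hi : ∀ d : QDart S G, d.1.1 = v → ∀ q, NAdj S G d.1.1 q →
      (d.1.1, q) ∈ innerDarts (vpts S G) (NAdj S G) := fun d hd => by rw [hd]; exact hin
  have hor : ∀ d : QDart S G, d.1.1 = v → Orig d := fun d hd => by rw [Orig, hd]; exact hv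
  have hmap : ∀ d : QDart S G, d.1.1 = v → (h.rot d).1.1 = v := fun d hd => by
    rw [h.rot_fst (hi d hd), hd]
  have hpos : ∀ d : QDart S G, d.1.1 = v → 0 < ori v d.1.2 (h.rot d).1.2 := fun d hd => by
    have := h.rot_pos (hi d hd); rwa [hd] at this
  have hinj : Function.Injective h.rot := revD_injective.comp h.net.φ.symm.injective
  have hx : ∀ d : QDart S G, d.1.2 ∉ S → d.1.2 ∈ xpts G := fun d => h.mem_xpts_of_not_mem
  constructor
  · intro d hd; rw [hs] at *; exact hmap d hd
  · intro d _ d' _ he; exact hinj he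
  · intro d hd
    obtain ⟨a, ha, he⟩ := Finset.surj_on_of_inj_on_of_card_le (fun d _ => h.rot d)
      (fun d hd => by rw [hs] at *; exact hmap d hd) (fun _ _ _ _ he => hinj he) le_rfl d hd
    exact ⟨a, ha, he.symm⟩
  · intro d hd; rw [hs] at hd; exact h.rot_ne (hi d hd)
  · intro d _; exact wt_nonneg
  · intro d hd h1 h2
    rw [hs] at hd
    by_cases k3 : (orb h.net.φ d).card = 3
    · obtain ⟨g, -, g1, -, g2⟩ := h.corner_tri (hi d hd) k3
      exact Or.inl ((g1 (hx _ h1)).trans (g2 (hx _ h2)).symm)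
    · right
      by_cases k4 : (orb h.net.φ d).card = 4
      · have := h.corner_quad (hi d hd) (hor d hd) k4 (hx _ h1) (hx _ h2)
        rw [hd] at this
        exact this.imp (fun ht => ⟨le_wt_of_card k3, ht⟩) Or.inl
      · exact Or.inr (Or.inr (wt_of_card_ne k3 k4).ge)
  · intro d hd h1 h2
    rw [hs] at hd
    have h3 := h.corner_two (hi d hd) (hor d hd) (Or.inl h1)
    by_cases k3 : (orb h.net.φ d).card = 3
    · obtain ⟨g, g1, -, -, g2⟩ := h.corner_tri (hi d hd) k3
      refine Or.inl ⟨le_wt_of_two h3, ?_⟩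
      rw [g2 (hx _ h2)]
      exact g1 h1
    · exact Or.inr (le_wt_of_two_of_card h3 k3)
  · intro d hd h1 h2
    rw [hs] at hd
    have h3 := h.corner_two (hi d hd) (hor d hd) (Or.inr h2)
    by_cases k3 : (orb h.net.φ d).card = 3
    · obtain ⟨g, -, g1, g2, -⟩ := h.corner_tri (hi d hd) k3
      refine Or.inl ⟨le_wt_of_two h3, ?_⟩
      rw [g1 (hx _ h1)]
      exact g2 h2
    · exact Or.inr (le_wt_of_two_of_card h3 k3)
  · intro d hd h1 h2
    rw [hs] at hd
    exact ⟨le_wt_of_three (h.corner_full (hi d hd) (hor d hd) h1 h2), hpos d hd⟩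
  · intro d hd h1
    exact h.exists_last_dart hv (fun d hd => (hs d).1 hd)
      (fun d hd => by rw [hs] at *; exact hmap d hd) (fun d hd => hpos d ((hs d).1 hd)) hd h1
  · intro u u' h1 h2
    rw [ori_swap_right] at h2
    linarith
  · intro a ha b hb _ h2 h3 _ h5 h6 h7
    rw [hs] at ha hb
    have i1 := (h.tv_spec (hx _ h2)).2.1
    rw [h5] at i1
    exact ori_pos_of_mem h6 h7 i1 (h.tv_spec (hx _ h3)).2.1 (hpos a ha) (hpos b hb)
  · intro e e' h1; exact h1.asymm
  · intro e e' e'' h1 h2 h3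
    exact h.qp h1.1 h1.2.1 h2.2.1 h1.ne h2.ne h3.ne.symm h1.2.2.1 h2.2.2.1 h3.2.2.1.symm
  · intro u e e' h1 h2 h3
    exact h.not_cr_of_mem h3.1 h3.2.1 h3.ne h1 h2 h3.2.2.1

theorem exists_adj_of_mem {v w : Pt} (hv : v ∈ S) (hw : w ∈ S) (hvw : v ≠ w) :
    ∃ q, NAdj S G v q := by
  obtain ⟨F, hF, F0, F1⟩ := exists_aff_sep hvw
  obtain ⟨q, hq, -⟩ := h.net.ext (mem_vpts_of_mem hv) (mem_vpts_of_mem hw) hF (by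
    rw [F0, F1]; exact one_pos)
  exact ⟨q, hq⟩

theorem sum_wt_ge {v w : Pt} (hv : v ∈ S) (hw : w ∈ S) (hvw : v ≠ w)
    (hin : ∀ q, NAdj S G v q → (v, q) ∈ innerDarts (vpts S G) (NAdj S G)) :
    42 ≤ ∑ d ∈ Finset.univ.filter (fun d : QDart S G => d.1.1 = v), wt h.net.φ Orig d := by
  obtain ⟨q, hq⟩ := h.exists_adj_of_mem hv hw hvw
  exact (h.rosette hv hin).sum_ge ⟨⟨_, hin q hq⟩, by simp⟩

end QNet

/-! ### The number of edges -/

theorem sum_card_edges {S : Finset Pt} {G : Finset (Sym2 Pt)}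
    (hG : ∀ e ∈ G, ¬ e.IsDiag ∧ ∀ p ∈ e, p ∈ S) :
    ∑ p ∈ S, (G.filter fun e => p ∈ e).card = 2 * G.card := by
  have h1 := Finset.sum_card_bipartiteAbove_eq_sum_card_bipartiteBelow (s := S) (t := G)
    (fun p e => p ∈ e)
  have h2 : ∀ e ∈ G, (Finset.bipartiteBelow (fun p e => p ∈ e) S e).card = 2 := by
    intro e he
    obtain ⟨hd, hS⟩ := hG e he
    induction e with | _ a b
    have hab : a ≠ b := fun h => hd (Sym2.mk_isDiag_iff.2 h)
    rw [← Finset.card_pair hab]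
    congr 1
    ext x
    simp only [Finset.bipartiteBelow, Finset.mem_filter, Sym2.mem_iff, Finset.mem_insert,
      Finset.mem_singleton]
    exact ⟨fun h => h.2, fun h => ⟨hS x (Sym2.mem_iff.2 h), h⟩⟩
  rw [Finset.sum_congr rfl h2, Finset.sum_const, smul_eq_mul, mul_comm] at h1
  exact h1

namespace QNet
variable {S : Finset Pt} {G : Finset (Sym2 Pt)} (h : QNet S G)
include h

/-- Two neighbours on opposite sides of a point on an edge. -/
theorem exists_adj_opposite {a b p : Pt} (he : s(a, b) ∈ G) (hp : p ∈ xpts G) (ho : OSeg a p b) :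
    ∃ q r, NAdj S G p q ∧ NAdj S G p r ∧ ori p a q = 0 ∧ ori p a r = 0 ∧
      ∀ c, ori p a c ≠ 0 → ori p c q * ori p c r < 0 := by
  obtain ⟨hab, ha, hb⟩ := h.edge he
  have hpV := mem_vpts_of_xpts (S := S) hp
  have hpS := h.not_mem_S hp
  obtain ⟨q, hq, t, t0, -, rfl⟩ := h.exists_adj_toward (Sym2.eq_swap ▸ he) hpV ho.symm.seg
    (by rintro rfl; exact hpS ha)
  obtain ⟨r, hr, u, u0, -, rfl⟩ := h.exists_adj_toward he hpV ho.seg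
    (by rintro rfl; exact hpS hb)
  obtain ⟨α, α0, α1, rfl⟩ := ho
  refine ⟨_, _, hq, hr, by simp only [ori, lerp]; ring, by simp only [ori, lerp]; ring, ?_⟩
  intro c hc
  have e1 : α * ori (lerp a b α) c (lerp (lerp a b α) b u) =
      u * (1 - α) * ori (lerp a b α) a c := by simp only [ori, lerp]; ring
  have e2 : ori (lerp a b α) c (lerp (lerp a b α) a t) = -(t * ori (lerp a b α) a c) := by
    simp only [ori, lerp]; ring
  have h1 : 0 < t * u * (1 - α) * (ori (lerp a b α) a c) ^ 2 := by
    have : 0 < 1 - α := by linarith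
    positivity
  have h2 : α * (ori (lerp a b α) c (lerp (lerp a b α) a t) *
      ori (lerp a b α) c (lerp (lerp a b α) b u)) =
      -(t * u * (1 - α) * (ori (lerp a b α) a c) ^ 2) := by
    rw [mul_left_comm, e1, e2]; ring
  by_contra hcon
  push Not at hcon
  have := mul_nonneg α0.le hcon
  linarith

theorem four_le_card {p : Pt} (hp : p ∈ xpts G) :
    4 ≤ ((PlaneNet.darts (vpts S G) (NAdj S G)).filter fun x => x.1 = p).card := by
  obtain ⟨a, b, c, d, he, hf, -, h1, h2, ho⟩ := h.exists_transversal hp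
  obtain ⟨q, r, aq, ar, q0, r0, hqr⟩ := h.exists_adj_opposite he hp h1
  obtain ⟨s, t, aps, apt, s0, t0, hst⟩ := h.exists_adj_opposite hf hp h2
  have ho' : ori p c a ≠ 0 := by rw [ori_swap_right]; exact neg_ne_zero.2 ho
  have k1 := hqr c ho
  have k2 := hst a ho'
  have n1 : q ≠ r := by rintro rfl; nlinarith
  have n2 : s ≠ t := by rintro rfl; nlinarith
  have n3 : q ≠ s := by rintro rfl; rw [q0, zero_mul] at k2; exact lt_irrefl _ k2
  have n4 : q ≠ t := by rintro rfl; rw [q0, mul_zero] at k2; exact lt_irrefl _ k2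
  have n5 : r ≠ s := by rintro rfl; rw [r0, zero_mul] at k2; exact lt_irrefl _ k2
  have n6 : r ≠ t := by rintro rfl; rw [r0, mul_zero] at k2; exact lt_irrefl _ k2
  have h4 : ({(p, q), (p, r), (p, s), (p, t)} : Finset (Pt × Pt)).card = 4 := by
    rw [Finset.card_insert_of_notMem, Finset.card_insert_of_notMem, Finset.card_pair] <;>
      simp [*]
  rw [← h4]
  refine Finset.card_le_card fun x hx => ?_
  have hm : ∀ z, NAdj S G p z → (p, z) ∈
      (PlaneNet.darts (vpts S G) (NAdj S G)).filter fun x => x.1 = p := fun z hz =>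
    Finset.mem_filter.2 ⟨Finset.mem_filter.2
      ⟨Finset.mem_product.2 ⟨h.net.mem hz, h.net.mem' hz⟩, hz⟩, rfl⟩
  simp only [Finset.mem_insert, Finset.mem_singleton] at hx
  rcases hx with rfl | rfl | rfl | rfl <;> exact hm _ ‹_›

theorem card_edges_le {v : Pt} (hv : v ∈ S) : (G.filter fun e => v ∈ e).card ≤
    ((PlaneNet.darts (vpts S G) (NAdj S G)).filter fun x => x.1 = v).card := by
  refine (Finset.card_le_card fun e he => ?_).trans
    (Finset.card_image_le (f := fun x : Pt × Pt => lab G x.1 x.2))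
  obtain ⟨he, hve⟩ := Finset.mem_filter.1 he
  obtain ⟨w, rfl⟩ := hve
  obtain ⟨hvw, -, hw⟩ := h.edge he
  obtain ⟨q, hq, t, t0, t1, rfl⟩ := h.exists_adj_toward he (mem_vpts_of_mem hv) (Seg.left _ _) hvw
  refine Finset.mem_image.2 ⟨(v, lerp v w t), Finset.mem_filter.2 ⟨Finset.mem_filter.2
    ⟨Finset.mem_product.2 ⟨h.net.mem hq, h.net.mem' hq⟩, hq⟩, rfl⟩, ?_⟩
  exact h.lab_eq hq he (inC_of_mem (Sym2.mem_mk_left _ _)) (inC_mk.2 ⟨t, t0.le, t1, rfl⟩)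

theorem card_le (h2 : 2 ≤ S.card) : 2 * G.card + 20 ≤ 13 * S.card := by
  set V := vpts S G with hV
  set A := NAdj S G with hA
  set D := PlaneNet.darts V A with hD
  set I := innerDarts V A with hI
  have mD : ∀ x, x ∈ D ↔ A x.1 x.2 := fun x => by
    refine ⟨fun hx => (Finset.mem_filter.1 hx).2, fun hx => Finset.mem_filter.2
      ⟨Finset.mem_product.2 ⟨h.net.mem hx, h.net.mem' hx⟩, hx⟩⟩
  have hID : I ⊆ D := fun x hx => (mD x).2 (Finset.mem_filter.1 hx).2.1
  have hSne : S.Nonempty := Finset.card_pos.1 (by omega)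
  have hVne : V.Nonempty := hSne.mono fun x hx => mem_vpts_of_mem hx
  have euler : D.card + 2 ≤ 2 * (faces h.net.φ).card + 2 * V.card := h.net.card_darts_le hVne
  have wle := h.sum_wt_le
  set O := D.filter fun x => x.1 ∈ S with hO
  set C := D.filter fun x => x.1 ∉ S with hC
  set J := I.filter fun x => x.1 ∈ S with hJ
  have cD : O.card + C.card = D.card := Finset.card_filter_add_card_filter_not _
  have CI : C = I.filter fun x => x.1 ∉ S := by
    ext x
    simp only [hC, Finset.mem_filter]
    refine and_congr_left fun hx => ⟨fun h1 => ?_, fun h1 => hID h1⟩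
    have h1 := (mD x).1 h1
    exact h.inner_of_xpts h1 (Or.inl (mem_vpts_cases (h.net.mem h1) hx))
  have cI : J.card + C.card = I.card := by
    rw [CI]; exact Finset.card_filter_add_card_filter_not _
  have cK : Fintype.card (QDart S G) = I.card := Fintype.card_coe _
  have cJ : (Finset.univ.filter (Orig : QDart S G → Prop)).card = J.card := by
    refine Finset.card_bij (fun d _ => d.1) (fun d hd => ?_) (fun _ _ _ _ he => Subtype.ext he)
      fun x hx => ?_
    · exact Finset.mem_filter.2 ⟨d.2, (Finset.mem_filter.1 hd).2⟩
    · obtain ⟨h1, h2⟩ := Finset.mem_filter.1 hx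
      exact ⟨⟨x, h1⟩, Finset.mem_filter.2 ⟨Finset.mem_univ _, h2⟩, rfl⟩
  have cV : V.card = S.card + (xpts G).card := by
    rw [hV, vpts, Finset.card_union_of_disjoint]
    rw [Finset.disjoint_left]
    exact fun x hx hx' => h.not_mem_S hx' hx
  have cX : 4 * (xpts G).card ≤ C.card := by
    rw [Finset.card_eq_sum_card_fiberwise (f := Prod.fst) (t := xpts G), mul_comm]
    · refine Finset.card_nsmul_le_sum _ _ 4 fun p hp => (h.four_le_card hp).trans
        (Finset.card_le_card fun x hx => ?_)
      obtain ⟨h1, rfl⟩ := Finset.mem_filter.1 hx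
      exact Finset.mem_filter.2 ⟨Finset.mem_filter.2 ⟨h1, h.not_mem_S hp⟩, rfl⟩
    · intro x hx
      obtain ⟨h1, h2⟩ := Finset.mem_filter.1 hx
      exact mem_vpts_cases (h.net.mem ((mD x).1 h1)) h2
  have cG : 2 * G.card ≤ O.card := by
    rw [← sum_card_edges (S := S) (G := G)]
    · rw [Finset.card_eq_sum_card_fiberwise (f := Prod.fst) (t := S)]
      · refine Finset.sum_le_sum fun p hp => (h.card_edges_le hp).trans
          (Finset.card_le_card fun x hx => ?_)
        obtain ⟨h1, rfl⟩ := Finset.mem_filter.1 hx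
        exact Finset.mem_filter.2 ⟨Finset.mem_filter.2 ⟨h1, hp⟩, rfl⟩
      · exact fun x hx => (Finset.mem_filter.1 hx).2
    · intro e he
      exact ⟨fun hd => by
        induction e with | _ a b
        exact (h.edge he).1 (Sym2.mk_isDiag_iff.1 hd), fun p hp => h.mem_S he hp⟩
  set R := S.filter fun v => ∀ q, A v q → (v, q) ∈ I with hR
  have cR : R.card + (S.filter fun v => ¬ ∀ q, A v q → (v, q) ∈ I).card = S.card :=
    Finset.card_filter_add_card_filter_not _
  have cO : (S.filter fun v => ¬ ∀ q, A v q → (v, q) ∈ I).card ≤ (O \ J).card := by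
    refine (Finset.card_le_card fun v hv => ?_).trans (Finset.card_image_le (f := Prod.fst))
    obtain ⟨h1, h2⟩ := Finset.mem_filter.1 hv
    push Not at h2
    obtain ⟨q, h3, h4⟩ := h2
    refine Finset.mem_image.2 ⟨(v, q), Finset.mem_sdiff.2 ⟨Finset.mem_filter.2
      ⟨(mD _).2 h3, h1⟩, fun h5 => h4 (Finset.mem_filter.1 h5).1⟩, rfl⟩
  have cOJ : (O \ J).card + J.card = O.card :=
    Finset.card_sdiff_add_card_eq_card (Finset.filter_subset_filter _ hID)
  have wge : (42 * R.card : ℤ) ≤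
      ∑ d : QDart S G, (if Orig d then wt h.net.φ Orig d else 0) := by
    have h3 : ∀ v ∈ R, (42 : ℤ) ≤ ∑ d : QDart S G, if v = d.1.1 then wt h.net.φ Orig d else 0 := by
      intro v hv
      obtain ⟨h4, h5⟩ := Finset.mem_filter.1 hv
      obtain ⟨w, hw, hvw⟩ := Finset.exists_mem_ne (s := S) (by omega) v
      have := h.sum_wt_ge h4 hw hvw.symm h5
      rw [Finset.sum_filter] at this
      simpa only [eq_comm] using this
    have h4 := Finset.card_nsmul_le_sum R _ (42 : ℤ) h3
    rw [Finset.sum_comm, nsmul_eq_mul, mul_comm] at h4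
    refine h4.trans (Finset.sum_le_sum fun d _ => ?_)
    rw [Finset.sum_ite_eq']
    split_ifs with h5 h6 h6
    · exact le_rfl
    · exact absurd (Finset.mem_filter.1 h5).1 h6
    · exact wt_nonneg
    · exact le_rfl
  have key := wge.trans wle
  rw [cK, cJ] at key
  omega

end QNet

/-! ### Counting -/

theorem GenPos.subset {S S' : Finset Pt} (hS : GenPos S) (h : S' ⊆ S) : GenPos S' :=
  fun _ ha _ hb _ hc => hS _ (h ha) _ (h hb) _ (h hc)

theorem isQuasiPlane_three_iff {S : Finset Pt} {G : Finset (Sym2 Pt)} :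
    IsQuasiPlane 3 S G ↔ (∀ e ∈ G, ¬ e.IsDiag ∧ ∀ p ∈ e, p ∈ S) ∧ ∀ e ∈ G, ∀ f ∈ G, ∀ g ∈ G,
      e ≠ f → f ≠ g → e ≠ g → Cr e f → Cr f g → Cr e g → False := by
  refine and_congr_right fun _ => ⟨fun h e he f hf g hg hef hfg heg c1 c2 c3 => h ?_, ?_⟩
  · refine ⟨{e, f, g}, ?_, Finset.card_eq_three.2 ⟨e, f, g, hef, heg, hfg, rfl⟩, ?_⟩
    · intro x hx
      simp only [Finset.mem_insert, Finset.mem_singleton] at hx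
      rcases hx with rfl | rfl | rfl <;> assumption
    · intro x hx y hy hxy
      rw [edgesCross_iff]
      simp only [Finset.mem_insert, Finset.mem_singleton] at hx hy
      rcases hx with rfl | rfl | rfl <;> rcases hy with rfl | rfl | rfl <;>
        first | exact absurd rfl hxy | assumption | (apply Cr.symm; assumption)
  · rintro h ⟨T, hT, hc, hp⟩
    obtain ⟨e, f, g, hef, heg, hfg, rfl⟩ := Finset.card_eq_three.1 hc
    have me : e ∈ ({e, f, g} : Finset (Sym2 Pt)) := by simp
    have mf : f ∈ ({e, f, g} : Finset (Sym2 Pt)) := by simp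
    have mg : g ∈ ({e, f, g} : Finset (Sym2 Pt)) := by simp
    exact h e (hT me) f (hT mf) g (hT mg) hef hfg heg (edgesCross_iff.1 (hp e me f mf hef))
      (edgesCross_iff.1 (hp f mf g mg hfg)) (edgesCross_iff.1 (hp e me g mg heg))

theorem IsQuasiPlane.subset {k : ℕ} {S : Finset Pt} {G G' : Finset (Sym2 Pt)}
    (h : IsQuasiPlane k S G) (hG : G' ⊆ G) : IsQuasiPlane k S G' :=
  ⟨fun e he => h.1 e (hG he), fun ⟨T, hT, hr⟩ => h.2 ⟨T, hT.trans hG, hr⟩⟩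

theorem mem_qpGraphs {k : ℕ} {S : Finset Pt} {G : Finset (Sym2 Pt)} :
    G ∈ qpGraphs k S ↔ IsQuasiPlane k S G := by
  refine ⟨fun h => (Finset.mem_filter.1 h).2, fun h => Finset.mem_filter.2 ⟨?_, h⟩⟩
  exact Finset.mem_powerset.2 fun e he => Finset.mem_sym2_iff.2 (h.1 e he).2

theorem QNet.of_maximal {S : Finset Pt} {G : Finset (Sym2 Pt)} (hS : GenPos S)
    (hG : Maximal (· ∈ qpGraphs 3 S) G) : QNet S G := by
  have hq := mem_qpGraphs.1 hG.prop
  obtain ⟨h1, h2⟩ := isQuasiPlane_three_iff.1 hq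
  refine ⟨hS, fun {a b} he => ?_, ?_, ?_⟩
  · obtain ⟨h3, h4⟩ := h1 _ he
    exact ⟨fun hab => h3 (Sym2.mk_isDiag_iff.2 hab), h4 a (Sym2.mem_mk_left _ _),
      h4 b (Sym2.mem_mk_right _ _)⟩
  · intro e f g he hf hg hef hfg heg c1 c2 c3
    exact h2 e he f hf g hg hef hfg heg c1 c2 c3
  · intro a b ha hb hab hn
    by_contra! hcon
    refine hn (hG.le_of_ge (y := insert s(a, b) G) (mem_qpGraphs.2 (isQuasiPlane_three_iff.2
      ⟨?_, ?_⟩)) (Finset.subset_insert _ _) (Finset.mem_insert_self _ _))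
    · intro e he
      rcases Finset.mem_insert.1 he with rfl | he
      · refine ⟨fun hd => hab (Sym2.mk_isDiag_iff.1 hd), fun p hp => ?_⟩
        rcases Sym2.mem_iff.1 hp with rfl | rfl <;> assumption
      · exact h1 e he
    · intro e he f hf g hg hef hfg heg c1 c2 c3
      rcases Finset.mem_insert.1 he with rfl | he'
      · exact hcon f (Finset.mem_of_mem_insert_of_ne hf hef.symm) g
          (Finset.mem_of_mem_insert_of_ne hg heg.symm) hfg c2 c1.symm c3.symm
      · rcases Finset.mem_insert.1 hf with rfl | hf'
        · exact hcon e he' g (Finset.mem_of_mem_insert_of_ne hg hfg.symm) heg c3 c1 c2.symm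
        · rcases Finset.mem_insert.1 hg with rfl | hg'
          · exact hcon e he' f hf' hef c1 c3 c2
          · exact h2 e he' f hf' g hg' hef hfg heg c1 c2 c3

/-- A quasi-plane graph on `n` points has at most `6.5 n` edges. -/
theorem two_mul_card_le {S : Finset Pt} {G : Finset (Sym2 Pt)} (hS : GenPos S)
    (hG : G ∈ qpGraphs 3 S) : 2 * G.card ≤ 13 * S.card := by
  by_cases h2 : 2 ≤ S.card
  · obtain ⟨G', hle, hmax⟩ := (qpGraphs 3 S).exists_le_maximal hG
    have h3 := (QNet.of_maximal hS hmax).card_le h2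
    have h4 := Finset.card_le_card hle
    omega
  · have : G = ∅ := by
      refine Finset.eq_empty_of_forall_notMem fun e he => ?_
      obtain ⟨h3, h4⟩ := (mem_qpGraphs.1 hG).1 e he
      induction e with | _ a b
      exact h3 (Sym2.mk_isDiag_iff.2 (Finset.card_le_one.1 (by omega) _
        (h4 a (Sym2.mem_mk_left _ _)) _ (h4 b (Sym2.mem_mk_right _ _))))
    simp [this]

theorem two_mul_sum_card_powerset {α : Type*} (s : Finset α) :
    2 * ∑ t ∈ s.powerset, t.card = s.card * 2 ^ s.card := by
  have h1 : ∑ t ∈ s.powerset, t.card = ∑ t ∈ s.powerset, (s \ t).card := by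
    refine Finset.sum_bij' (fun t _ => s \ t) (fun t _ => s \ t) ?_ ?_ ?_ ?_ ?_
    · exact fun t _ => Finset.mem_powerset.2 Finset.sdiff_subset
    · exact fun t _ => Finset.mem_powerset.2 Finset.sdiff_subset
    · exact fun t ht => Finset.sdiff_sdiff_eq_self (Finset.mem_powerset.1 ht)
    · exact fun t ht => Finset.sdiff_sdiff_eq_self (Finset.mem_powerset.1 ht)
    · exact fun t ht => by rw [Finset.sdiff_sdiff_eq_self (Finset.mem_powerset.1 ht)]
  have h2 : ∀ t ∈ s.powerset, t.card + (s \ t).card = s.card := fun t ht => by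
    rw [add_comm, Finset.card_sdiff_add_card_eq_card (Finset.mem_powerset.1 ht)]
  rw [two_mul]
  nth_rewrite 2 [h1]
  rw [← Finset.sum_add_distrib, Finset.sum_congr rfl h2, Finset.sum_const, smul_eq_mul,
    Finset.card_powerset, mul_comm]

theorem mul_two_pow_le (a : ℕ) : 27 * 2 ^ a ≤ a * 2 ^ a + 2 ^ 26 := by
  rcases le_or_gt 27 a with h | h
  · exact (Nat.mul_le_mul_right _ h).trans (Nat.le_add_right _ _)
  · interval_cases a <;> norm_num

section Fiber
variable {S : Finset Pt} {p : Pt}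

/-- The edges at `p` that can be added to `G`. -/
def freeEdges (S : Finset Pt) (p : Pt) (G : Finset (Sym2 Pt)) : Finset (Sym2 Pt) :=
  S.sym2.filter fun e => p ∈ e ∧ IsQuasiPlane 3 S (insert e G)

theorem not_cr_of_mem_both (hS : GenPos S) {e f : Sym2 Pt} (he : ¬ e.IsDiag ∧ ∀ q ∈ e, q ∈ S)
    (hf : ¬ f.IsDiag ∧ ∀ q ∈ f, q ∈ S) (hef : e ≠ f) (hpe : p ∈ e) (hpf : p ∈ f) : ¬ Cr e f := by
  obtain ⟨a, rfl⟩ := hpe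
  obtain ⟨b, rfl⟩ := hpf
  rintro ⟨z, h1, h2⟩
  have hpa : p ≠ a := fun h => he.1 (Sym2.mk_isDiag_iff.2 h)
  have hpb : p ≠ b := fun h => hf.1 (Sym2.mk_isDiag_iff.2 h)
  have hab : a ≠ b := fun h => hef (by rw [h])
  have ho := hS.ori_ne_zero (he.2 p (Sym2.mem_mk_left _ _)) (he.2 a (Sym2.mem_mk_right _ _))
    (hf.2 b (Sym2.mem_mk_right _ _)) hpa hpb hab
  obtain ⟨t, t0, t1, rfl⟩ := inO_mk.1 h1
  obtain ⟨u, u0, u1, h3⟩ := inO_mk.1 h2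
  have h4 : t * ori p a b = ori p (lerp p a t) b := by simp only [ori, lerp]; ring
  have h5 : ori p (lerp p b u) b = 0 := by simp only [ori, lerp]; ring
  rw [h3, h5] at h4
  exact mul_ne_zero t0.ne' ho h4

theorem isQuasiPlane_union (hS : GenPos S) {G T : Finset (Sym2 Pt)}
    (hG : IsQuasiPlane 3 (S.erase p) G) (hT : T ⊆ freeEdges S p G) : IsQuasiPlane 3 S (G ∪ T) := by
  obtain ⟨g1, g2⟩ := isQuasiPlane_three_iff.1 hG
  have hT' : ∀ e ∈ T, p ∈ e ∧ IsQuasiPlane 3 S (insert e G) := fun e he =>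
    (Finset.mem_filter.1 (hT he)).2
  have ht : ∀ e ∈ T, ¬ e.IsDiag ∧ ∀ q ∈ e, q ∈ S := fun e he =>
    (hT' e he).2.1 e (Finset.mem_insert_self _ _)
  have nc : ∀ e ∈ T, ∀ f ∈ T, e ≠ f → ¬ Cr e f := fun e he f hf hef =>
    not_cr_of_mem_both hS (ht e he) (ht f hf) hef (hT' e he).1 (hT' f hf).1
  have n1 : ∀ e ∈ T, ∀ f ∈ G, ∀ g ∈ G, e ≠ f → f ≠ g → e ≠ g → Cr e f → Cr f g → Cr e g →
      False := fun e he f hf g hg =>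
    (isQuasiPlane_three_iff.1 (hT' e he).2).2 e (Finset.mem_insert_self _ _) f
      (Finset.mem_insert_of_mem hf) g (Finset.mem_insert_of_mem hg)
  refine isQuasiPlane_three_iff.2 ⟨fun e he => ?_, ?_⟩
  · rcases Finset.mem_union.1 he with he | he
    · exact ⟨(g1 e he).1, fun q hq => Finset.mem_of_mem_erase ((g1 e he).2 q hq)⟩
    · exact ht e he
  · intro e he f hf g hg hef hfg heg c1 c2 c3
    rcases Finset.mem_union.1 he with he | he <;> rcases Finset.mem_union.1 hf with hf | hf <;>
      rcases Finset.mem_union.1 hg with hg | hg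
    · exact g2 e he f hf g hg hef hfg heg c1 c2 c3
    · exact n1 g hg e he f hf heg.symm hef hfg.symm c3.symm c1 c2.symm
    · exact n1 f hf e he g hg hef.symm heg hfg c1.symm c3 c2
    · exact nc f hf g hg hfg c2
    · exact n1 e he f hf g hg hef hfg heg c1 c2 c3
    · exact nc e he g hg heg c3
    · exact nc e he f hf hef c1
    · exact nc e he f hf hef c1

theorem filter_not_mem_mem {G : Finset (Sym2 Pt)} (hG : G ∈ qpGraphs 3 S) :
    (G.filter fun e => p ∉ e) ∈ qpGraphs 3 (S.erase p) := by
  rw [mem_qpGraphs] at *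
  obtain ⟨h1, h2⟩ := hG.subset (Finset.filter_subset (fun e => p ∉ e) G)
  refine ⟨fun e he => ⟨(h1 e he).1, fun q hq => Finset.mem_erase.2 ⟨?_, (h1 e he).2 q hq⟩⟩, h2⟩
  rintro rfl
  exact (Finset.mem_filter.1 he).2 hq

/-- The graphs restricting to a given graph away from `p` have large average degree at `p`. -/
theorem fiber_card_le (hS : GenPos S) {G : Finset (Sym2 Pt)}
    (hG : G ∈ qpGraphs 3 (S.erase p)) :
    27 * ((qpGraphs 3 S).filter fun H => H.filter (fun e => p ∉ e) = G).card ≤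
      2 * ∑ H ∈ (qpGraphs 3 S).filter (fun H => H.filter (fun e => p ∉ e) = G),
        (H.filter fun e => p ∈ e).card + 2 ^ 26 := by
  have hG' := mem_qpGraphs.1 hG
  have hGp : ∀ e ∈ G, p ∉ e := fun e he hp => Finset.notMem_erase p S ((hG'.1 e he).2 p hp)
  have hFp : ∀ T ⊆ freeEdges S p G, ∀ e ∈ T, p ∈ e := fun T hT e he =>
    (Finset.mem_filter.1 (hT he)).2.1
  have f1 : ∀ T ⊆ freeEdges S p G, (G ∪ T).filter (fun e => p ∈ e) = T := by
    intro T hT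
    rw [Finset.filter_union, Finset.filter_false_of_mem hGp, Finset.empty_union,
      Finset.filter_true_of_mem (hFp T hT)]
  have f2 : ∀ T ⊆ freeEdges S p G, (G ∪ T).filter (fun e => p ∉ e) = G := by
    intro T hT
    rw [Finset.filter_union, Finset.filter_true_of_mem hGp,
      Finset.filter_false_of_mem fun e he => not_not.2 (hFp T hT e he), Finset.union_empty]
  have key : ∀ f : Finset (Sym2 Pt) → ℕ,
      ∑ H ∈ (qpGraphs 3 S).filter (fun H => H.filter (fun e => p ∉ e) = G),
        f (H.filter fun e => p ∈ e) = ∑ T ∈ (freeEdges S p G).powerset, f T := by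
    intro f
    refine Finset.sum_bij' (fun H _ => H.filter fun e => p ∈ e) (fun T _ => G ∪ T) ?_ ?_ ?_ ?_ ?_
    · intro H hH
      obtain ⟨h1, rfl⟩ := Finset.mem_filter.1 hH
      refine Finset.mem_powerset.2 fun e he => ?_
      obtain ⟨h2, h3⟩ := Finset.mem_filter.1 he
      rw [mem_qpGraphs] at h1
      exact Finset.mem_filter.2 ⟨Finset.mem_sym2_iff.2 (h1.1 e h2).2, h3,
        h1.subset (Finset.insert_subset h2 (Finset.filter_subset _ _))⟩
    · intro T hT
      rw [Finset.mem_powerset] at hT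
      exact Finset.mem_filter.2 ⟨mem_qpGraphs.2 (isQuasiPlane_union hS hG' hT), f2 T hT⟩
    · intro H hH
      obtain ⟨-, rfl⟩ := Finset.mem_filter.1 hH
      ext e
      simp only [Finset.mem_union, Finset.mem_filter]
      tauto
    · exact fun T hT => f1 T (Finset.mem_powerset.1 hT)
    · exact fun _ _ => rfl
  have k1 := key fun _ => 1
  have k2 := key Finset.card
  rw [Finset.sum_const, Finset.sum_const, smul_eq_mul, smul_eq_mul, mul_one, mul_one,
    Finset.card_powerset] at k1
  rw [k1, k2, two_mul_sum_card_powerset]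
  exact mul_two_pow_le _

/-- Vertex removal, summed over all graphs. -/
theorem card_qpGraphs_le (hS : GenPos S) (p : Pt) : 27 * (qpGraphs 3 S).card ≤
    2 * ∑ G ∈ qpGraphs 3 S, (G.filter fun e => p ∈ e).card +
      2 ^ 26 * (qpGraphs 3 (S.erase p)).card := by
  have hm : ∀ G ∈ qpGraphs 3 S, G.filter (fun e => p ∉ e) ∈ qpGraphs 3 (S.erase p) :=
    fun G hG => filter_not_mem_mem hG
  have h1 := Finset.sum_le_sum fun G hG => fiber_card_le (p := p) hS (G := G) hG
  rw [← Finset.mul_sum, Finset.sum_add_distrib, ← Finset.mul_sum, Finset.sum_const, smul_eq_mul,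
    Finset.sum_fiberwise_of_maps_to hm, ← Finset.card_eq_sum_card_fiberwise hm] at h1
  rwa [mul_comm (2 ^ 26)]

end Fiber

theorem card_qpGraphs_three_le (n : ℕ) : ∀ S : Finset Pt, S.card = n → GenPos S →
    (qpGraphs 3 S).card ≤ 2 ^ (26 * n) := by
  induction n with
  | zero =>
    intro S hS _
    rw [Finset.card_eq_zero] at hS
    subst hS
    refine (Finset.card_filter_le _ _).trans ?_
    simp
  | succ n ih =>
    intro S hS hgp
    have h1 := Finset.sum_le_sum fun p (_ : p ∈ S) => card_qpGraphs_le hgp p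
    have h2 : ∀ p ∈ S, (qpGraphs 3 (S.erase p)).card ≤ 2 ^ (26 * n) := fun p hp =>
      ih _ (by rw [Finset.card_erase_of_mem hp, hS]; rfl)
        (hgp.subset (Finset.erase_subset _ _))
    have h3 := Finset.sum_le_card_nsmul _ _ _ h2
    have h4 : ∀ G ∈ qpGraphs 3 S, ∑ p ∈ S, (G.filter fun e => p ∈ e).card * 2 ≤ 26 * S.card := by
      intro G hG
      rw [← Finset.sum_mul, sum_card_edges (mem_qpGraphs.1 hG).1]
      have := two_mul_card_le hgp hG
      omega
    have h5 := Finset.sum_le_card_nsmul _ _ _ h4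
    rw [Finset.sum_comm] at h5
    simp only [← Finset.sum_mul] at h5
    rw [Finset.sum_add_distrib, Finset.sum_const, ← Finset.mul_sum, ← Finset.mul_sum] at h1
    rw [hS] at h1 h3 h5
    simp only [smul_eq_mul] at h1 h3 h5
    have h6 : (n + 1) * (qpGraphs 3 S).card ≤ (n + 1) * 2 ^ (26 * (n + 1)) := by
      have e : 2 ^ (26 * (n + 1)) = 2 ^ 26 * 2 ^ (26 * n) := by rw [← pow_add]; ring_nf
      rw [e]
      nlinarith
    exact Nat.le_of_mul_le_mul_left h6 n.succ_pos

/-- Theorem 3.3. The number of 3-quasi-plane graphs on any set of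
`N ≥ 1` points in general position is at most `2 ^ (26 N)`. -/
theorem stmt18 (N : ℕ) (hN : 1 ≤ N) (S : Finset Pt) (hS : S.card = N)
    (hgp : GenPos S) :
    (qpGraphs 3 S).card ≤ 2 ^ (26 * N) := by
  exact card_qpGraphs_three_le N S hS hgp
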